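/- Let F be a layered 3-graph. Then π_co(F) = 0 if and only if π_⸫(F) = 0. -/

import Mathlib

open Finset

structure ThreeGraph (V : Type*) where
  edges : Finset (Finset V)
  card_eq : ∀ e ∈ edges, e.card = 3

variable {α β : Type*}

/-- `H` contains a copy of `F`. -/
def HasCopy [DecidableEq β] (H : ThreeGraph β) (F : ThreeGraph α) : Prop :=
  ∃ φ : α → β, Function.Injective φ ∧ ∀ e ∈ F.edges, e.image φ ∈ H.edges

/-- The codegree of a pair of vertices. -/
def codeg [DecidableEq β] [Fintype β] (H : ThreeGraph β) (u v : β) : ℕ :=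
  (Finset.univ.filter (fun w => ({u, v, w} : Finset β) ∈ H.edges)).card

/-- The codegree Turán density of a 3-graph `F`. -/
noncomputable def piCo (F : ThreeGraph α) : ℝ :=
  sSup {x : ℝ | 0 ≤ x ∧ x ≤ 1 ∧ ∀ n₀ : ℕ, ∃ n : ℕ, n₀ ≤ n ∧ ∃ H : ThreeGraph (Fin n),
    ¬ HasCopy H F ∧ ∀ u v : Fin n, u ≠ v → x * n ≤ (codeg H u v : ℝ)}

/-- An `n`-vertex 3-graph is uniformly `(d, η)`-dense. -/
def UniformlyDense {n : ℕ} (H : ThreeGraph (Fin n)) (d η : ℝ) : Prop :=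
  ∀ U : Finset (Fin n),
    d * (U.card.choose 3 : ℝ) - η * (n : ℝ) ^ 3 ≤ ((H.edges.filter (fun e => e ⊆ U)).card : ℝ)

/-- The uniform Turán density of a 3-graph `F`. -/
noncomputable def piUnif (F : ThreeGraph α) : ℝ :=
  sSup {d : ℝ | 0 ≤ d ∧ d ≤ 1 ∧ ∀ η : ℝ, 0 < η → ∀ n₀ : ℕ, ∃ n : ℕ, n₀ ≤ n ∧
    ∃ H : ThreeGraph (Fin n), ¬ HasCopy H F ∧ UniformlyDense H d η}

/-- `f` is a layered function of the 3-graph with edge set `E`. -/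
def IsLayeredFunction [DecidableEq α] (E : Finset (Finset α)) (f : α → ℕ) : Prop :=
  (∀ e ∈ E, ∃ w ∈ e, ∀ u ∈ e, u ≠ w → f u < f w) ∧
  (∀ e₁ ∈ E, ∀ e₂ ∈ E, e₁.sup f = e₂.sup f → Multiset.map f e₁.val = Multiset.map f e₂.val) ∧
  (∀ e₁ ∈ E, ∀ e₂ ∈ E, ∀ u v w u' v' w' : α,
    u ≠ v → u ≠ w → v ≠ w → u' ≠ v' → u' ≠ w' → v' ≠ w' →
    e₁ = {u, v, w} → e₂ = {u', v', w'} →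
    f u = f u' → f v = f v' → f w = f w')

/-- A 3-graph is layered if it admits a layered function. -/
def IsLayered [DecidableEq α] (F : ThreeGraph α) : Prop :=
  ∃ f : α → ℕ, IsLayeredFunction F.edges f

/-- An intermediate form of Ramsey's theorem: one can pass to a sublist whose entries carry a bit
that determines the colour of all sublists of length `r + 1` starting there. -/
theorem exists_sublist_bit_determined {ι : Type*} (r : ℕ)
    (hr : ∀ m : ℕ, ∃ N : ℕ, ∀ (c : List ι → Prop) (S : List ι), N ≤ S.length →
      ∃ H : List ι, H.Sublist S ∧ H.length = m ∧
        ((∀ l : List ι, l.Sublist H → l.length = r → c l) ∨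
          (∀ l : List ι, l.Sublist H → l.length = r → ¬ c l))) (t : ℕ) :
    ∃ N : ℕ, ∀ (c : List ι → Prop) (S : List ι), N ≤ S.length →
      ∃ P : List (ι × Bool), (P.map Prod.fst).Sublist S ∧ P.length = t ∧
        ∀ (p : ι × Bool) (l : List (ι × Bool)), (p :: l).Sublist P → l.length = r →
          (c (p.1 :: l.map Prod.fst) ↔ p.2 = true) := by
  induction t with
  | zero => exact ⟨0, fun c S _ => ⟨[], by simp, rfl, by simp⟩⟩
  | succ t ih =>
    obtain ⟨N, hN⟩ := ih
    obtain ⟨M, hM⟩ := hr N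
    refine ⟨M + 1, fun c S hS => ?_⟩
    cases S with
    | nil => simp at hS
    | cons x S =>
      obtain ⟨H, hHS, hHl, hc⟩ := hM (fun l => c (x :: l)) S (by simpa using hS)
      obtain ⟨P, hPH, hPl, hP⟩ := hN c H hHl.ge
      have key : ∃ b : Bool, ∀ l : List ι, l.Sublist H → l.length = r → (c (x :: l) ↔ b = true) := by
        rcases hc with hc | hc
        · exact ⟨true, fun l h1 h2 => by simpa using hc l h1 h2⟩
        · exact ⟨false, fun l h1 h2 => by simpa using hc l h1 h2⟩
      obtain ⟨b, hb⟩ := key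
      refine ⟨(x, b) :: P, ?_, by simp [hPl], ?_⟩
      · simpa using (hPH.trans hHS)
      · intro p l hpl hl
        rcases List.sublist_cons_iff.1 hpl with h | ⟨r', h1, h2⟩
        · exact hP p l h hl
        · obtain ⟨rfl, rfl⟩ := List.cons.inj h1
          exact hb _ ((h2.map Prod.fst).trans hPH) (by simpa using hl)

/-- Ramsey's theorem for two colours, phrased with sublists of a list. -/
theorem exists_sublist_homogeneous {ι : Type*} (r m : ℕ) :
    ∃ N : ℕ, ∀ (c : List ι → Prop) (S : List ι), N ≤ S.length →
      ∃ H : List ι, H.Sublist S ∧ H.length = m ∧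
        ((∀ l : List ι, l.Sublist H → l.length = r → c l) ∨
          (∀ l : List ι, l.Sublist H → l.length = r → ¬ c l)) := by
  induction r generalizing m with
  | zero =>
    refine ⟨m, fun c S hS => ⟨S.take m, List.take_sublist _ _, by simpa using hS, ?_⟩⟩
    by_cases h : c []
    · left; intro l _ hl; rwa [List.length_eq_zero_iff.1 hl]
    · right; intro l _ hl; rwa [List.length_eq_zero_iff.1 hl]
  | succ r ih =>
    obtain ⟨N, hN⟩ := exists_sublist_bit_determined r ih (2 * m)
    refine ⟨N, fun c S hS => ?_⟩
    obtain ⟨P, hPS, hPl, hP⟩ := hN c S hS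
    have hsum : (P.filter (fun p => p.2)).length + (P.filter (fun p => !p.2)).length = P.length := by
      rw [← List.countP_eq_length_filter, ← List.countP_eq_length_filter]
      have := P.length_eq_countP_add_countP (fun p => p.2)
      simpa using this.symm
    have build : ∀ Q : List (ι × Bool), Q.Sublist P → m ≤ Q.length → ∀ b : Bool,
        (∀ p ∈ Q, p.2 = b) → ∃ H : List ι, H.Sublist S ∧ H.length = m ∧
          ∀ l : List ι, l.Sublist H → l.length = r + 1 → (c l ↔ b = true) := by
      intro Q hQ hm b hb
      refine ⟨(Q.take m).map Prod.fst, ?_, by simpa using hm, ?_⟩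
      · exact (((List.take_sublist _ _).trans hQ).map _).trans hPS
      · intro l hl hlen
        obtain ⟨l', hl', rfl⟩ := List.sublist_map_iff.1 hl
        cases l' with
        | nil => simp at hlen
        | cons p l' =>
          have h1 : (p :: l').Sublist Q := hl'.trans (List.take_sublist _ _)
          have h2 := hP p l' (h1.trans hQ) (by simpa using hlen)
          rw [hb p (h1.subset (by simp))] at h2
          simpa using h2
    by_cases hbig : m ≤ (P.filter (fun p => p.2)).length
    · obtain ⟨H, h1, h2, h3⟩ := build _ List.filter_sublist hbig true (by simp)
      exact ⟨H, h1, h2, Or.inl fun l h h' => (h3 l h h').2 rfl⟩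
    · obtain ⟨H, h1, h2, h3⟩ := build _ (List.filter_sublist (p := fun p => !p.2)) (by omega) false
        (by simp)
      exact ⟨H, h1, h2, Or.inr fun l h hl => by simpa using (h3 l h hl)⟩

/-- The set of points satisfying `P` has density at least `β`. -/
def Large {Ω : Type*} [Fintype Ω] (β : ℝ) (P : Ω → Prop) : Prop :=
  β * Fintype.card Ω ≤ Nat.card {ω // P ω}

theorem large_iff {Ω : Type*} [Fintype Ω] {β : ℝ} {P : Ω → Prop} [DecidablePred P] :
    Large β P ↔ β * Fintype.card Ω ≤ #{ω | P ω} := by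
  unfold Large
  rw [Nat.card_eq_fintype_card, Fintype.card_subtype]

theorem Large.mono {Ω : Type*} [Fintype Ω] {β β' : ℝ} {P Q : Ω → Prop} (h : Large β P)
    (hβ : β' ≤ β) (hPQ : ∀ ω, P ω → Q ω) : Large β' Q := by
  classical
  rw [large_iff] at h ⊢
  calc β' * Fintype.card Ω ≤ β * Fintype.card Ω := by gcongr
    _ ≤ _ := h
    _ ≤ _ := by
      gcongr with ω
      exact hPQ ω

theorem Large.exists_of_forall_exists {Ω τ : Type*} [Fintype Ω] {β : ℝ} {P : Ω → Prop}
    (hP : Large β P) (s : Finset τ) (hs : s.Nonempty) (Q : τ → Ω → Prop)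
    (h : ∀ ω, P ω → ∃ t ∈ s, Q t ω) : ∃ t ∈ s, Large (β / #s) (Q t) := by
  classical
  rw [large_iff] at hP
  simp only [large_iff]
  have hcard : (0 : ℝ) < #s := by exact_mod_cast hs.card_pos
  apply Finset.exists_le_of_sum_le hs
  rw [Finset.sum_const, nsmul_eq_mul]
  calc (#s : ℝ) * (β / #s * Fintype.card Ω) = β * Fintype.card Ω := by field_simp
    _ ≤ #{ω | P ω} := hP
    _ ≤ (#(s.biUnion fun t => ({ω | Q t ω} : Finset Ω)) : ℕ) := by
      gcongr
      intro ω hω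
      simpa using h ω (by simpa using hω)
    _ ≤ ∑ t ∈ s, (#{ω | Q t ω} : ℝ) := by exact_mod_cast Finset.card_biUnion_le

/-- Among sufficiently many events of density `β`, some `k` have large intersection. -/
theorem exists_sublist_large_inter {τ : Type} (β : ℝ) (hβ : 0 < β) (k : ℕ) :
    ∃ K : ℕ, ∃ β' > 0, ∀ {Ω : Type} [Fintype Ω] (T : List τ) (Ev : τ → Ω → Prop),
      T.length = K → (∀ t ∈ T, Large β (Ev t)) →
        ∃ L : List τ, L.Sublist T ∧ L.length = k ∧ Large β' (fun ω => ∀ t ∈ L, Ev t ω) := by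
  classical
  obtain ⟨K, hK⟩ := exists_nat_ge (2 * k / β + k + 1)
  have hkK : (k : ℝ) ≤ K := by
    have : 0 ≤ 2 * k / β := by positivity
    linarith
  have hK0 : (0 : ℝ) < K := by
    have : 0 ≤ 2 * k / β := by positivity
    have : (0:ℝ) ≤ k := by positivity
    linarith
  have hkβ : 2 * k ≤ β * K := by
    have h1 : 2 * k / β ≤ K := by
      have : (0:ℝ) ≤ k := by positivity
      linarith
    rw [div_le_iff₀ hβ] at h1
    linarith
  refine ⟨K, β / 2 / 2 ^ K, by positivity, fun {Ω} _ T Ev hT hEv => ?_⟩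
  let X : Ω → ℕ := fun ω => (T.filter (fun t => Ev t ω)).length
  have hXK : ∀ ω, X ω ≤ K := fun ω => hT ▸ List.length_filter_le _ _
  have hsum : β * K * Fintype.card Ω ≤ ∑ ω, (X ω : ℝ) := by
    have h1 : ∀ T' : List τ, (∀ t ∈ T', Large β (Ev t)) → β * T'.length * Fintype.card Ω ≤
        ∑ ω, ((T'.filter (fun t => Ev t ω)).length : ℝ) := by
      intro T' hT'
      induction T' with
      | nil => simp
      | cons t T' ih =>
        have h2 := ih fun t ht => hT' t (by simp [ht])
        have h3 := large_iff.1 (hT' t (by simp))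
        have h4 : ∀ ω, (((t :: T').filter (fun t => Ev t ω)).length : ℝ) =
            (if Ev t ω then 1 else 0) + ((T'.filter (fun t => Ev t ω)).length : ℝ) := by
          intro ω
          by_cases h : Ev t ω <;> simp [h, add_comm]
        simp only [h4, Finset.sum_add_distrib, Finset.sum_boole, List.length_cons]
        push_cast
        linarith
    rw [← hT]
    exact h1 T hEv
  have hlarge : Large (β / 2) (fun ω => k ≤ X ω) := by
    rw [large_iff]
    have h1 : ∑ ω, (X ω : ℝ) ≤ ∑ ω : Ω, ((k : ℝ) + K * if k ≤ X ω then 1 else 0) := by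
      apply Finset.sum_le_sum
      intro ω _
      split_ifs with h
      · have : (X ω : ℝ) ≤ K := by exact_mod_cast hXK ω
        have : (0:ℝ) ≤ k := by positivity
        linarith
      · have : (X ω : ℝ) ≤ k := by exact_mod_cast (not_le.1 h).le
        linarith
    rw [Finset.sum_add_distrib, ← Finset.mul_sum, Finset.sum_boole, Finset.sum_const,
      nsmul_eq_mul, Finset.card_univ] at h1
    have h2 : (0:ℝ) ≤ Fintype.card Ω := by positivity
    have h3 : K * (β / 2 * Fintype.card Ω) ≤ (K:ℝ) * #{ω | k ≤ X ω} := by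
      nlinarith [mul_le_mul_of_nonneg_right hkβ h2]
    exact le_of_mul_le_mul_left h3 hK0
  set s : Finset (List τ) := T.sublists.toFinset.filter (fun L => L.length = k) with hs
  have hsne : s.Nonempty := ⟨T.take k, by
    simp only [hs, Finset.mem_filter, List.mem_toFinset, List.mem_sublists]
    refine ⟨List.take_sublist _ _, ?_⟩
    have : k ≤ K := by exact_mod_cast hkK
    simp [hT, this]⟩
  have hscard : (#s : ℝ) ≤ 2 ^ K := by
    have h1 : #s ≤ 2 ^ K := by
      calc #s ≤ #T.sublists.toFinset := Finset.card_filter_le _ _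
        _ ≤ T.sublists.length := List.toFinset_card_le _
        _ = 2 ^ K := by rw [List.length_sublists, hT]
    exact_mod_cast h1
  obtain ⟨L, hL, hlar⟩ := hlarge.exists_of_forall_exists s hsne
    (fun L ω => ∀ t ∈ L, Ev t ω) (by
      intro ω hω
      refine ⟨(T.filter (fun t => Ev t ω)).take k, ?_, ?_⟩
      · simp only [hs, Finset.mem_filter, List.mem_toFinset, List.mem_sublists]
        exact ⟨(List.take_sublist _ _).trans List.filter_sublist, by simpa using hω⟩
      · intro t ht
        have := List.mem_of_mem_take ht
        simpa using (List.mem_filter.1 this).2)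
  simp only [hs, Finset.mem_filter, List.mem_toFinset, List.mem_sublists] at hL
  refine ⟨L, hL.1, hL.2, hlar.mono ?_ fun _ h => h⟩
  have : (0:ℝ) < #s := by exact_mod_cast hsne.card_pos
  gcongr

/-- The event that `W p q` holds for every pair of entries of `l` such that `p` precedes `q`,
where `p` is marked `true` and `q` is marked `false` by the pattern `b`. -/
def PatternEvent {Ω : Type} (W : ℕ → ℕ → Ω → Prop) (l : List ℕ) (b : List Bool) (ω : Ω) : Prop :=
  (l.zip b).Pairwise fun p q => p.2 = true → q.2 = false → W p.1 q.1 ω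

/-- Every long list in which all the events `W i j` are large has a sublist for which the event of
the pattern `b` is large. -/
def Unavoidable (b : List Bool) : Prop :=
  ∀ α : ℝ, 0 < α → ∃ β : ℝ, 0 < β ∧ ∃ N : ℕ, ∀ {Ω : Type} [Fintype Ω] (W : ℕ → ℕ → Ω → Prop)
    (S : List ℕ), N ≤ S.length → (∀ i j, [i, j].Sublist S → Large α (W i j)) →
      ∃ l : List ℕ, l.Sublist S ∧ l.length = b.length ∧ Large β (PatternEvent W l b)

theorem Unavoidable.exists_homogeneous {b : List Bool} (hb : Unavoidable b) (α : ℝ) (hα : 0 < α) :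
    ∃ β : ℝ, 0 < β ∧ ∀ m : ℕ, ∃ N : ℕ, ∀ {Ω : Type} [Fintype Ω] (W : ℕ → ℕ → Ω → Prop)
      (S : List ℕ), N ≤ S.length → (∀ i j, [i, j].Sublist S → Large α (W i j)) →
        ∃ H : List ℕ, H.Sublist S ∧ H.length = m ∧
          ∀ l : List ℕ, l.Sublist H → l.length = b.length → Large β (PatternEvent W l b) := by
  obtain ⟨β, hβ, N₀, h⟩ := hb α hα
  refine ⟨β, hβ, fun m => ?_⟩
  obtain ⟨N, hN⟩ := exists_sublist_homogeneous (ι := ℕ) b.length (max m N₀)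
  refine ⟨N, fun {Ω} _ W S hS hW => ?_⟩
  obtain ⟨H, hHS, hHl, hH⟩ := hN (fun l => Large β (PatternEvent W l b)) S hS
  rcases hH with hH | hH
  · refine ⟨H.take m, (List.take_sublist _ _).trans hHS, by simp [hHl], fun l hl hlen => ?_⟩
    exact hH l (hl.trans (List.take_sublist _ _)) hlen
  · obtain ⟨l, hl, hlen, hlar⟩ := h W H (by simp [hHl]) fun i j hij => hW i j (hij.trans hHS)
    exact absurd hlar (hH l hl hlen)

theorem exists_append_of_length_eq {ι : Type*} {H : List ι} {a b c : ℕ}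
    (h : H.length = a + (b + c)) :
    ∃ X M Y : List ι, H = X ++ (M ++ Y) ∧ X.length = a ∧ M.length = b ∧ Y.length = c := by
  refine ⟨H.take a, (H.drop a).take b, (H.drop a).drop b, ?_, ?_, ?_, ?_⟩ <;> simp <;> omega

theorem patternEvent_append_iff {Ω : Type} {W : ℕ → ℕ → Ω → Prop} {X M Y : List ℕ}
    {x m y : List Bool} (hX : X.length = x.length) (hM : M.length = m.length) {ω : Ω} :
    PatternEvent W (X ++ (M ++ Y)) (x ++ (m ++ y)) ω ↔
      PatternEvent W X x ω ∧ PatternEvent W M m ω ∧ PatternEvent W Y y ω ∧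
      (∀ p ∈ X.zip x, ∀ q ∈ M.zip m, p.2 = true → q.2 = false → W p.1 q.1 ω) ∧
      (∀ p ∈ M.zip m, ∀ q ∈ Y.zip y, p.2 = true → q.2 = false → W p.1 q.1 ω) ∧
      (∀ p ∈ X.zip x, ∀ q ∈ Y.zip y, p.2 = true → q.2 = false → W p.1 q.1 ω) := by
  unfold PatternEvent
  rw [List.zip_append hX, List.zip_append hM, List.pairwise_append, List.pairwise_append]
  simp only [List.mem_append]
  constructor
  · rintro ⟨h1, ⟨h2, h3, h4⟩, h5⟩
    exact ⟨h1, h2, h3, fun p hp q hq => h5 p hp q (.inl hq), h4,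
      fun p hp q hq => h5 p hp q (.inr hq)⟩
  · rintro ⟨h1, h2, h3, h4, h5, h6⟩
    exact ⟨h1, ⟨h2, h3, h5⟩, fun p hp q hq => hq.elim (h4 p hp q) (h6 p hp q)⟩

theorem unavoidable_true_false : Unavoidable [true, false] := by
  intro α hα
  refine ⟨α, hα, 2, fun {Ω} _ W S hS hW => ?_⟩
  match S, hS, hW with
  | i :: j :: S, _, hW =>
    refine ⟨[i, j], by simp, rfl, ?_⟩
    exact (hW i j (by simp)).mono le_rfl fun ω h => by simpa [PatternEvent] using h

theorem Unavoidable.replicate {x y : List Bool} {c : Bool} (h : Unavoidable (x ++ ([c] ++ y)))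
    (k : ℕ) : Unavoidable (x ++ (List.replicate (k + 1) c ++ y)) := by
  intro α hα
  obtain ⟨β, hβ, hH⟩ := h.exists_homogeneous α hα
  obtain ⟨K, β', hβ', hK⟩ := exists_sublist_large_inter (τ := ℕ) β hβ (k + 1)
  obtain ⟨N, hN⟩ := hH (x.length + (K + y.length))
  refine ⟨β', hβ', N, fun {Ω} _ W S hS hW => ?_⟩
  obtain ⟨H, hHS, hHl, hgood⟩ := hN W S hS hW
  obtain ⟨X, M, Y, rfl, hX, hM, hY⟩ := exists_append_of_length_eq hHl
  obtain ⟨L, hLM, hLl, hL⟩ := hK M (fun t => PatternEvent W (X ++ ([t] ++ Y)) (x ++ ([c] ++ y))) hM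
    (by
      intro t ht
      refine hgood _ ?_ (by simp [hX, hY])
      gcongr
      simpa using ht)
  refine ⟨X ++ (L ++ Y), ?_, by simp [hX, hY, hLl], hL.mono le_rfl fun ω hω => ?_⟩
  · refine List.Sublist.trans ?_ hHS
    gcongr
  · simp only [patternEvent_append_iff (M := [_]) (m := [c]) hX rfl] at hω
    obtain ⟨t, ht⟩ : ∃ t, t ∈ L := List.exists_mem_of_ne_nil _ (by rintro rfl; simp at hLl)
    have hmem : ∀ p ∈ L.zip (List.replicate (k + 1) c), p.1 ∈ L ∧ p.2 = c := by
      rintro ⟨a, b⟩ hp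
      have := List.of_mem_zip hp
      exact ⟨this.1, List.eq_of_mem_replicate this.2⟩
    rw [patternEvent_append_iff hX (by simp [hLl])]
    refine ⟨(hω t ht).1, ?_, (hω t ht).2.2.1, ?_, ?_, (hω t ht).2.2.2.2.2⟩
    · refine List.pairwise_of_forall_mem_list fun p hp q hq h1 h2 => ?_
      rw [(hmem p hp).2] at h1
      rw [(hmem q hq).2, h1] at h2
      cases h2
    · intro p hp q hq h1 h2
      exact (hω _ (hmem q hq).1).2.2.2.1 p hp (q.1, c) (by simp) h1 ((hmem q hq).2 ▸ h2)
    · intro p hp q hq h1 h2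
      exact (hω _ (hmem p hp).1).2.2.2.2.1 (p.1, c) (by simp) q hq ((hmem p hp).2 ▸ h1) h2

/-- Split a list into consecutive pairs. -/
def pairUp {ι : Type*} : List ι → List (ι × ι)
  | a :: b :: l => (a, b) :: pairUp l
  | _ => []

theorem length_pairUp {ι : Type*} (K : ℕ) : ∀ l : List ι, l.length = 2 * K →
    (pairUp l).length = K := by
  induction K with
  | zero => intro l hl; simp [List.length_eq_zero_iff.1 hl, pairUp]
  | succ K ih =>
    intro l hl
    match l, hl with
    | a :: b :: l, hl =>
      rw [pairUp, List.length_cons, ih l (by simp at hl; omega)]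
    | [a], hl => simp at hl; omega
    | [], hl => simp at hl

theorem flatMap_sublist_of_sublist_pairUp {ι : Type*} : ∀ (l : List ι) (L : List (ι × ι)),
    L.Sublist (pairUp l) → (L.flatMap fun p => [p.1, p.2]).Sublist l
  | [], L, h => by simp only [pairUp, List.sublist_nil] at h; simp [h]
  | [a], L, h => by simp only [pairUp, List.sublist_nil] at h; simp [h]
  | a :: b :: l, L, h => by
    rw [pairUp] at h
    rcases List.sublist_cons_iff.1 h with hl | ⟨r, rfl, hl⟩
    · exact ((flatMap_sublist_of_sublist_pairUp l L hl).cons b).cons a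
    · simpa using flatMap_sublist_of_sublist_pairUp l r hl

theorem Unavoidable.swap {x y : List Bool} (h : Unavoidable (x ++ ([true, false] ++ y))) :
    Unavoidable (x ++ ([false, true] ++ y)) := by
  intro α hα
  obtain ⟨β, hβ, hH⟩ := h.exists_homogeneous α hα
  obtain ⟨K, β', hβ', hK⟩ := exists_sublist_large_inter (τ := ℕ × ℕ) β hβ 2
  obtain ⟨N, hN⟩ := hH (x.length + (2 * K + y.length))
  refine ⟨β', hβ', N, fun {Ω} _ W S hS hW => ?_⟩
  obtain ⟨H, hHS, hHl, hgood⟩ := hN W S hS hW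
  obtain ⟨X, M, Y, rfl, hX, hM, hY⟩ := exists_append_of_length_eq hHl
  obtain ⟨L, hLM, hLl, hL⟩ := hK (pairUp M)
    (fun t => PatternEvent W (X ++ ([t.1, t.2] ++ Y)) (x ++ ([true, false] ++ y)))
    (length_pairUp K M hM)
    (by
      intro t ht
      refine hgood _ ?_ (by simp [hX, hY])
      gcongr
      simpa using flatMap_sublist_of_sublist_pairUp M [t] (by simpa using ht))
  match L, hLl with
  | [p, q], _ =>
    have hpq := flatMap_sublist_of_sublist_pairUp M [p, q] hLM
    simp only [List.flatMap_cons, List.flatMap_nil, List.cons_append, List.nil_append] at hpq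
    refine ⟨X ++ ([p.2, q.1] ++ Y), ?_, by simp [hX, hY], hL.mono le_rfl fun ω hω => ?_⟩
    · refine List.Sublist.trans ?_ hHS
      have h1 : [p.2, q.1].Sublist [p.1, p.2, q.1, q.2] :=
        List.Sublist.cons _ (List.Sublist.cons_cons _ (List.Sublist.cons_cons _ (by simp)))
      have := h1.trans hpq
      gcongr
    · have hp := hω p (by simp)
      have hq := hω q (by simp)
      rw [patternEvent_append_iff (M := [_, _]) (m := [_, _]) hX rfl] at hp hq ⊢
      refine ⟨hp.1, by simp [PatternEvent], hp.2.2.1, ?_, ?_, hp.2.2.2.2.2⟩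
      · intro a ha b hb h1 h2
        simp only [List.zip_cons_cons, List.zip_nil_right, List.mem_cons, List.not_mem_nil,
          or_false] at hb
        rcases hb with rfl | rfl
        · exact hp.2.2.2.1 a ha (p.2, false) (by simp) h1 rfl
        · cases h2
      · intro a ha b hb h1 h2
        simp only [List.zip_cons_cons, List.zip_nil_right, List.mem_cons, List.not_mem_nil,
          or_false] at ha
        rcases ha with rfl | rfl
        · cases h1
        · exact hq.2.2.2.2.1 (q.1, true) (by simp) b hb rfl h2

theorem Unavoidable.move (x : List Bool) (k : ℕ) : ∀ y : List Bool,
    Unavoidable (x ++ (List.replicate k true ++ (false :: y))) →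
      Unavoidable (x ++ (false :: (List.replicate k true ++ y))) := by
  induction k with
  | zero => intro y h; simpa using h
  | succ k ih =>
    intro y h
    have h1 : Unavoidable ((x ++ List.replicate k true) ++ ([false, true] ++ y)) := by
      apply Unavoidable.swap
      simpa [List.replicate_succ'] using h
    have h2 := ih (true :: y) (by simpa using h1)
    simpa [List.replicate_succ'] using h2

theorem unavoidable_append (p : List Bool) : ∀ a c : ℕ,
    Unavoidable (p ++ (List.replicate (a + 1) true ++ List.replicate (c + 1) false)) := by
  induction p using List.reverseRecOn with
  | nil =>
    intro a c
    have h1 := Unavoidable.replicate (x := []) (y := [false]) (c := true)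
      unavoidable_true_false a
    have h2 := Unavoidable.replicate (x := List.replicate (a + 1) true) (y := []) (c := false)
      (by simpa using h1) c
    simpa using h2
  | append_singleton p z ih =>
    intro a c
    cases z with
    | true => simpa [List.replicate_succ] using ih (a + 1) c
    | false =>
      have h := Unavoidable.move p (a + 1) (List.replicate (c + 1) false)
        (by simpa [List.replicate_succ] using ih a (c + 1))
      simpa [List.replicate_succ] using h

theorem unavoidable (b : List Bool) : Unavoidable b := by
  intro α hα
  obtain ⟨β, hβ, N, h⟩ := unavoidable_append b 0 0 α hα
  refine ⟨β, hβ, N, fun {Ω} _ W S hS hW => ?_⟩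
  obtain ⟨l, hlS, hll, hl⟩ := h W S hS hW
  have hsplit : l = l.take b.length ++ l.drop b.length := by simp
  have hlen : (l.take b.length).length = b.length := by simp [hll]
  refine ⟨l.take b.length, (List.take_sublist _ _).trans hlS, hlen, hl.mono le_rfl fun ω hω => ?_⟩
  unfold PatternEvent at hω ⊢
  rw [hsplit, List.zip_append hlen] at hω
  exact (List.pairwise_append.1 hω).1

theorem exists_simultaneously_homogeneous (bs : List (List Bool)) (α : ℝ) (hα : 0 < α) :
    ∃ β : ℝ, 0 < β ∧ ∀ m : ℕ, ∃ N : ℕ, ∀ {Ω : Type} [Fintype Ω] (W : ℕ → ℕ → Ω → Prop)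
      (S : List ℕ), N ≤ S.length → (∀ i j, [i, j].Sublist S → Large α (W i j)) →
        ∃ H : List ℕ, H.Sublist S ∧ H.length = m ∧ ∀ b ∈ bs,
          ∀ l : List ℕ, l.Sublist H → l.length = b.length → Large β (PatternEvent W l b) := by
  induction bs with
  | nil =>
    refine ⟨1, one_pos, fun m => ⟨m, fun {Ω} _ W S hS _ => ?_⟩⟩
    exact ⟨S.take m, List.take_sublist _ _, by simpa using hS, by simp⟩
  | cons b bs ih =>
    obtain ⟨β₁, hβ₁, h₁⟩ := ih
    obtain ⟨β₂, hβ₂, h₂⟩ := (unavoidable b).exists_homogeneous α hα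
    refine ⟨min β₁ β₂, lt_min hβ₁ hβ₂, fun m => ?_⟩
    obtain ⟨N₁, hN₁⟩ := h₁ m
    obtain ⟨N₂, hN₂⟩ := h₂ N₁
    refine ⟨N₂, fun {Ω} _ W S hS hW => ?_⟩
    obtain ⟨H₂, hS₂, hl₂, hg₂⟩ := hN₂ W S hS hW
    obtain ⟨H₁, hS₁, hl₁, hg₁⟩ := hN₁ W H₂ hl₂.ge fun i j hij => hW i j (hij.trans hS₂)
    refine ⟨H₁, hS₁.trans hS₂, hl₁, fun b' hb' l hl hlen => ?_⟩
    rcases List.mem_cons.1 hb' with rfl | hb'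
    · exact (hg₂ l (hl.trans hS₁) hlen).mono (min_le_right _ _) fun _ h => h
    · exact (hg₁ b' hb' l hl hlen).mono (min_le_left _ _) fun _ h => h

/-- Given many large events indexed by pairs `i < j`, there is a subset of `s` indices such that
for every subset `B` of it, the events `W i j` with `i ∈ B` and `j ∉ B` intersect in a large
event. -/
theorem exists_strictMono_large (s : ℕ) (α : ℝ) (hα : 0 < α) :
    ∃ M : ℕ, ∃ β : ℝ, 0 < β ∧ ∀ {Ω : Type} [Fintype Ω] (W : Fin M → Fin M → Ω → Prop),
      (∀ i j, i < j → Large α (W i j)) → ∃ σ : Fin s → Fin M, StrictMono σ ∧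
        ∀ B : Fin s → Prop, Large β (fun ω => ∀ a a', a < a' → B a → ¬ B a' → W (σ a) (σ a') ω) := by
  classical
  obtain ⟨β, hβ, h⟩ := exists_simultaneously_homogeneous
    ((Finset.univ : Finset (Fin s → Bool)).toList.map List.ofFn) α hα
  obtain ⟨M, hM⟩ := h s
  refine ⟨M, β, hβ, fun {Ω} _ W hW => ?_⟩
  obtain ⟨H, hHS, hHl, hH⟩ := hM
    (fun i j ω => ∀ (hi : i < M) (hj : j < M), W ⟨i, hi⟩ ⟨j, hj⟩ ω) (List.range M) (by simp)
    (by
      intro i j hij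
      have hlt : i < j := by
        have := (List.sortedLT_range M).pairwise.sublist hij
        simpa using this
      have hjM : j < M := by simpa using hij.subset (a := j) (by simp)
      exact (hW ⟨i, hlt.trans hjM⟩ ⟨j, hjM⟩ hlt).mono le_rfl fun ω hω _ _ => hω)
  have hlt : ∀ a : Fin s, H[a.1]'(by omega) < M := fun a => by
    simpa using hHS.subset (List.getElem_mem (l := H) (n := a.1) (by omega))
  refine ⟨fun a => ⟨H[a.1]'(by omega), hlt a⟩, ?_, fun B => ?_⟩
  · intro a a' haa'
    have := (List.sortedLT_range M).pairwise.sublist hHS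
    exact List.pairwise_iff_getElem.1 this a.1 a'.1 _ _ haa'
  · refine (hH (List.ofFn fun a => decide (B a)) (by simp) H (List.Sublist.refl _)
      (by simp [hHl])).mono le_rfl fun ω hω a a' haa' hB hB' => ?_
    have := List.pairwise_iff_getElem.1 hω a.1 a'.1 (by simp [hHl]) (by simp [hHl]) haa'
    simp only [List.getElem_zip, List.getElem_ofFn, Fin.eta, decide_eq_true_eq,
      decide_eq_false_iff_not] at this
    exact this hB hB' (hlt a) (hlt a')

theorem Large.exists {Ω : Type*} [Fintype Ω] [Nonempty Ω] {β : ℝ} (hβ : 0 < β) {P : Ω → Prop}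
    (h : Large β P) : ∃ ω, P ω := by
  classical
  rw [large_iff] at h
  have h1 : (0 : ℝ) < Fintype.card Ω := by exact_mod_cast Fintype.card_pos
  have h2 : (0 : ℝ) < #{ω | P ω} := lt_of_lt_of_le (by positivity) h
  obtain ⟨ω, hω⟩ := Finset.card_pos.1 (by exact_mod_cast h2)
  exact ⟨ω, by simpa using hω⟩

theorem Large.of_forall {Ω : Type*} [Fintype Ω] {P : Ω → Prop} (h : ∀ ω, P ω) : Large 1 P := by
  classical
  rw [large_iff, Finset.filter_true_of_mem fun ω _ => h ω, Finset.card_univ, one_mul]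

theorem Large.exists_of_forall_exists_fintype {Ω τ : Type*} [Fintype Ω] [Nonempty Ω] [Fintype τ]
    {β : ℝ} (hβ : 0 < β) {P : Ω → Prop} (hP : Large β P) (Q : τ → Ω → Prop)
    (h : ∀ ω, P ω → ∃ t, Q t ω) : ∃ t, Large (β / Fintype.card τ) (Q t) := by
  obtain ⟨ω, hω⟩ := hP.exists hβ
  obtain ⟨t, -⟩ := h ω hω
  obtain ⟨t, -, ht⟩ := hP.exists_of_forall_exists Finset.univ ⟨t, Finset.mem_univ t⟩ Q
    fun ω hω => by simpa using h ω hω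
  exact ⟨t, by simpa using ht⟩

theorem large_comp_fst_iff {Ω Ω₁ Ω₂ : Type*} [Fintype Ω] [Fintype Ω₁] [Fintype Ω₂] [Nonempty Ω₂]
    (φ : Ω ≃ Ω₁ × Ω₂) {β : ℝ} {P : Ω₁ → Prop} :
    Large β (fun ω => P (φ ω).1) ↔ Large β P := by
  unfold Large
  have h1 : Nat.card {ω // P (φ ω).1} = Nat.card {ω // P ω} * Nat.card Ω₂ := by
    rw [← Nat.card_prod]
    refine Nat.card_congr ((φ.subtypeEquiv (q := fun z => P z.1) fun _ => Iff.rfl).trans ?_)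
    exact ⟨fun z => (⟨z.1.1, z.2⟩, z.1.2), fun z => ⟨(z.1.1, z.2), z.1.2⟩, fun _ => rfl,
      fun _ => rfl⟩
  rw [h1, Fintype.card_congr φ, Fintype.card_prod, Nat.card_eq_fintype_card (α := Ω₂)]
  have h2 : (0 : ℝ) < Fintype.card Ω₂ := by exact_mod_cast Fintype.card_pos
  push_cast
  rw [← mul_assoc]
  exact mul_le_mul_iff_of_pos_right h2

theorem large_comp_injective_iff {A G Y : Type} [Fintype A] [DecidableEq A] [Fintype G]
    [DecidableEq G] [Fintype Y] [Nonempty Y]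
    {ι : A → G} (hι : Function.Injective ι) {β : ℝ} {P : (A → Y) → Prop} :
    Large β (fun x : G → Y => P (x ∘ ι)) ↔ Large β P := by
  classical
  let φ : (G → Y) ≃ (A → Y) × (↥(Set.range ι)ᶜ → Y) :=
    (Equiv.arrowCongr ((Equiv.sumCongr (Equiv.ofInjective ι hι) (Equiv.refl _)).trans
      (Equiv.Set.sumCompl (Set.range ι))).symm (Equiv.refl Y)).trans
      (Equiv.sumArrowEquivProdArrow _ _ _)
  have := large_comp_fst_iff φ (β := β) (P := P)
  exact this

theorem Large.large_fibers {K Y : Type*} [Fintype K] [Fintype Y] [Nonempty Y] {β : ℝ}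
    (hβ : 0 ≤ β) {P : K × Y → Prop} (h : Large β P) :
    Large (β / 2) (fun k => Large (β / 2) fun y => P (k, y)) := by
  classical
  have hY : (0 : ℝ) < Fintype.card Y := by exact_mod_cast Fintype.card_pos
  rw [large_iff] at h ⊢
  have h1 : #{z | P z} = ∑ k, #{y | P (k, y)} := by
    rw [Finset.card_filter, Fintype.sum_prod_type]
    simp only [Finset.card_filter]
  have h2 : ∀ k, (#{y | P (k, y)} : ℝ) ≤ β / 2 * Fintype.card Y +
      Fintype.card Y * (if Large (β / 2) (fun y => P (k, y)) then 1 else 0) := by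
    intro k
    have h3 : (#{y | P (k, y)} : ℝ) ≤ Fintype.card Y := by exact_mod_cast Finset.card_le_univ _
    split_ifs with h4
    · have : 0 ≤ β / 2 * Fintype.card Y := by positivity
      linarith
    · rw [large_iff] at h4
      linarith
  have h3 := Finset.sum_le_sum fun k (_ : k ∈ Finset.univ) => h2 k
  rw [Finset.sum_add_distrib, Finset.sum_const, ← Finset.mul_sum, Finset.sum_boole, nsmul_eq_mul,
    Finset.card_univ] at h3
  rw [h1, Fintype.card_prod] at h
  push_cast at h
  refine le_of_mul_le_mul_left ?_ hY
  nlinarith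

theorem exists_injective_mem {G K : Type} [Fintype G] (t : G → Finset K)
    (h : ∀ w, Fintype.card G ≤ #(t w)) :
    ∃ κ : G → K, Function.Injective κ ∧ ∀ w, κ w ∈ t w := by
  classical
  rw [← Finset.all_card_le_biUnion_card_iff_exists_injective]
  intro s
  rcases s.eq_empty_or_nonempty with rfl | ⟨w, hw⟩
  · simp
  · calc #s ≤ Fintype.card G := Finset.card_le_univ s
      _ ≤ #(t w) := h w
      _ ≤ _ := Finset.card_le_card (Finset.subset_biUnion_of_mem t hw)

theorem exists_equiv_fin_lt_of_lt {P κ : Type*} [Fintype P] [LinearOrder κ] (key : P → κ) :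
    ∃ (s : ℕ) (pos : P ≃ Fin s), ∀ u v, key u < key v → pos u < pos v := by
  let e := Fintype.equivFin P
  let g : Fin (Fintype.card P) → κ := key ∘ e.symm
  refine ⟨_, e.trans (Tuple.sort g).symm, fun u v huv => ?_⟩
  by_contra hcon
  have := Tuple.monotone_sort g (not_lt.1 hcon)
  simp [g] at this
  exact absurd huv (not_lt.2 this)

/-- The combinatorial rules for the layers of a layered 3-graph: `par g = some (c, b)` says that
the edges with top layer `g` have their other two vertices in the layers `c` and `b`. -/
structure ParentRule (par : ℕ → Option (ℕ × ℕ)) : Prop where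
  le : ∀ {g c b : ℕ}, par g = some (c, b) → c ≤ b
  lt : ∀ {g c b : ℕ}, par g = some (c, b) → b < g
  ne : ∀ {g c b q₁ q₂ : ℕ}, par g = some (c, b) → par b = some (q₁, q₂) → c ≠ q₁ ∧ c ≠ q₂

/-- A layered 3-graph with an ordering of the vertices in which no vertex is the end of one edge of
a link graph and the beginning of another one. The vertices `u, v, w` of an edge are listed with
the top vertex `w` last. -/
structure LinkSystem (par : ℕ → Option (ℕ × ℕ)) {G : Type} (f r : G → ℕ)
    (E : G → G → G → Prop) : Prop where
  par_eq : ∀ {u v w : G}, E u v w → par (f w) = some (f u, f v)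
  lt : ∀ {u v w : G}, E u v w → f u = f v → r u < r v
  link : ∀ {u v w x : G}, E u v w → E v x w → False

/-- A host structure: the points are triples of a layer, a cell and an element of `Y`. -/
structure IsHost (par : ℕ → Option (ℕ × ℕ)) {N : ℕ} {Y : Type} [Fintype Y] (α ε : ℝ)
    (R : ℕ × Fin N × Y → ℕ × Fin N × Y → ℕ × Fin N × Y → Prop)
    (Γ : ℕ × Fin N × Y → ℕ × Fin N × Y → Prop) : Prop where
  symm : ∀ {p q}, Γ p q → Γ q p
  rich : ∀ {p q g}, par g = some (p.1, q.1) → Γ p q → Large α (fun z => R p q (g, z))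
  dense : ∀ {c b : ℕ} {i j : Fin N}, (c, i) ≠ (b, j) → ∀ B : Finset Y, ε * Fintype.card Y ≤ #B →
    (Nat.card {y // (Nat.card {y' // y' ∈ B ∧ Γ (c, i, y) (b, j, y')} : ℝ) < α * #B} : ℝ) ≤
      ε * Fintype.card Y

theorem IsHost.mono {par : ℕ → Option (ℕ × ℕ)} {N : ℕ} {Y : Type} [Fintype Y] {α ε ε' : ℝ}
    {R : ℕ × Fin N × Y → ℕ × Fin N × Y → ℕ × Fin N × Y → Prop}
    {Γ : ℕ × Fin N × Y → ℕ × Fin N × Y → Prop} (h : IsHost par α ε R Γ) (hε : ε ≤ ε') :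
    IsHost par α ε' R Γ := by
  refine ⟨h.symm, h.rich, fun hne B hB => ?_⟩
  have hle : ε * Fintype.card Y ≤ ε' * Fintype.card Y := by gcongr
  exact (h.dense hne B (hle.trans hB)).trans hle

/-- The map `x`, with cells given by `κ`, is a copy in the host structure of the 3-graph `E`, and
it sends pairs of vertices which are relevant for layers from `ℓ` on to pairs in `Γ`. -/
def IsCopy (par : ℕ → Option (ℕ × ℕ)) {N : ℕ} {Y : Type}
    (R : ℕ × Fin N × Y → ℕ × Fin N × Y → ℕ × Fin N × Y → Prop)
    (Γ : ℕ × Fin N × Y → ℕ × Fin N × Y → Prop) {G : Type} (f : G → ℕ) (E : G → G → G → Prop)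
    (ℓ : ℕ) (κ : G → Fin N) (x : G → Y) : Prop :=
  (∀ u v w, E u v w → R (f u, κ u, x u) (f v, κ v, x v) (f w, κ w, x w)) ∧
  ∀ u v, u ≠ v → (∃ g, ℓ ≤ g ∧ par g = some (f u, f v)) → Γ (f u, κ u, x u) (f v, κ v, x v)

/-- Every link system with layers below `ℓ` has many copies in each host structure. -/
def Embeds (par : ℕ → Option (ℕ × ℕ)) (ℓ : ℕ) : Prop :=
  ∀ {G : Type} [Fintype G] [DecidableEq G] {f r : G → ℕ} {E : G → G → G → Prop},
    LinkSystem par f r E → (∀ v, f v < ℓ) → ∀ α : ℝ, 0 < α → α ≤ 1 →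
    ∃ N₀ : ℕ, ∀ N ≥ N₀, ∃ ε : ℝ, 0 < ε ∧ ∃ p : ℝ, 0 < p ∧
    ∀ {Y : Type} [Fintype Y] [Nonempty Y]
      {R : ℕ × Fin N × Y → ℕ × Fin N × Y → ℕ × Fin N × Y → Prop}
      {Γ : ℕ × Fin N × Y → ℕ × Fin N × Y → Prop}, IsHost par α ε R Γ →
    ∃ κ : G → Fin N, (∀ u v, f u = f v → κ u = κ v → u = v) ∧
      Large p (IsCopy par R Γ f E ℓ κ)

theorem embeds_zero (par : ℕ → Option (ℕ × ℕ)) : Embeds par 0 := by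
  intro G _ _ f r E _ hf α _ _
  have : IsEmpty G := ⟨fun v => absurd (hf v) (Nat.not_lt_zero _)⟩
  refine ⟨0, fun N _ => ⟨1, one_pos, 1, one_pos, fun {Y} _ _ R Γ _ => ?_⟩⟩
  exact ⟨isEmptyElim, isEmptyElim, Large.of_forall fun x => ⟨isEmptyElim, isEmptyElim⟩⟩

/-- A copy of the layers below `e`, such that for each vertex of the layer `e` there are many
possible images. -/
def IsPreCopy (par : ℕ → Option (ℕ × ℕ)) {N : ℕ} {Y : Type} [Fintype Y]
    (R : ℕ × Fin N × Y → ℕ × Fin N × Y → ℕ × Fin N × Y → Prop)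
    (Γ : ℕ × Fin N × Y → ℕ × Fin N × Y → Prop) {G : Type} (f : G → ℕ) (E : G → G → G → Prop)
    (e : ℕ) (β : ℝ) (κ : G → Fin N) (x : G → Y) : Prop :=
  (∀ u v w, E u v w → f w < e → R (f u, κ u, x u) (f v, κ v, x v) (f w, κ w, x w)) ∧
  (∀ u v, u ≠ v → f u < e → f v < e → (∃ g, e ≤ g ∧ par g = some (f u, f v)) →
    Γ (f u, κ u, x u) (f v, κ v, x v)) ∧
  ∀ w, f w = e → Large β fun y => ∀ u v, E u v w → R (f u, κ u, x u) (f v, κ v, x v) (e, κ w, y)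

theorem exists_large_isPreCopy_of_restrict {par : ℕ → Option (ℕ × ℕ)} (hpar : ParentRule par)
    {N : ℕ} {Y : Type} [Fintype Y] [Nonempty Y]
    {R : ℕ × Fin N × Y → ℕ × Fin N × Y → ℕ × Fin N × Y → Prop}
    {Γ : ℕ × Fin N × Y → ℕ × Fin N × Y → Prop} {G : Type} [Fintype G] [DecidableEq G]
    {f r : G → ℕ} {E : G → G → G → Prop} (hE : LinkSystem par f r E) {e : ℕ}
    (hf : ∀ v, f v < e + 1) {β p : ℝ}
    (κA : {v // f v < e} → Fin N) (hκA : ∀ u v : {v // f v < e}, f u = f v → κA u = κA v → u = v)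
    (κT : G → Fin N) (hκT : Function.Injective κT)
    (h : Large p (fun x : {v // f v < e} → Y =>
      IsCopy par R Γ (fun v => f v.1) (fun u v w => E u.1 v.1 w.1) e κA x ∧
      ∀ w, f w = e → Large β fun y => ∀ u v : {v // f v < e}, E u.1 v.1 w →
        R (f u.1, κA u, x u) (f v.1, κA v, x v) (e, κT w, y))) :
    ∃ κ : G → Fin N, (∀ u v, f u = f v → κ u = κ v → u = v) ∧
      Large p (IsPreCopy par R Γ f E e β κ) := by
  classical
  have hlt : ∀ {u v w}, E u v w → f u < f w ∧ f v < f w := fun h => by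
    have h1 := hpar.lt (hE.par_eq h)
    exact ⟨(hpar.le (hE.par_eq h)).trans_lt h1, h1⟩
  let κ : G → Fin N := fun v => if h : f v < e then κA ⟨v, h⟩ else κT v
  have hκ₁ : ∀ v (h : f v < e), κ v = κA ⟨v, h⟩ := fun v h => by simp [κ, h]
  have hκ₂ : ∀ v, f v = e → κ v = κT v := fun v h => by simp [κ, h]
  refine ⟨κ, fun u v hfu hκ => ?_, ?_⟩
  · by_cases hu : f u < e
    · have hv : f v < e := hfu ▸ hu
      rw [hκ₁ u hu, hκ₁ v hv] at hκ
      exact congrArg Subtype.val (hκA _ _ hfu hκ)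
    · have hu' : f u = e := by have := hf u; omega
      rw [hκ₂ u hu', hκ₂ v (hfu ▸ hu')] at hκ
      exact hκT hκ
  · rw [← large_comp_injective_iff (G := G) (Subtype.val_injective)] at h
    refine h.mono le_rfl fun x hx => ⟨?_, ?_, ?_⟩
    · intro u v w huvw hw
      have hu := (hlt huvw).1.trans hw
      have hv := (hlt huvw).2.trans hw
      rw [hκ₁ u hu, hκ₁ v hv, hκ₁ w hw]
      exact hx.1.1 ⟨u, hu⟩ ⟨v, hv⟩ ⟨w, hw⟩ huvw
    · intro u v huv hu hv hg
      rw [hκ₁ u hu, hκ₁ v hv]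
      exact hx.1.2 ⟨u, hu⟩ ⟨v, hv⟩ (by simpa using huv) hg
    · intro w hw
      refine (hx.2 w hw).mono le_rfl fun y hy u v huvw => ?_
      have hu := hw ▸ (hlt huvw).1
      have hv := hw ▸ (hlt huvw).2
      rw [hκ₁ u hu, hκ₁ v hv, hκ₂ w hw]
      exact hy ⟨u, hu⟩ ⟨v, hv⟩ huvw

section Glue

variable {A : Type} {s M : ℕ} {P : A → Prop} [DecidablePred P]

/-- The inclusion of the copy of `A` indexed by `σ` into the union of all these copies, in which
the vertices satisfying `P` are glued along a common set. -/
def glueMap (pos : {v // P v} → Fin s) (tag : A → Bool) (σ : Fin s → Fin M) (v : A) :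
    ((Fin s → Fin M) × A) ⊕ (Fin M × Bool) :=
  if h : P v then Sum.inr (σ (pos ⟨v, h⟩), tag v) else Sum.inl (σ, v)

/-- The layers of the glued structure. -/
def glueLayer (f : A → ℕ) (c b : ℕ) : ((Fin s → Fin M) × A) ⊕ (Fin M × Bool) → ℕ
  | Sum.inl z => f z.2
  | Sum.inr z => if z.2 then b else c

/-- The vertex order of the glued structure. -/
def glueRank (r : A → ℕ) : ((Fin s → Fin M) × A) ⊕ (Fin M × Bool) → ℕ
  | Sum.inl z => r z.2
  | Sum.inr z => z.1

/-- The edges of the glued structure. -/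
def GlueEdge (E : A → A → A → Prop) (pos : {v // P v} → Fin s) (tag : A → Bool)
    (x y z : ((Fin s → Fin M) × A) ⊕ (Fin M × Bool)) : Prop :=
  ∃ σ : Fin s → Fin M, StrictMono σ ∧ ∃ u v w, E u v w ∧ x = glueMap pos tag σ u ∧
    y = glueMap pos tag σ v ∧ z = glueMap pos tag σ w

theorem glueMap_injective {pos : {v // P v} → Fin s} (hpos : Function.Injective pos)
    (tag : A → Bool) {σ : Fin s → Fin M} (hσ : Function.Injective σ) :
    Function.Injective (glueMap pos tag σ) := by
  intro u v h
  unfold glueMap at h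
  split_ifs at h with hu hv hv
  · simp only [Sum.inr.injEq, Prod.mk.injEq] at h
    simpa using hpos (hσ h.1)
  · simpa using h

theorem glueMap_eq_of_not {pos : {v // P v} → Fin s} {tag : A → Bool} {σ τ : Fin s → Fin M}
    {u v : A} (hu : ¬ P u) (h : glueMap pos tag σ u = glueMap pos tag τ v) : σ = τ ∧ u = v := by
  unfold glueMap at h
  rw [dif_neg hu] at h
  split_ifs at h with hv
  simpa using h

end Glue

theorem linkSystem_glue {par : ℕ → Option (ℕ × ℕ)} (hpar : ParentRule par) {A : Type}
    {f r : A → ℕ} {E : A → A → A → Prop} (hE : LinkSystem par f r E) {e c b s M : ℕ}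
    (hcb : par e = some (c, b)) (pos : {v // f v = c ∨ f v = b} → Fin s)
    (hpos : Function.Injective pos)
    (hlt : ∀ u v : {v // f v = c ∨ f v = b}, f u = f v → r u < r v → pos u < pos v) :
    LinkSystem par (glueLayer f c b) (glueRank r)
      (GlueEdge (M := M) E pos fun v => decide (f v ≠ c)) ∧
    ∀ σ v, glueLayer (M := M) f c b (glueMap pos (fun v => decide (f v ≠ c)) σ v) = f v := by
  have hlayer : ∀ σ v,
      glueLayer (M := M) f c b (glueMap pos (fun v => decide (f v ≠ c)) σ v) = f v := by
    intro σ v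
    unfold glueMap glueLayer
    split_ifs with h
    · by_cases hc : f v = c
      · simp [hc]
      · simp only [hc, false_or] at h
        simpa [h] using Eq.symm
    · rfl
  refine ⟨⟨?_, ?_, ?_⟩, hlayer⟩
  · rintro _ _ _ ⟨σ, -, u, v, w, h, rfl, rfl, rfl⟩
    simpa only [hlayer] using hE.par_eq h
  · rintro _ _ _ ⟨σ, hσ, u, v, w, h, rfl, rfl, rfl⟩ huv
    rw [hlayer, hlayer] at huv
    have hr := hE.lt h huv
    unfold glueMap glueRank
    by_cases hu : f u = c ∨ f u = b
    · have hv : f v = c ∨ f v = b := huv ▸ hu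
      simp only [hu, hv, dite_true]
      exact hσ (hlt ⟨u, hu⟩ ⟨v, hv⟩ huv hr)
    · have hv : ¬ (f v = c ∨ f v = b) := huv ▸ hu
      simpa only [hu, hv, dite_false] using hr
  · rintro _ _ _ _ ⟨σ, hσ, u, v, w, h, rfl, rfl, rfl⟩ ⟨τ, hτ, v', x, w', h', hv, rfl, hw⟩
    have key : σ = τ ∧ v = v' ∧ w = w' := by
      by_cases hPw : f w = c ∨ f w = b
      · have hPv : ¬ (f v = c ∨ f v = b) := by
          intro hPv
          have h1 := hE.par_eq h
          have h2 := hpar.lt h1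
          have h3 := hpar.le hcb
          have h4 : f v = c ∧ f w = b := by omega
          exact (hpar.ne hcb (h4.2 ▸ h1)).2 h4.1.symm
        obtain ⟨rfl, rfl⟩ := glueMap_eq_of_not (P := fun v => f v = c ∨ f v = b) hPv hv
        exact ⟨rfl, rfl, glueMap_injective hpos _ hσ.injective hw⟩
      · obtain ⟨rfl, rfl⟩ := glueMap_eq_of_not (P := fun v => f v = c ∨ f v = b) hPw hw
        exact ⟨rfl, glueMap_injective hpos _ hσ.injective hv, rfl⟩
    obtain ⟨rfl, rfl, rfl⟩ := key
    exact hE.link h h'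

theorem LinkSystem.restrict {par : ℕ → Option (ℕ × ℕ)} {G : Type} {f r : G → ℕ}
    {E : G → G → G → Prop} (hE : LinkSystem par f r E) (p : G → Prop) :
    LinkSystem par (fun v : {v // p v} => f v) (fun v => r v) (fun u v w => E u v w) :=
  ⟨hE.par_eq, hE.lt, hE.link⟩

theorem Embeds.exists_preCopy {par : ℕ → Option (ℕ × ℕ)} (hpar : ParentRule par) {e : ℕ}
    (he : Embeds par e) {G : Type} [Fintype G] [DecidableEq G] {f r : G → ℕ}
    {E : G → G → G → Prop} (hE : LinkSystem par f r E) (hf : ∀ v, f v < e + 1) (α : ℝ)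
    (hα : 0 < α) (hα' : α ≤ 1) :
    ∃ β : ℝ, 0 < β ∧ ∃ N₀ : ℕ, ∀ N ≥ N₀, ∃ ε : ℝ, 0 < ε ∧ ∃ p : ℝ, 0 < p ∧
    ∀ {Y : Type} [Fintype Y] [Nonempty Y]
      {R : ℕ × Fin N × Y → ℕ × Fin N × Y → ℕ × Fin N × Y → Prop}
      {Γ : ℕ × Fin N × Y → ℕ × Fin N × Y → Prop}, IsHost par α ε R Γ →
    ∃ κ : G → Fin N, (∀ u v, f u = f v → κ u = κ v → u = v) ∧
      Large p (IsPreCopy par R Γ f E e β κ) := by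
  classical
  have hA := hE.restrict fun v => f v < e
  cases hpe : par e with
  | none =>
    obtain ⟨N₀, hN₀⟩ := he hA (fun v => v.2) α hα hα'
    refine ⟨1, one_pos, max N₀ (Fintype.card G), fun N hN => ?_⟩
    obtain ⟨ε, hε, p, hp, h⟩ := hN₀ N (le_of_max_le_left hN)
    refine ⟨ε, hε, p, hp, fun {Y} _ _ R Γ hR => ?_⟩
    obtain ⟨κA, hκA, hl⟩ := h hR
    obtain ⟨κT, hκT, -⟩ := exists_injective_mem (fun _ : G => (Finset.univ : Finset (Fin N)))
      fun _ => by simpa using le_of_max_le_right hN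
    refine exists_large_isPreCopy_of_restrict hpar hE hf κA hκA κT hκT
      (hl.mono le_rfl fun x hx => ⟨hx, fun w hw => Large.of_forall fun y u v huvw => ?_⟩)
    have := hE.par_eq huvw
    rw [hw, hpe] at this
    cases this
  | some cb =>
    obtain ⟨c, b⟩ := cb
    have hcb := hpar.le hpe
    have hbe := hpar.lt hpe
    let A := {v // f v < e}
    obtain ⟨s, pos, hpos⟩ := exists_equiv_fin_lt_of_lt
      (fun v : {v : A // f v.1 = c ∨ f v.1 = b} => toLex (decide (f v.1.1 ≠ c), r v.1.1))
    obtain ⟨M, β, hβ, hM⟩ := exists_strictMono_large s α hα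
    obtain ⟨hglue, hlayer⟩ := linkSystem_glue (M := M) hpar hA hpe pos pos.injective
      (fun u v huv hr => hpos u v (by simp only [Prod.Lex.toLex_lt_toLex]; right; simp [huv, hr]))
    obtain ⟨N₀, hN₀⟩ := he hglue (by
      rintro (⟨σ, v⟩ | ⟨i, t⟩)
      · exact v.2
      · simp only [glueLayer]
        split_ifs <;> omega) α hα hα'
    obtain ⟨N₁, hN₁⟩ := exists_nat_ge (Fintype.card G / (β / 2))
    refine ⟨β / 2, half_pos hβ, max N₀ (max N₁ 1), fun N hN => ?_⟩
    obtain ⟨ε, hε, p, hp, h⟩ := hN₀ N (le_of_max_le_left hN)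
    have hN1 : 1 ≤ N := le_of_max_le_right (le_of_max_le_right hN)
    have hNpos : 0 < N := hN1
    have hNG : (Fintype.card G : ℝ) ≤ β / 2 * N := by
      have h1 : (N₁ : ℝ) ≤ N := by exact_mod_cast le_of_max_le_left (le_of_max_le_right hN)
      have := hN₁.trans h1
      rwa [div_le_iff₀ (half_pos hβ), mul_comm] at this
    have hτ : Nonempty (Fin N) := ⟨⟨0, hNpos⟩⟩
    refine ⟨ε, hε, p / (Fintype.card ((Fin s → Fin M) × (G → Fin N)) + 1), by positivity,
      fun {Y} _ _ R Γ hR => ?_⟩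
    obtain ⟨κ, hκ, hl⟩ := h hR
    let ι : (Fin s → Fin M) → A → ((Fin s → Fin M) × A) ⊕ (Fin M × Bool) :=
      glueMap pos fun v => decide (f v ≠ c)
    have hι : ∀ σ : Fin s → Fin M, StrictMono σ → Function.Injective (ι σ) :=
      fun σ hσ => glueMap_injective pos.injective _ hσ.injective
    have hlay : ∀ σ v, glueLayer (fun v : A => f v.1) c b (ι σ v) = f v.1 := hlayer
    let Good : (Fin s → Fin M) → (G → Fin N) → (A → Y) → Prop := fun σ κT x =>
      IsCopy par R Γ (fun v => f v.1) (fun u v w => E u.1 v.1 w.1) e (κ ∘ ι σ) x ∧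
      ∀ w, f w = e → Large (β / 2) fun y => ∀ u v : A, E u.1 v.1 w →
        R (f u.1, (κ ∘ ι σ) u, x u) (f v.1, (κ ∘ ι σ) v, x v) (e, κT w, y)
    have hexists : ∀ x, IsCopy par R Γ (glueLayer (fun v : A => f v.1) c b)
        (GlueEdge (fun u v w => E u.1 v.1 w.1) pos fun v => decide (f v ≠ c)) e κ x →
        ∃ t : (Fin s → Fin M) × (G → Fin N),
          StrictMono t.1 ∧ Function.Injective t.2 ∧ Good t.1 t.2 (x ∘ ι t.1) := by
      intro x hx
      let pt : ((Fin s → Fin M) × A) ⊕ (Fin M × Bool) → ℕ × Fin N × Y := fun z =>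
        (glueLayer (fun v : A => f v.1) c b z, κ z, x z)
      have htag : (if decide (b ≠ c) = true then b else c) = b := by
        by_cases hbc : b = c <;> simp [hbc]
      obtain ⟨σ, hσ, hlarge⟩ := hM (Ω := Fin N × Y)
        (fun i j z => R (pt (Sum.inr (i, false))) (pt (Sum.inr (j, decide (b ≠ c)))) (e, z))
        (by
          intro i j hij
          refine hR.rich ?_ (hx.2 _ _ ?_ ⟨e, le_rfl, ?_⟩)
          · simp only [pt, glueLayer, htag, hpe, Bool.false_eq_true, if_false]
          · simp [hij.ne]
          · simp only [glueLayer, htag, hpe, Bool.false_eq_true, if_false])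
      have hfib := fun w : G => (hlarge fun a =>
        ∃ v : A, E (pos.symm a).1.1 v.1 w).large_fibers hβ.le
      obtain ⟨κT, hκT, hmem⟩ := exists_injective_mem (fun w => Finset.univ.filter _)
        (fun w => by
          have h1 := large_iff.1 (hfib w)
          rw [Fintype.card_fin] at h1
          exact_mod_cast hNG.trans h1)
      have hpt : ∀ v, (f v.1, κ (ι σ v), x (ι σ v)) = pt (ι σ v) := fun v => by
        rw [← hlay σ v]
      refine ⟨(σ, κT), hσ, hκT, ⟨?_, ?_⟩, ?_⟩
      · intro u v w huvw
        simp only [Function.comp_apply, hpt]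
        exact hx.1 _ _ _ ⟨σ, hσ, u, v, w, huvw, rfl, rfl, rfl⟩
      · intro u v huv hg
        simp only [Function.comp_apply, hpt]
        exact hx.2 _ _ ((hι σ hσ).ne huv) (by rwa [hlay, hlay])
      · intro w hw
        refine (Finset.mem_filter.1 (hmem w)).2.mono le_rfl fun y hy u v huvw => ?_
        have h1 := hE.par_eq huvw
        rw [hw, hpe, Option.some.injEq, Prod.mk.injEq] at h1
        obtain ⟨hc, hb⟩ := h1
        have hιu : ι σ u = Sum.inr (σ (pos ⟨u, .inl hc.symm⟩), false) := by
          simp [ι, glueMap, hc.symm]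
        have hιv : ι σ v = Sum.inr (σ (pos ⟨v, .inr hb.symm⟩), decide (b ≠ c)) := by
          simp [ι, glueMap, hb.symm]
        simp only [Function.comp_apply]
        rw [hpt u, hpt v, hιu, hιv]
        refine hy (pos ⟨u, .inl hc.symm⟩) (pos ⟨v, .inr hb.symm⟩) (hpos _ _ ?_) ⟨v, by simpa using huvw⟩ ?_
        · rw [Prod.Lex.toLex_lt_toLex]
          rcases hcb.lt_or_eq with hlt | heq
          · left
            simp [hc.symm, hb.symm, hlt.ne']
          · right
            exact ⟨by simp [hc.symm, hb.symm, heq], hE.lt huvw (by rw [← hc, ← hb, heq])⟩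
        · rintro ⟨z, hz⟩
          exact hE.link huvw (by simpa using hz)
    have hYG : Nonempty (((Fin s → Fin M) × A) ⊕ (Fin M × Bool) → Y) := inferInstance
    obtain ⟨⟨σ, κT⟩, ht⟩ := hl.exists_of_forall_exists_fintype hp _ hexists
    have hcard : 0 < Fintype.card ((Fin s → Fin M) × (G → Fin N)) :=
      Fintype.card_pos_iff.2 ⟨(σ, κT)⟩
    obtain ⟨x, hσ, hκT, -⟩ := ht.exists (by positivity)
    have ht' : Large (p / (Fintype.card ((Fin s → Fin M) × (G → Fin N)) + 1))
        fun x : _ → Y => Good σ κT (x ∘ ι σ) :=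
      ht.mono (by gcongr; linarith) fun x hx => hx.2.2
    rw [large_comp_injective_iff (hι σ hσ)] at ht'
    refine exists_large_isPreCopy_of_restrict hpar hE hf (κ ∘ ι σ) (fun u v huv hκuv => ?_) κT hκT ht'
    refine hι σ hσ (hκ _ _ ?_ hκuv)
    rwa [hlay, hlay]

theorem sum_card_update {G Y : Type} [Fintype G] [DecidableEq G] [Fintype Y] [DecidableEq Y]
    (P : (G → Y) → Prop) [DecidablePred P] (v : G) :
    ∑ x : G → Y, #{y | P (Function.update x v y)} = Fintype.card Y * #{x | P x} := by
  let φ : (G → Y) × Y → (G → Y) × Y := fun z => (Function.update z.1 v z.2, z.1 v)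
  have hφ : Function.Involutive φ := by
    rintro ⟨x, y⟩
    simp [φ]
  have h1 : ∑ z : (G → Y) × Y, (if P (φ z).1 then 1 else 0) =
      ∑ z : (G → Y) × Y, if P z.1 then 1 else 0 :=
    Equiv.sum_comp hφ.toPerm (fun z : (G → Y) × Y => if P z.1 then 1 else 0)
  rw [Fintype.sum_prod_type, Fintype.sum_prod_type] at h1
  simp only [φ] at h1
  simp only [Finset.card_filter]
  rw [h1]
  rw [Finset.mul_sum]
  exact Finset.sum_congr rfl fun x _ => by by_cases hP : P x <;> simp [hP]

theorem Large.of_update {G Y : Type} [Fintype G] [DecidableEq G] [Fintype Y] [Nonempty Y]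
    {P A : (G → Y) → Prop} (v : G) {q β : ℝ} (hβ : 0 ≤ β) (hA : Large q A)
    (h : ∀ x, A x → Large β fun y => P (Function.update x v y)) : Large (β * q) P := by
  classical
  simp only [large_iff] at hA h ⊢
  have hY : (0 : ℝ) < Fintype.card Y := by exact_mod_cast Fintype.card_pos
  refine le_of_mul_le_mul_left ?_ hY
  have h1 : ((Fintype.card Y * #{x | P x} : ℕ) : ℝ) =
      ∑ x : G → Y, (#{y | P (Function.update x v y)} : ℝ) := by
    rw [← sum_card_update P v]
    push_cast
    rfl
  push_cast at h1
  rw [h1]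
  calc Fintype.card Y * (β * q * Fintype.card (G → Y))
      = β * Fintype.card Y * (q * Fintype.card (G → Y)) := by ring
    _ ≤ β * Fintype.card Y * #{x | A x} := by gcongr
    _ = ∑ x with A x, β * Fintype.card Y := by
      rw [Finset.sum_const, nsmul_eq_mul, mul_comm]
    _ ≤ ∑ x with A x, (#{y | P (Function.update x v y)} : ℝ) :=
      Finset.sum_le_sum fun x hx => h x (by simpa using hx)
    _ ≤ _ := Finset.sum_le_univ_sum_of_nonneg fun x => by positivity

theorem card_le_of_update {G Y : Type} [Fintype G] [DecidableEq G] [Fintype Y] [Nonempty Y]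
    (P : (G → Y) → Prop) [DecidablePred P] (v : G) {ε : ℝ}
    (h : ∀ x, (#{y | P (Function.update x v y)} : ℝ) ≤ ε * Fintype.card Y) :
    (#{x | P x} : ℝ) ≤ ε * Fintype.card (G → Y) := by
  classical
  have hY : (0 : ℝ) < Fintype.card Y := by exact_mod_cast Fintype.card_pos
  refine le_of_mul_le_mul_left ?_ hY
  have h1 : ((Fintype.card Y * #{x | P x} : ℕ) : ℝ) =
      ∑ x : G → Y, (#{y | P (Function.update x v y)} : ℝ) := by
    rw [← sum_card_update P v]
    push_cast
    rfl
  push_cast at h1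
  rw [h1]
  calc _ ≤ ∑ x : G → Y, ε * Fintype.card Y := Finset.sum_le_sum fun x _ => h x
    _ = _ := by
      rw [Finset.sum_const, nsmul_eq_mul, Finset.card_univ]
      ring

section Extend

variable {par : ℕ → Option (ℕ × ℕ)} {N : ℕ} {Y : Type} [Fintype Y]
  {R : ℕ × Fin N × Y → ℕ × Fin N × Y → ℕ × Fin N × Y → Prop}
  {Γ : ℕ × Fin N × Y → ℕ × Fin N × Y → Prop} {G : Type}
  {f r : G → ℕ} {E : G → G → G → Prop} {e : ℕ} {κ : G → Fin N}

open Classical in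
/-- The possible images of the vertex `w` of layer `e`, taking into account the conditions imposed
by the vertices of `D`. -/
noncomputable def candidates (par : ℕ → Option (ℕ × ℕ))
    (R : ℕ × Fin N × Y → ℕ × Fin N × Y → ℕ × Fin N × Y → Prop)
    (Γ : ℕ × Fin N × Y → ℕ × Fin N × Y → Prop) (f : G → ℕ) (E : G → G → G → Prop) (e : ℕ)
    (κ : G → Fin N) (w : G) (D : Finset G) (x : G → Y) : Finset Y :=
  {y | (∀ u v, E u v w → R (f u, κ u, x u) (f v, κ v, x v) (e, κ w, y)) ∧
    ∀ v ∈ D, (∃ g, e + 1 ≤ g ∧ par g = some (f v, e)) → Γ (f v, κ v, x v) (e, κ w, y)}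

theorem candidates_congr {w : G} {D : Finset G} {x x' : G → Y}
    (h₁ : ∀ u v, E u v w → x u = x' u ∧ x v = x' v) (h₂ : ∀ v ∈ D, x v = x' v) :
    candidates par R Γ f E e κ w D x = candidates par R Γ f E e κ w D x' := by
  ext y
  simp only [candidates, Finset.mem_filter, Finset.mem_univ, true_and]
  refine and_congr ?_ ?_
  · refine forall₃_congr fun u v huv => ?_
    rw [(h₁ u v huv).1, (h₁ u v huv).2]
  · refine forall₂_congr fun v hv => ?_
    rw [h₂ v hv]

open Classical in
theorem candidates_insert {w v : G} {D : Finset G} {x : G → Y} :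
    candidates par R Γ f E e κ w (insert v D) x = (candidates par R Γ f E e κ w D x).filter
      fun y => (∃ g, e + 1 ≤ g ∧ par g = some (f v, e)) → Γ (f v, κ v, x v) (e, κ w, y) := by
  ext y
  simp only [candidates, Finset.mem_filter, Finset.mem_univ, true_and, Finset.mem_insert,
    forall_eq_or_imp]
  tauto

open Classical in
theorem card_few_candidates_le [Fintype G] [Nonempty Y] (hpar : ParentRule par)
    (hE : LinkSystem par f r E) {α β ε : ℝ} (hα : 0 < α) (hα' : α ≤ 1) (hβ : 0 < β) (hε : 0 < ε)
    (hR : IsHost par α ε R Γ) (hεβ : ε ≤ α ^ Fintype.card G * β)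
    (hκ : ∀ u v, f u = f v → κ u = κ v → u = v) {w : G} (hw : f w = e) (D : Finset G)
    (hwD : w ∉ D) :
    (#{x : G → Y | β * Fintype.card Y ≤ #(candidates par R Γ f E e κ w ∅ x) ∧
      #(candidates par R Γ f E e κ w D x) < α ^ #D * β * Fintype.card Y} : ℝ) ≤
      #D * ε * Fintype.card (G → Y) := by
  induction D using Finset.induction_on with
  | empty =>
    simp only [Finset.card_empty, pow_zero, one_mul, Nat.cast_zero, zero_mul]
    rw [Finset.filter_false_of_mem]
    · simp
    · rintro x - ⟨h1, h2⟩
      linarith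
  | insert v D hvD ih =>
    simp only [Finset.mem_insert, not_or] at hwD
    have ih := ih hwD.2
    have hY : (0 : ℝ) < Fintype.card Y := by exact_mod_cast Fintype.card_pos
    have hstep : (#{x : G → Y | α ^ #D * β * Fintype.card Y ≤ #(candidates par R Γ f E e κ w D x) ∧
        #(candidates par R Γ f E e κ w (insert v D) x) <
          α ^ (#D + 1) * β * Fintype.card Y} : ℝ) ≤ ε * Fintype.card (G → Y) := by
      apply card_le_of_update _ v
      intro x
      by_cases hnb : ∃ g, e + 1 ≤ g ∧ par g = some (f v, e)
      · have hpe : ∀ u u', E u u' w → u ≠ v ∧ u' ≠ v := by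
          intro u u' huw
          obtain ⟨g, -, hg⟩ := hnb
          have h1 := hE.par_eq huw
          rw [hw] at h1
          have h2 := hpar.ne hg h1
          exact ⟨fun h => h2.1 (by rw [h]), fun h => h2.2 (by rw [h])⟩
        have hB : ∀ y, candidates par R Γ f E e κ w D (Function.update x v y) =
            candidates par R Γ f E e κ w D x := fun y => by
          apply candidates_congr
          · intro u u' huw
            simp [Function.update_of_ne (hpe u u' huw).1, Function.update_of_ne (hpe u u' huw).2]
          · intro z hz
            rw [Function.update_of_ne]
            rintro rfl
            exact hvD hz
        set B := candidates par R Γ f E e κ w D x with hBdef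
        by_cases hBl : α ^ #D * β * Fintype.card Y ≤ #B
        · have hne : (f v, κ v) ≠ (e, κ w) := by
            rw [← hw]
            intro h
            rw [Prod.mk.injEq] at h
            exact hwD.1 (hκ _ _ h.1 h.2).symm
          have hDG : α ^ Fintype.card G ≤ α ^ #D :=
            pow_le_pow_of_le_one hα.le hα' (Finset.card_le_univ D)
          have hBε : ε * Fintype.card Y ≤ #B := by
            refine le_trans ?_ hBl
            gcongr
            exact hεβ.trans (by gcongr)
          refine le_trans ?_ (hR.dense hne B hBε)
          rw [Nat.card_eq_fintype_card, Fintype.card_subtype]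
          gcongr with y
          rintro ⟨-, h2⟩
          rw [candidates_insert, hB] at h2
          rw [Nat.card_eq_fintype_card, Fintype.card_subtype]
          have h3 : (Finset.univ.filter fun y' => y' ∈ B ∧ Γ (f v, κ v, y) (e, κ w, y')) =
              B.filter fun y' => (∃ g, e + 1 ≤ g ∧ par g = some (f v, e)) →
                Γ (f v, κ v, Function.update x v y v) (e, κ w, y') := by
            ext y'
            simp only [Finset.mem_filter, Finset.mem_univ, true_and, hnb, true_imp_iff,
              Function.update_self]
          rw [h3]
          refine h2.trans_le ?_
          calc α ^ (#D + 1) * β * Fintype.card Y = α * (α ^ #D * β * Fintype.card Y) := by ring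
            _ ≤ α * #B := by gcongr
        · rw [Finset.filter_false_of_mem]
          · simp only [Finset.card_empty, Nat.cast_zero]
            positivity
          · rintro y - ⟨h1, -⟩
            rw [hB] at h1
            exact hBl h1
      · rw [Finset.filter_false_of_mem]
        · simp only [Finset.card_empty, Nat.cast_zero]
          positivity
        · rintro y - ⟨h1, h2⟩
          rw [candidates_insert] at h2
          simp only [hnb, false_imp_iff, Finset.filter_true] at h2
          have : α ^ (#D + 1) * β * Fintype.card Y ≤ α ^ #D * β * Fintype.card Y := by
            gcongr ?_ * _ * _
            exact pow_le_pow_of_le_one hα.le hα' (Nat.le_succ _)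
          linarith
    rw [Finset.card_insert_of_notMem hvD]
    push_cast
    calc _ ≤ ((#{x : G → Y | β * Fintype.card Y ≤ #(candidates par R Γ f E e κ w ∅ x) ∧
          #(candidates par R Γ f E e κ w D x) < α ^ #D * β * Fintype.card Y} +
          #{x : G → Y | α ^ #D * β * Fintype.card Y ≤ #(candidates par R Γ f E e κ w D x) ∧
          #(candidates par R Γ f E e κ w (insert v D) x) <
          α ^ (#D + 1) * β * Fintype.card Y} : ℕ) : ℝ) := by
          norm_cast
          refine le_trans (Finset.card_le_card ?_) (Finset.card_union_le _ _)
          intro x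
          simp only [Finset.mem_filter, Finset.mem_univ, true_and, Finset.mem_union]
          rintro ⟨h1, h2⟩
          by_cases h3 : (#(candidates par R Γ f E e κ w D x) : ℝ) < α ^ #D * β * Fintype.card Y
          · exact Or.inl ⟨h1, h3⟩
          · exact Or.inr ⟨not_lt.1 h3, h2⟩
      _ ≤ _ := by
          push_cast
          linarith

end Extend

theorem IsPreCopy.congr {par : ℕ → Option (ℕ × ℕ)} (hpar : ParentRule par) {N : ℕ} {Y : Type}
    [Fintype Y] {R : ℕ × Fin N × Y → ℕ × Fin N × Y → ℕ × Fin N × Y → Prop}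
    {Γ : ℕ × Fin N × Y → ℕ × Fin N × Y → Prop} {G : Type}
    {f r : G → ℕ} {E : G → G → G → Prop} (hE : LinkSystem par f r E) {e : ℕ} {β : ℝ}
    {κ : G → Fin N} {x x' : G → Y} (h : IsPreCopy par R Γ f E e β κ x)
    (hx : ∀ v, f v < e → x v = x' v) : IsPreCopy par R Γ f E e β κ x' := by
  have hlt : ∀ {u v w}, E u v w → f u < f w ∧ f v < f w := fun h => by
    have h1 := hpar.lt (hE.par_eq h)
    exact ⟨(hpar.le (hE.par_eq h)).trans_lt h1, h1⟩
  refine ⟨fun u v w huvw hw => ?_, fun u v huv hu hv hg => ?_, fun w hw => ?_⟩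
  · have h2 := hlt huvw
    rw [← hx u (h2.1.trans hw), ← hx v (h2.2.trans hw), ← hx w hw]
    exact h.1 u v w huvw hw
  · rw [← hx u hu, ← hx v hv]
    exact h.2.1 u v huv hu hv hg
  · refine (h.2.2 w hw).mono le_rfl fun y hy u v huvw => ?_
    have h2 := hlt huvw
    rw [← hx u (hw ▸ h2.1), ← hx v (hw ▸ h2.2)]
    exact hy u v huvw

theorem Embeds.succ {par : ℕ → Option (ℕ × ℕ)} (hpar : ParentRule par) {e : ℕ}
    (he : Embeds par e) : Embeds par (e + 1) := by
  classical
  intro G _ _ f r E hE hf α hα hα'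
  have hlt : ∀ {u v w}, E u v w → f u < f w ∧ f v < f w := fun h => by
    have h1 := hpar.lt (hE.par_eq h)
    exact ⟨(hpar.le (hE.par_eq h)).trans_lt h1, h1⟩
  obtain ⟨β, hβ, N₀, hN₀⟩ := he.exists_preCopy hpar hE hf α hα hα'
  refine ⟨N₀, fun N hN => ?_⟩
  obtain ⟨ε₁, hε₁, p, hp, h⟩ := hN₀ N hN
  set n := Fintype.card G with hn
  let γ : ℝ := α ^ n * min β 1
  have hγ : 0 < γ := by positivity
  have hγ1 : γ ≤ 1 := mul_le_one₀ (pow_le_one₀ hα.le hα') (by positivity) (min_le_right _ _)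
  have hγβ : γ ≤ α ^ n * β := by
    have : min β 1 ≤ β := min_le_left _ _
    simp only [γ]
    gcongr
  let q : ℕ → ℝ := fun j => (γ / 2) ^ j * p
  have hq : ∀ j, 0 < q j := fun j => by positivity
  have hqn : ∀ j ≤ n, q n ≤ q j := fun j hj => by
    simp only [q]
    gcongr ?_ * _
    exact pow_le_pow_of_le_one (by positivity) (by linarith) hj
  refine ⟨min ε₁ (min γ (q n / 2 / (n + 1))), ?_, q n, hq n, fun {Y} _ _ R Γ hR => ?_⟩
  · have := hq n
    positivity
  set ε := min ε₁ (min γ (q n / 2 / (n + 1))) with hε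
  have hε0 : 0 < ε := by
    have := hq n
    positivity
  have hεγ : ε ≤ γ := (min_le_right _ _).trans (min_le_left _ _)
  have hεq : n * ε ≤ q n / 2 := by
    have h1 : ε ≤ q n / 2 / (n + 1) := (min_le_right _ _).trans (min_le_right _ _)
    rw [le_div_iff₀ (by positivity)] at h1
    linarith
  obtain ⟨κ, hκ, hpre⟩ := h (hR.mono (min_le_left _ _))
  let Good : Finset G → (G → Y) → Prop := fun T x => IsPreCopy par R Γ f E e β κ x ∧
    ∀ w ∈ T, (∀ u v, E u v w → R (f u, κ u, x u) (f v, κ v, x v) (e, κ w, x w)) ∧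
      ∀ v, (f v < e ∨ v ∈ T) → v ≠ w → (∃ g, e + 1 ≤ g ∧ par g = some (f v, e)) →
        Γ (f v, κ v, x v) (e, κ w, x w)
  have hGood : ∀ T : Finset G, (∀ w ∈ T, f w = e) → Large (q #T) (Good T) := by
    intro T
    induction T using Finset.induction_on with
    | empty =>
      intro _
      exact hpre.mono (by simp [q]) fun x hx => ⟨hx, by simp⟩
    | insert w T hwT ih =>
      intro hT
      have hw : f w = e := hT w (by simp)
      have hT' : ∀ w ∈ T, f w = e := fun w hw => hT w (by simp [hw])
      have ih := ih hT'
      let D : Finset G := {v | f v < e ∨ v ∈ T}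
      have hwD : w ∉ D := by simp [D, hw, hwT]
      have hbad := card_few_candidates_le hpar hE hα hα' hβ hε0 hR (hεγ.trans hγβ) hκ hw D hwD
      have hA : Large (q #T / 2) fun x => Good T x ∧
          α ^ #D * β * Fintype.card Y ≤ #(candidates par R Γ f E e κ w D x) := by
        rw [large_iff] at ih ⊢
        have h1 : (#{x | Good T x} : ℝ) ≤ ((#{x | Good T x ∧
            α ^ #D * β * Fintype.card Y ≤ #(candidates par R Γ f E e κ w D x)} +
            #{x : G → Y | β * Fintype.card Y ≤ #(candidates par R Γ f E e κ w ∅ x) ∧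
            #(candidates par R Γ f E e κ w D x) < α ^ #D * β * Fintype.card Y} : ℕ) : ℝ) := by
          norm_cast
          refine le_trans (Finset.card_le_card ?_) (Finset.card_union_le _ _)
          intro x
          simp only [Finset.mem_filter, Finset.mem_univ, true_and, Finset.mem_union]
          intro hx
          by_cases h3 : (#(candidates par R Γ f E e κ w D x) : ℝ) < α ^ #D * β * Fintype.card Y
          · refine Or.inr ⟨?_, h3⟩
            have h4 := large_iff.1 (hx.1.2.2 w hw)
            simpa [candidates] using h4
          · exact Or.inl ⟨hx, not_lt.1 h3⟩
        push_cast at h1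
        have h2 : (#D : ℝ) * ε ≤ q #T / 2 := by
          have h3 : (#D : ℝ) ≤ n := by exact_mod_cast Finset.card_le_univ D
          have h4 := hqn #T (Finset.card_le_univ T)
          calc (#D : ℝ) * ε ≤ n * ε := by gcongr
            _ ≤ q n / 2 := hεq
            _ ≤ _ := by gcongr
        have h3 : (#D : ℝ) * ε * Fintype.card (G → Y) ≤ q #T / 2 * Fintype.card (G → Y) := by
          gcongr
        have h4 : (#{x : G → Y | β * Fintype.card Y ≤ #(candidates par R Γ f E e κ w ∅ x) ∧
            #(candidates par R Γ f E e κ w D x) < α ^ #D * β * Fintype.card Y} : ℝ) ≤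
            #D * ε * Fintype.card (G → Y) := by
          convert hbad
        linarith
      have hupd := Large.of_update (P := Good (insert w T)) w hγ.le hA (by
        rintro x ⟨hx, hxD⟩
        rw [large_iff]
        have h1 : γ * Fintype.card Y ≤ α ^ #D * β * Fintype.card Y := by
          gcongr ?_ * _
          refine hγβ.trans ?_
          gcongr ?_ * _
          exact pow_le_pow_of_le_one hα.le hα' (Finset.card_le_univ D)
        refine (h1.trans hxD).trans ?_
        norm_cast
        refine Finset.card_le_card fun y hy => ?_
        simp only [candidates, Finset.mem_filter, Finset.mem_univ, true_and, D] at hy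
        simp only [Finset.mem_filter, Finset.mem_univ, true_and]
        have hne : ∀ v, f v < e → Function.update x w y v = x v := fun v hv =>
          Function.update_of_ne (by rintro rfl; omega) _ _
        have hneT : ∀ v ∈ T, Function.update x w y v = x v := fun v hv =>
          Function.update_of_ne (by rintro rfl; exact hwT hv) _ _
        refine ⟨hx.1.congr hpar hE fun v hv => (hne v hv).symm, fun w' hw' => ⟨?_, ?_⟩⟩
        · intro u v huvw
          have hw'e := hT w' hw'
          have h2 := hlt huvw
          rw [hne u (hw'e ▸ h2.1), hne v (hw'e ▸ h2.2)]
          rcases Finset.mem_insert.1 hw' with rfl | hwT'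
          · rw [Function.update_self]
            exact hy.1 u v huvw
          · rw [hneT w' hwT']
            exact (hx.2 w' hwT').1 u v huvw
        · intro v hv hvw hg
          rcases Finset.mem_insert.1 hw' with rfl | hwT'
          · have hv' : f v < e ∨ v ∈ T := by
              rcases hv with hv | hv
              · exact Or.inl hv
              · exact Or.inr ((Finset.mem_insert.1 hv).resolve_left hvw)
            rw [Function.update_self, Function.update_of_ne hvw]
            exact hy.2 v hv' hg
          · rw [hneT w' hwT']
            by_cases hvw' : v = w
            · subst hvw'
              rw [Function.update_self]
              have h3 := hy.2 w' (Or.inr hwT') (by rw [hT' w' hwT']; rwa [hw] at hg)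
              rw [hT' w' hwT'] at h3
              rw [hw]
              exact hR.symm h3
            · rw [Function.update_of_ne hvw']
              refine (hx.2 w' hwT').2 v ?_ hvw hg
              rcases hv with hv | hv
              · exact Or.inl hv
              · exact Or.inr ((Finset.mem_insert.1 hv).resolve_left hvw'))
      refine hupd.mono (le_of_eq ?_) fun x hx => hx
      rw [Finset.card_insert_of_notMem hwT]
      simp only [q]
      ring
  refine ⟨κ, hκ, (hGood {w | f w = e} (by simp)).mono (hqn _ (Finset.card_le_univ _))
    fun x hx => ⟨fun u v w huvw => ?_, fun u v huv hg => ?_⟩⟩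
  · rcases (Nat.lt_succ_iff.1 (hf w)).lt_or_eq with hw | hw
    · exact hx.1.1 u v w huvw hw
    · rw [hw]
      exact (hx.2 w (by simp [hw])).1 u v huvw
  · obtain ⟨g, hge, hg⟩ := hg
    have huv' := hpar.le hg
    rcases (Nat.lt_succ_iff.1 (hf v)).lt_or_eq with hv | hv
    · exact hx.1.2.1 u v huv (by omega) hv ⟨g, by omega, hg⟩
    · rw [hv] at hg ⊢
      refine (hx.2 v (by simp [hv])).2 u ?_ huv ⟨g, hge, hg⟩
      have := hf u
      simp only [Finset.mem_filter, Finset.mem_univ, true_and]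
      omega

theorem embeds {par : ℕ → Option (ℕ × ℕ)} (hpar : ParentRule par) (ℓ : ℕ) : Embeds par ℓ := by
  induction ℓ with
  | zero => exact embeds_zero par
  | succ e ih => exact Embeds.succ hpar ih

/-- There is a linear order of the vertices in which no vertex is the end of one edge and the
beginning of another edge of the link graph of a vertex. -/
def LinkOrdered {V : Type*} [DecidableEq V] (F : ThreeGraph V) : Prop :=
  ∃ r : V → ℕ, Function.Injective r ∧ ∀ u v x w, r u < r v → r v < r x →
    {u, v, w} ∈ F.edges → {v, x, w} ∈ F.edges → False

theorem ThreeGraph.ne_of_mem {V : Type*} [DecidableEq V] (F : ThreeGraph V) {u v w : V}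
    (h : {u, v, w} ∈ F.edges) : u ≠ v ∧ u ≠ w ∧ v ≠ w := by
  have h3 := F.card_eq _ h
  refine ⟨?_, ?_, ?_⟩
  · rintro rfl
    have := Finset.card_le_two (a := u) (b := w)
    simp only [Finset.insert_eq_of_mem, Finset.mem_insert, true_or] at h3
    omega
  · rintro rfl
    have := Finset.card_le_two (a := v) (b := u)
    rw [Finset.insert_eq_of_mem (by simp)] at h3
    omega
  · rintro rfl
    have := Finset.card_le_two (a := u) (b := v)
    rw [Finset.pair_eq_singleton] at h3
    omega

/-- The oriented edges of a 3-graph: the top vertex comes last, and the other two are ordered by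
layer and then by `r`. -/
def OrientedEdge {V : Type*} [DecidableEq V] (F : ThreeGraph V) (f r : V → ℕ) (u v w : V) : Prop :=
  {u, v, w} ∈ F.edges ∧ f u < f w ∧ f v < f w ∧ (f u < f v ∨ (f u = f v ∧ r u < r v))

theorem OrientedEdge.le {V : Type*} [DecidableEq V] {F : ThreeGraph V} {f r : V → ℕ} {u v w : V}
    (h : OrientedEdge F f r u v w) : f u ≤ f v := by
  rcases h.2.2.2 with h | h <;> omega

theorem OrientedEdge.layer_eq {V : Type*} [DecidableEq V] {F : ThreeGraph V} {f r : V → ℕ}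
    (hf : IsLayeredFunction F.edges f) {u v w u' v' w' : V} (h : OrientedEdge F f r u v w)
    (h' : OrientedEdge F f r u' v' w') (hw : f w = f w') : f u = f u' ∧ f v = f v' := by
  have hsup : ∀ {u v w}, OrientedEdge F f r u v w → ({u, v, w} : Finset V).sup f = f w := by
    intro u v w h
    simp only [Finset.sup_insert, Finset.sup_singleton]
    have := h.2.1
    have := h.2.2.1
    simp [this.le, h.2.1.le]
  have hval : ∀ {u v w}, OrientedEdge F f r u v w →
      Multiset.map f ({u, v, w} : Finset V).val = {f u, f v, f w} := by
    intro u v w h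
    have hne := F.ne_of_mem h.1
    rw [Finset.insert_val_of_notMem (by simp [hne.1, hne.2.1]),
      Finset.insert_val_of_notMem (by simp [hne.2.2])]
    simp
  have h2 := hf.2.1 _ h.1 _ h'.1 (by rw [hsup h, hsup h', hw])
  rw [hval h, hval h', hw] at h2
  have h3 : ({f u, f v} : Multiset ℕ) = {f u', f v'} := by
    have e1 : ∀ a b c : ℕ, ({a, b, c} : Multiset ℕ) = {a, b} + {c} := by
      intro a b c
      rfl
    rw [e1, e1] at h2
    exact add_right_cancel h2
  have h4 := h.le
  have h5 := h'.le
  have h6 : f u ∈ ({f u', f v'} : Multiset ℕ) := by rw [← h3]; simp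
  have h7 : f v ∈ ({f u', f v'} : Multiset ℕ) := by rw [← h3]; simp
  have h8 : f u' ∈ ({f u, f v} : Multiset ℕ) := by rw [h3]; simp
  have h9 : f v' ∈ ({f u, f v} : Multiset ℕ) := by rw [h3]; simp
  simp only [Multiset.insert_eq_cons, Multiset.mem_cons, Multiset.mem_singleton] at h6 h7 h8 h9
  omega

theorem IsLayered.exists_linkSystem {V : Type} [DecidableEq V] {F : ThreeGraph V}
    (hF : IsLayered F) (hL : LinkOrdered F) :
    ∃ (par : ℕ → Option (ℕ × ℕ)) (f r : V → ℕ) (E : V → V → V → Prop), ParentRule par ∧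
      LinkSystem par f r E ∧ (∀ g g' p, par g = some p → par g' = some p → g = g') ∧
      ∀ e ∈ F.edges, ∃ u v w, e = {u, v, w} ∧ E u v w := by
  classical
  obtain ⟨f, hf⟩ := hF
  obtain ⟨r, hr, hlink⟩ := hL
  let par : ℕ → Option (ℕ × ℕ) := fun g =>
    if h : ∃ p : V × V × V, OrientedEdge F f r p.1 p.2.1 p.2.2 ∧ f p.2.2 = g then
      some (f h.choose.1, f h.choose.2.1) else none
  have hpar : ∀ {u v w}, OrientedEdge F f r u v w → par (f w) = some (f u, f v) := by
    intro u v w h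
    have hex : ∃ p : V × V × V, OrientedEdge F f r p.1 p.2.1 p.2.2 ∧ f p.2.2 = f w :=
      ⟨(u, v, w), h, rfl⟩
    simp only [par, dif_pos hex]
    have := hex.choose_spec.1.layer_eq hf h hex.choose_spec.2
    rw [this.1, this.2]
  have hpar' : ∀ {g c b}, par g = some (c, b) →
      ∃ u v w, OrientedEdge F f r u v w ∧ f u = c ∧ f v = b ∧ f w = g := by
    intro g c b h
    simp only [par] at h
    split_ifs at h with hex
    simp only [Option.some.injEq, Prod.mk.injEq] at h
    exact ⟨_, _, _, hex.choose_spec.1, h.1, h.2, hex.choose_spec.2⟩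
  refine ⟨par, f, r, OrientedEdge F f r, ⟨?_, ?_, ?_⟩, ⟨hpar, ?_, ?_⟩, ?_, ?_⟩
  · intro g c b hp
    obtain ⟨u, v, w, h, rfl, rfl, rfl⟩ := hpar' hp
    exact h.le
  · intro g c b hp
    obtain ⟨u, v, w, h, rfl, rfl, rfl⟩ := hpar' hp
    exact h.2.2.1
  · intro g c b q₁ q₂ hp hp'
    obtain ⟨u, v, w, h, rfl, rfl, rfl⟩ := hpar' hp
    obtain ⟨u', v', w', h', rfl, rfl, hw⟩ := hpar' hp'
    have h1 := h.2.2.1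
    have h2 := h'.2.1
    have h3 := h'.2.2.1
    have n := F.ne_of_mem h.1
    have n' := F.ne_of_mem h'.1
    constructor
    · intro heq
      have := hf.2.2 _ h.1 _ h'.1 u v w u' w' v' n.1 n.2.1 n.2.2 n'.2.1 n'.1 n'.2.2.symm rfl
        (by ext; simp; tauto) heq hw.symm
      omega
    · intro heq
      have := hf.2.2 _ h.1 _ h'.1 u v w v' w' u' n.1 n.2.1 n.2.2 n'.2.2 n'.1.symm n'.2.1.symm rfl
        (by ext; simp; tauto) heq hw.symm
      omega
  · intro u v w h heq
    rcases h.2.2.2 with h | h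
    · omega
    · exact h.2
  · intro u v w x h h'
    have h1 := hpar h
    rw [hpar h'] at h1
    simp only [Option.some.injEq, Prod.mk.injEq] at h1
    have h2 := h.2.2.2
    have h3 := h'.2.2.2
    exact hlink u v x w (by omega) (by omega) h.1 h'.1
  · rintro g g' ⟨c, b⟩ hp hp'
    obtain ⟨u, v, w, h, rfl, rfl, rfl⟩ := hpar' hp
    obtain ⟨u', v', w', h', hu, hv, rfl⟩ := hpar' hp'
    have n := F.ne_of_mem h.1
    have n' := F.ne_of_mem h'.1
    exact hf.2.2 _ h.1 _ h'.1 u v w u' v' w' n.1 n.2.1 n.2.2 n'.1 n'.2.1 n'.2.2 rfl rfl hu.symm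
      hv.symm
  · intro e he
    obtain ⟨w, hwe, hw⟩ := hf.1 e he
    obtain ⟨u, v, huv, huve⟩ : ∃ u v, u ≠ v ∧ e.erase w = {u, v} := by
      apply Finset.card_eq_two.1
      rw [Finset.card_erase_of_mem hwe, F.card_eq e he]
    have he' : e = {u, v, w} := by
      rw [← Finset.insert_erase hwe, huve]
      ext
      simp
      tauto
    have hu : u ∈ e.erase w := by simp [huve]
    have hv : v ∈ e.erase w := by simp [huve]
    have hu' := hw u (Finset.mem_of_mem_erase hu) (Finset.ne_of_mem_erase hu)
    have hv' := hw v (Finset.mem_of_mem_erase hv) (Finset.ne_of_mem_erase hv)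
    have hrne := hr.ne huv
    have he'' : e = {v, u, w} := by
      rw [he']
      ext
      simp
      tauto
    by_cases hlt : f u < f v ∨ (f u = f v ∧ r u < r v)
    · exact ⟨u, v, w, he', he' ▸ he, hu', hv', hlt⟩
    · exact ⟨v, u, w, he'', he'' ▸ he, hv', hu', by omega⟩

theorem card_filter_not_injective_le {G Y : Type} [Fintype G] [DecidableEq G] [Fintype Y]
    [DecidableEq Y] [Nonempty Y] [DecidablePred fun x : G → Y => ¬ Function.Injective x] :
    (#{x : G → Y | ¬ Function.Injective x} : ℝ) * Fintype.card Y ≤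
      (Fintype.card G : ℝ) ^ 2 * Fintype.card (G → Y) := by
  have hY : (0 : ℝ) < Fintype.card Y := by exact_mod_cast Fintype.card_pos
  have h1 : ∀ p : G × G, p.1 ≠ p.2 → (#{x : G → Y | x p.1 = x p.2} : ℝ) ≤
      (1 / Fintype.card Y) * Fintype.card (G → Y) := fun p hp => by
    refine card_le_of_update (fun x : G → Y => x p.1 = x p.2) p.1 fun x => ?_
    have : #{y | Function.update x p.1 y p.1 = Function.update x p.1 y p.2} ≤ 1 := by
      refine Finset.card_le_one.2 fun y hy z hz => ?_
      simp only [Function.update_self, Function.update_of_ne hp.symm, Finset.mem_filter] at hy hz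
      rw [hy.2, hz.2]
    rw [one_div_mul_cancel hY.ne']
    exact_mod_cast this
  have h2 : #{x : G → Y | ¬ Function.Injective x} ≤
      ∑ p ∈ ({p : G × G | p.1 ≠ p.2} : Finset (G × G)), #{x : G → Y | x p.1 = x p.2} := by
    refine le_trans (Finset.card_le_card ?_) Finset.card_biUnion_le
    intro x hx
    simp only [Finset.mem_filter, Finset.mem_univ, true_and, Function.Injective, not_forall] at hx
    obtain ⟨a, b, hab, hne⟩ := hx
    simp only [Finset.mem_biUnion, Finset.mem_filter, Finset.mem_univ, true_and]
    exact ⟨(a, b), hne, hab⟩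
  have h3 : (#{x : G → Y | ¬ Function.Injective x} : ℝ) ≤
      #({p : G × G | p.1 ≠ p.2} : Finset (G × G)) •
        ((1 / Fintype.card Y : ℝ) * Fintype.card (G → Y)) := by
    refine le_trans (Nat.cast_le.2 h2) ?_
    rw [Nat.cast_sum]
    refine Finset.sum_le_card_nsmul _ _ _ fun p hp => ?_
    exact h1 p (by simpa using hp)
  have h4 : (#({p : G × G | p.1 ≠ p.2} : Finset (G × G)) : ℝ) ≤ (Fintype.card G : ℝ) ^ 2 := by
    have := Finset.card_le_univ ({p : G × G | p.1 ≠ p.2} : Finset (G × G))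
    rw [Fintype.card_prod, ← sq] at this
    exact_mod_cast this
  rw [nsmul_eq_mul] at h3
  calc _ ≤ (#({p : G × G | p.1 ≠ p.2} : Finset (G × G)) : ℝ) *
        ((1 / Fintype.card Y : ℝ) * Fintype.card (G → Y)) * Fintype.card Y := by gcongr
    _ = #({p : G × G | p.1 ≠ p.2} : Finset (G × G)) * Fintype.card (G → Y) := by
        field_simp
    _ ≤ _ := by gcongr

theorem sSup_eq_zero_of_forall_pos_notMem {S : Set ℝ} (hS : ∀ x ∈ S, 0 ≤ x)
    (h : ∀ x, 0 < x → x ∉ S) : sSup S = 0 := by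
  rcases S.eq_empty_or_nonempty with rfl | hne
  · exact Real.sSup_empty
  · have : S = {0} := hne.subset_singleton_iff.1 fun x hx =>
      le_antisymm (not_lt.1 fun h0 => h x h0 hx) (hS x hx)
    rw [this, csSup_singleton]

theorem exists_layer_bound {V : Type} [Fintype V] (f : V → ℕ) : ∃ L, ∀ v, f v < L :=
  ⟨univ.sup f + 1, fun v => Nat.lt_succ_of_le (Finset.le_sup (f := f) (Finset.mem_univ v))⟩

theorem piCo_eq_zero_of_linkOrdered {V : Type} [Fintype V] [DecidableEq V] {F : ThreeGraph V}
    (hF : IsLayered F) (hL : LinkOrdered F) : piCo F = 0 := by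
  classical
  refine sSup_eq_zero_of_forall_pos_notMem (fun x hx => hx.1) ?_
  rintro α hα ⟨-, hα1, h⟩
  obtain ⟨par, f, r, E, hpar, hE, -, hedge⟩ := hF.exists_linkSystem hL
  obtain ⟨L, hfL⟩ := exists_layer_bound f
  obtain ⟨N₀, hN₀⟩ := embeds hpar L hE hfL α hα hα1
  obtain ⟨ε, hε, p, hp, hemb⟩ := hN₀ (N₀ + 1) (Nat.le_succ _)
  obtain ⟨n, hn, H, hH, hco⟩ := h (⌈(Fintype.card V : ℝ) ^ 2 / p⌉₊ + 1)
  apply hH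
  have : Nonempty (Fin n) := ⟨⟨0, by omega⟩⟩
  let R : ℕ × Fin (N₀ + 1) × Fin n → ℕ × Fin (N₀ + 1) × Fin n →
      ℕ × Fin (N₀ + 1) × Fin n → Prop := fun a b c =>
    a.2.2 = b.2.2 ∨ ({a.2.2, b.2.2, c.2.2} : Finset (Fin n)) ∈ H.edges
  have hhost : IsHost par α ε R (fun _ _ => True) := by
    refine ⟨fun _ => trivial, ?_, ?_⟩
    · intro a b g _ _
      by_cases hab : a.2.2 = b.2.2
      · exact (Large.of_forall fun z => Or.inl hab).mono hα1 fun _ h => h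
      · have h1 : Large α fun z : Fin n => ({a.2.2, b.2.2, z} : Finset (Fin n)) ∈ H.edges := by
          rw [large_iff, Fintype.card_fin]
          exact hco _ _ hab
        have h2 := (large_comp_fst_iff (Equiv.prodComm (Fin (N₀ + 1)) (Fin n))).2 h1
        exact h2.mono le_rfl fun z hz => Or.inr hz
    · intro c b i j _ B _
      have : IsEmpty {y : Fin n // (Nat.card {y' // y' ∈ B ∧ True} : ℝ) < α * #B} := by
        refine ⟨fun ⟨y, hy⟩ => ?_⟩
        simp only [and_true, Nat.card_eq_fintype_card, Fintype.card_coe] at hy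
        nlinarith [(Nat.cast_nonneg #B : (0 : ℝ) ≤ #B)]
      rw [Nat.card_of_isEmpty]
      simp only [Nat.cast_zero]
      positivity
  obtain ⟨κ, -, hcopy⟩ := hemb hhost
  obtain ⟨x, hx, hxinj⟩ : ∃ x : V → Fin n, IsCopy par R (fun _ _ => True) f E L κ x ∧
      Function.Injective x := by
    by_contra! hcon
    rw [large_iff] at hcopy
    have h1 : #{x : V → Fin n | IsCopy par R (fun _ _ => True) f E L κ x} ≤
        #{x : V → Fin n | ¬ Function.Injective x} := by
      refine Finset.card_le_card fun x => ?_
      simp only [Finset.mem_filter, Finset.mem_univ, true_and]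
      exact hcon x
    have h2 := card_filter_not_injective_le (G := V) (Y := Fin n)
    have h3 : (0 : ℝ) < Fintype.card (V → Fin n) := by exact_mod_cast Fintype.card_pos
    have h4 : (Fintype.card V : ℝ) ^ 2 < p * n := by
      rw [← div_lt_iff₀' hp]
      refine (Nat.le_ceil _).trans_lt ?_
      exact_mod_cast hn
    rw [Fintype.card_fin] at h2
    have h5 : p * Fintype.card (V → Fin n) * n ≤
        (Fintype.card V : ℝ) ^ 2 * Fintype.card (V → Fin n) := by
      refine le_trans ?_ h2
      gcongr
      exact hcopy.trans (by exact_mod_cast h1)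
    nlinarith
  refine ⟨x, hxinj, fun e he => ?_⟩
  obtain ⟨u, v, w, rfl, huvw⟩ := hedge e he
  have hne := F.ne_of_mem he
  have := hx.1 u v w huvw
  simp only [R, hxinj.eq_iff, hne.1, false_or] at this
  simpa [Finset.image_insert] using this

/-- A lower tail bound: independent events of probability at least `ρ` rarely happen less than a
fixed proportion `θ` of the time. -/
theorem exists_card_few_hits_le {ρ : ℝ} (hρ : 0 < ρ) (hρ1 : ρ ≤ 1) :
    ∃ θ : ℝ, 0 < θ ∧ ∃ t : ℝ, 0 < t ∧ t < 1 ∧ ∀ {I Ω : Type} [Fintype I] [DecidableEq I]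
      [Fintype Ω] [DecidableEq Ω] (J : Finset I) (A : I → Finset Ω),
      (∀ j ∈ J, ρ * Fintype.card Ω ≤ #(A j)) →
      (#{c : I → Ω | (#{j ∈ J | c j ∈ A j} : ℝ) < θ * #J} : ℝ) ≤
        t ^ #J * Fintype.card (I → Ω) := by
  have h2 : 0 < 1 - ρ / 2 := by linarith
  have h4 : 0 < 1 - ρ / 4 := by linarith
  have hq : 1 < (1 - ρ / 4) / (1 - ρ / 2) := by
    rw [one_lt_div h2]
    linarith
  refine ⟨Real.logb 2 ((1 - ρ / 4) / (1 - ρ / 2)), Real.logb_pos one_lt_two hq, 1 - ρ / 4, h4,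
    by linarith, ?_⟩
  intro I Ω _ _ _ _ J A hA
  set θ := Real.logb 2 ((1 - ρ / 4) / (1 - ρ / 2)) with hθ
  have hpow : (2 : ℝ) ^ θ = (1 - ρ / 4) / (1 - ρ / 2) :=
    Real.rpow_logb (by norm_num) (by norm_num) (by positivity)
  let wt : I → Ω → ℝ := fun i ω => if i ∈ J ∧ ω ∈ A i then 1 / 2 else 1
  have hwt : ∀ i ω, 0 < wt i ω := fun i ω => by
    simp only [wt]
    split_ifs <;> norm_num
  have hsum : ∑ c : I → Ω, ∏ i, wt i (c i) ≤
      (1 - ρ / 2) ^ #J * Fintype.card (I → Ω) := by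
    rw [← Fintype.prod_sum]
    have hle : ∀ i, ∑ ω, wt i ω ≤ (if i ∈ J then 1 - ρ / 2 else 1) * Fintype.card Ω := by
      intro i
      by_cases hi : i ∈ J
      · have h5 : ∑ ω, wt i ω = Fintype.card Ω - #(A i) / 2 := by
          have h6 : ∀ ω, wt i ω = 1 - if ω ∈ A i then 1 / 2 else 0 := fun ω => by
            simp only [wt, hi, true_and]
            split_ifs <;> norm_num
          simp only [h6, Finset.sum_sub_distrib, Finset.sum_const, Finset.card_univ, nsmul_eq_mul,
            mul_one, Finset.sum_ite_mem, Finset.univ_inter]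
          ring
        rw [h5, if_pos hi]
        linarith [hA i hi]
      · simp [wt, hi]
    calc ∏ i, ∑ ω, wt i ω ≤ ∏ i, (if i ∈ J then 1 - ρ / 2 else 1) * (Fintype.card Ω : ℝ) :=
          Finset.prod_le_prod (fun i _ => Finset.sum_nonneg fun ω _ => (hwt i ω).le)
            fun i _ => hle i
      _ = _ := by
          rw [Finset.prod_mul_distrib, Finset.prod_ite_mem, Finset.univ_inter, Finset.prod_const,
            Finset.prod_const, Finset.card_univ, Fintype.card_fun]
          push_cast
          rfl
  have hmarkov : (#{c : I → Ω | (#{j ∈ J | c j ∈ A j} : ℝ) < θ * #J} : ℝ) *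
      ((2 : ℝ) ^ (θ * #J))⁻¹ ≤ ∑ c : I → Ω, ∏ i, wt i (c i) := by
    rw [← nsmul_eq_mul, ← Finset.sum_const]
    refine le_trans (Finset.sum_le_sum fun c hc => ?_) (Finset.sum_le_sum_of_subset_of_nonneg
      (Finset.subset_univ _) fun c _ _ => Finset.prod_nonneg fun i _ => (hwt i _).le)
    simp only [Finset.mem_filter, Finset.mem_univ, true_and] at hc
    have h5 : ∏ i, wt i (c i) = (1 / 2 : ℝ) ^ #{j ∈ J | c j ∈ A j} := by
      simp only [wt]
      rw [Finset.prod_ite, Finset.prod_const, Finset.prod_const_one, mul_one]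
      congr 2
      ext i
      simp
    rw [h5, one_div, inv_pow, ← Real.rpow_natCast]
    exact inv_anti₀ (by positivity) (Real.rpow_le_rpow_of_exponent_le one_le_two hc.le)
  have h6 := hmarkov.trans hsum
  rw [mul_inv_le_iff₀ (by positivity), Real.rpow_mul (by norm_num), hpow,
    Real.rpow_natCast] at h6
  refine h6.trans (le_of_eq ?_)
  have h7 : (1 - ρ / 2) ^ #J ≠ 0 := (pow_pos h2 _).ne'
  rw [div_pow, mul_right_comm, mul_div_cancel₀ _ h7]

theorem exists_forall_not_of_card_mul_lt {Ω ι : Type*} [Fintype Ω] [Nonempty Ω] [Fintype ι]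
    (Bad : ι → Ω → Prop) [∀ i, DecidablePred (Bad i)] {ε : ℝ}
    (h : ∀ i, (#{ω | Bad i ω} : ℝ) ≤ ε * Fintype.card Ω) (hε : Fintype.card ι * ε < 1) :
    ∃ ω, ∀ i, ¬ Bad i ω := by
  by_contra! hcon
  have hΩ : (0 : ℝ) < Fintype.card Ω := by exact_mod_cast Fintype.card_pos
  have h1 : Fintype.card Ω ≤ ∑ i, #{ω | Bad i ω} := by
    classical
    refine le_trans (Finset.card_le_card fun ω _ => ?_) Finset.card_biUnion_le
    simpa using hcon ω
  have h2 : (Fintype.card Ω : ℝ) ≤ ∑ i, (#{ω | Bad i ω} : ℝ) := by exact_mod_cast h1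
  have h3 : ∑ i, (#{ω | Bad i ω} : ℝ) ≤ Fintype.card ι * (ε * Fintype.card Ω) := by
    rw [← nsmul_eq_mul, ← Finset.card_univ]
    exact Finset.sum_le_card_nsmul _ _ _ fun i _ => h i
  nlinarith

theorem LinkOrdered.of_key {V κ : Type*} [Fintype V] [DecidableEq V] [LinearOrder κ]
    {F : ThreeGraph V} (key : V → κ) (hkey : Function.Injective key)
    (h : ∀ u v x w, key u < key v → key v < key x → {u, v, w} ∈ F.edges →
      {v, x, w} ∈ F.edges → False) : LinkOrdered F := by
  let r : V → ℕ := fun v => #{u | key u < key v}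
  have hr : ∀ {u v}, key u < key v → r u < r v := fun {u v} huv => by
    refine Finset.card_lt_card (Finset.ssubset_iff_of_subset (fun z hz => ?_) |>.2 ⟨u, ?_⟩)
    · simp only [Finset.mem_filter, Finset.mem_univ, true_and] at hz ⊢
      exact hz.trans huv
    · simp [huv]
  have hr' : ∀ {u v}, r u < r v → key u < key v := fun {u v} huv => by
    rcases lt_trichotomy (key u) (key v) with h1 | h1 | h1
    · exact h1
    · simp [hkey h1] at huv
    · exact absurd (hr h1) huv.asymm
  refine ⟨r, fun u v huv => ?_, fun u v x w h1 h2 => h u v x w (hr' h1) (hr' h2)⟩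
  rcases lt_trichotomy (key u) (key v) with h1 | h1 | h1
  · exact absurd huv (hr h1).ne
  · exact hkey h1
  · exact absurd huv.symm (hr h1).ne

/-- The image of a 3-graph under a bijection. -/
def ThreeGraph.mapEquiv {V W : Type*} [DecidableEq W] (H : ThreeGraph V) (φ : V ≃ W) :
    ThreeGraph W where
  edges := H.edges.image fun e => e.image φ
  card_eq := by
    intro e he
    obtain ⟨e', he', rfl⟩ := Finset.mem_image.1 he
    rw [Finset.card_image_of_injective _ φ.injective, H.card_eq e' he']

theorem ThreeGraph.image_mem_mapEquiv_iff {V W : Type*} [DecidableEq W] (H : ThreeGraph V)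
    (φ : V ≃ W) {e : Finset V} : e.image φ ∈ (H.mapEquiv φ).edges ↔ e ∈ H.edges :=
  Function.Injective.mem_finset_image (Finset.image_injective φ.injective)

theorem HasCopy.of_mapEquiv {V W U : Type*} [DecidableEq V] [DecidableEq W] {H : ThreeGraph V}
    {φ : V ≃ W} {F : ThreeGraph U} (h : HasCopy (H.mapEquiv φ) F) : HasCopy H F := by
  obtain ⟨ψ, hψ, hedge⟩ := h
  refine ⟨φ.symm ∘ ψ, φ.symm.injective.comp hψ, fun e he => ?_⟩
  rw [← H.image_mem_mapEquiv_iff φ, Finset.image_image]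
  have : φ ∘ φ.symm ∘ ψ = ψ := by
    ext
    simp
  rw [this]
  exact hedge e he

theorem codeg_mapEquiv {V W : Type*} [DecidableEq V] [Fintype V] [DecidableEq W] [Fintype W]
    (H : ThreeGraph V) (φ : V ≃ W) (u v : V) :
    codeg (H.mapEquiv φ) (φ u) (φ v) = codeg H u v := by
  unfold codeg
  symm
  refine Finset.card_bij (fun w _ => φ w) ?_ (fun _ _ _ _ h => φ.injective h) ?_
  · intro w hw
    simp only [Finset.mem_filter, Finset.mem_univ, true_and] at hw ⊢
    rw [← H.image_mem_mapEquiv_iff φ] at hw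
    simpa [Finset.image_insert] using hw
  · intro w hw
    simp only [Finset.mem_filter, Finset.mem_univ, true_and] at hw
    refine ⟨φ.symm w, ?_, by simp⟩
    simp only [Finset.mem_filter, Finset.mem_univ, true_and]
    rw [← H.image_mem_mapEquiv_iff φ]
    simpa [Finset.image_insert] using hw

theorem codeg_comm {V : Type*} [DecidableEq V] [Fintype V] (H : ThreeGraph V) (u v : V) :
    codeg H u v = codeg H v u := by
  unfold codeg
  simp only [Finset.insert_comm u v]

section Arc

variable {m N : ℕ}

/-- The displacement from `x` to `y` along the circle of arcs; points of the same arc are treated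
as being in consecutive arcs. -/
def arcDiff (x y : ZMod m × Fin N) : ZMod m :=
  if y.1 - x.1 ≠ 0 then y.1 - x.1 else if x.2 < y.2 then 1 else -1

theorem arcDiff_ne_zero (hm : 3 ≤ m) (x y : ZMod m × Fin N) : arcDiff x y ≠ 0 := by
  have : Fact (1 < m) := ⟨by omega⟩
  unfold arcDiff
  split_ifs with h1 h2
  · exact h1
  · exact one_ne_zero
  · exact neg_ne_zero.2 one_ne_zero

theorem arcDiff_of_ne {x y : ZMod m × Fin N} (h : x.1 ≠ y.1) : arcDiff x y = y.1 - x.1 := by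
  simp [arcDiff, sub_eq_zero, h.symm]

theorem exists_arc_coloring (hm : 3 ≤ m) [NeZero m] : ∃ θ : ℝ, 0 < θ ∧ ∃ N₀ : ℕ, ∀ N ≥ N₀,
    ∃ c : ZMod m × Fin N → ZMod m × Fin N → {δ : ZMod m // δ ≠ 0},
      (∀ x y, x ≠ y → θ * N ≤ (#{w | (c w x : ZMod m) = arcDiff x y ∧
        (c w y : ZMod m) = arcDiff y x} : ℝ)) ∧
      ∀ w a δ, θ * N ≤ (#{y | y.1 = a ∧ c w y = δ} : ℝ) := by
  classical
  have hm0 : (1 : ℝ) ≤ m := by exact_mod_cast (by omega : 1 ≤ m)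
  have hρ : (0 : ℝ) < 1 / (m : ℝ) ^ 2 := by positivity
  have hρ1 : 1 / (m : ℝ) ^ 2 ≤ 1 := by
    rw [div_le_one (by positivity)]
    nlinarith
  obtain ⟨θ, hθ, t, ht, ht1, hcher⟩ := exists_card_few_hits_le hρ hρ1
  have hlim := (tendsto_pow_const_mul_const_pow_of_abs_lt_one 2
    (by rwa [abs_of_pos ht] : |t| < 1)).eventually_lt_const
    (by positivity : (0 : ℝ) < 1 / (2 * (m : ℝ) ^ 3))
  obtain ⟨N₀, hN₀⟩ := Filter.eventually_atTop.1 hlim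
  refine ⟨θ, hθ, N₀ + 1, fun N hN => ?_⟩
  have hNt := hN₀ N (by omega)
  have hN1 : (1 : ℝ) ≤ N := by exact_mod_cast (by omega : 1 ≤ N)
  have hΔ : Fintype.card {δ : ZMod m // δ ≠ 0} ≤ m := by
    refine (Fintype.card_subtype_le _).trans (le_of_eq (ZMod.card m))
  have : Nonempty {δ : ZMod m // δ ≠ 0} := by
    have : Fact (1 < m) := ⟨by omega⟩
    exact ⟨⟨1, one_ne_zero⟩⟩
  let dd : ZMod m × Fin N → ZMod m × Fin N → {δ : ZMod m // δ ≠ 0} := fun x y =>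
    ⟨arcDiff x y, arcDiff_ne_zero hm x y⟩
  let Bad : ((ZMod m × Fin N) × (ZMod m × Fin N)) ⊕
      ((ZMod m × Fin N) × ZMod m × {δ : ZMod m // δ ≠ 0}) →
      (ZMod m × Fin N → ZMod m × Fin N → {δ : ZMod m // δ ≠ 0}) → Prop := fun s c =>
    match s with
    | Sum.inl (x, y) => x ≠ y ∧ (#{w | c w x = dd x y ∧ c w y = dd y x} : ℝ) < θ * N
    | Sum.inr (w, a, δ) => (#{y | y.1 = a ∧ c w y = δ} : ℝ) < θ * N
  have hBad : ∀ s, (#{c | Bad s c} : ℝ) ≤ t ^ N *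
      Fintype.card (ZMod m × Fin N → ZMod m × Fin N → {δ : ZMod m // δ ≠ 0}) := by
    rintro (⟨x, y⟩ | ⟨w, a, δ⟩)
    · by_cases hxy : x = y
      · simp only [Bad, hxy, ne_eq, not_true_eq_false, false_and, Finset.filter_false,
          Finset.card_empty, Nat.cast_zero]
        positivity
      · have h1 := hcher (I := ZMod m × Fin N)
          (Ω := ZMod m × Fin N → {δ : ZMod m // δ ≠ 0}) Finset.univ
          (fun _ => {row | row x = dd x y ∧ row y = dd y x}) (fun _ _ => by
            rw [one_div_mul_eq_div, div_le_iff₀ (by positivity)]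
            have h2 : Fintype.card (ZMod m × Fin N → {δ : ZMod m // δ ≠ 0}) ≤
                Fintype.card ({row : ZMod m × Fin N → {δ : ZMod m // δ ≠ 0} //
                  row x = dd x y ∧ row y = dd y x} × {δ : ZMod m // δ ≠ 0} ×
                  {δ : ZMod m // δ ≠ 0}) := by
              refine Fintype.card_le_of_injective (fun row => (⟨Function.update
                (Function.update row x (dd x y)) y (dd y x), ?_, by simp⟩, row x, row y)) ?_
              · rw [Function.update_of_ne hxy, Function.update_self]
              · intro row row' h
                simp only [Prod.mk.injEq, Subtype.mk.injEq] at h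
                ext z
                by_cases hzx : z = x
                · rw [hzx, h.2.1]
                by_cases hzy : z = y
                · rw [hzy, h.2.2]
                have := congrFun h.1 z
                rw [Function.update_of_ne hzy, Function.update_of_ne hzx,
                  Function.update_of_ne hzy, Function.update_of_ne hzx] at this
                rw [this]
            rw [Fintype.card_prod, Fintype.card_prod, Fintype.card_subtype] at h2
            have h3 := h2.trans (Nat.mul_le_mul_left _ (Nat.mul_le_mul hΔ hΔ))
            rw [← sq] at h3
            exact_mod_cast h3)
        have h2 : t ^ #(Finset.univ : Finset (ZMod m × Fin N)) ≤ t ^ N := by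
          refine pow_le_pow_of_le_one ht.le ht1.le ?_
          rw [Finset.card_univ, Fintype.card_prod, Fintype.card_fin]
          exact Nat.le_mul_of_pos_left _ Fintype.card_pos
        refine le_trans ?_ (h1.trans (mul_le_mul_of_nonneg_right h2 (Nat.cast_nonneg _)))
        norm_cast
        refine Finset.card_le_card fun c => ?_
        simp only [Bad, Finset.mem_filter, Finset.mem_univ, true_and]
        rintro ⟨-, h3⟩
        refine h3.trans_le ?_
        gcongr
        rw [Finset.card_univ, Fintype.card_prod, Fintype.card_fin]
        exact Nat.le_mul_of_pos_left _ Fintype.card_pos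
    · have : Nonempty (ZMod m × Fin N → {δ : ZMod m // δ ≠ 0}) := inferInstance
      refine card_le_of_update (Bad (Sum.inr (w, a, δ))) w fun c => ?_
      simp only [Bad, Function.update_self]
      have hJ : #{y : ZMod m × Fin N | y.1 = a} = N := by
        have : ({y : ZMod m × Fin N | y.1 = a} : Finset _) = {a} ×ˢ Finset.univ := by
          ext y
          simp only [Finset.mem_filter, Finset.mem_univ, true_and, Finset.mem_product,
            Finset.mem_singleton, and_true]
        rw [this]
        simp
      have h1 := hcher (I := ZMod m × Fin N) (Ω := {δ : ZMod m // δ ≠ 0})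
        {y | y.1 = a} (fun _ => {δ}) (fun _ _ => by
          rw [one_div_mul_eq_div, div_le_iff₀ (by positivity), Finset.card_singleton]
          have : (Fintype.card {δ : ZMod m // δ ≠ 0} : ℝ) ≤ m := by exact_mod_cast hΔ
          push_cast
          nlinarith)
      rw [hJ] at h1
      simpa only [Finset.filter_filter, Finset.mem_singleton] using h1
  obtain ⟨c, hc⟩ := exists_forall_not_of_card_mul_lt Bad hBad (by
    simp only [Fintype.card_sum, Fintype.card_prod, ZMod.card, Fintype.card_fin]
    have h1 : (Fintype.card {δ : ZMod m // δ ≠ 0} : ℝ) ≤ m := by exact_mod_cast hΔ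
    push_cast
    have h2 : (m : ℝ) * N * (m * N) + m * N * (m * Fintype.card {δ : ZMod m // δ ≠ 0}) ≤
        2 * (m : ℝ) ^ 3 * (N : ℝ) ^ 2 := by
      calc _ ≤ (m : ℝ) * N * (m * N) * m + m * N * (m * m) * N := by
            refine add_le_add (le_mul_of_one_le_right (by positivity) hm0) ?_
            refine le_trans ?_ (le_mul_of_one_le_right (by positivity) hN1)
            gcongr
        _ = _ := by ring
    rw [lt_div_iff₀ (by positivity)] at hNt
    calc _ ≤ 2 * (m : ℝ) ^ 3 * (N : ℝ) ^ 2 * t ^ N := by gcongr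
      _ = (N : ℝ) ^ 2 * t ^ N * (2 * (m : ℝ) ^ 3) := by ring
      _ < 1 := hNt)
  refine ⟨c, fun x y hxy => ?_, fun w a δ => ?_⟩
  · have h1 := hc (Sum.inl (x, y))
    simp only [Bad, not_and, not_lt] at h1
    simpa only [dd, Subtype.ext_iff] using h1 hxy
  · have h1 := hc (Sum.inr (w, a, δ))
    simpa only [Bad, not_lt] using h1

end Arc

section ArcGraph

variable {m N : ℕ}

/-- The vertices `s`, `t` and `z` form an edge of the arc graph with apex `z`. -/
def IsArcEdge (c : ZMod m × Fin N → ZMod m × Fin N → {δ : ZMod m // δ ≠ 0})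
    (s t z : ZMod 3 × ZMod m × Fin N) : Prop :=
  t.1 = s.1 ∧ z.1 = s.1 + 1 ∧ s.2 ≠ t.2 ∧ (c z.2 s.2 : ZMod m) = arcDiff s.2 t.2 ∧
    (c z.2 t.2 : ZMod m) = arcDiff t.2 s.2

theorem IsArcEdge.symm {c : ZMod m × Fin N → ZMod m × Fin N → {δ : ZMod m // δ ≠ 0}}
    {s t z : ZMod 3 × ZMod m × Fin N} (h : IsArcEdge c s t z) : IsArcEdge c t s z :=
  ⟨h.1.symm, h.1.symm ▸ h.2.1, h.2.2.1.symm, h.2.2.2.2, h.2.2.2.1⟩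

theorem IsArcEdge.ne {c : ZMod m × Fin N → ZMod m × Fin N → {δ : ZMod m // δ ≠ 0}}
    {s t z : ZMod 3 × ZMod m × Fin N} (h : IsArcEdge c s t z) : s ≠ t ∧ s ≠ z ∧ t ≠ z := by
  have h1 : ∀ a : ZMod 3, a ≠ a + 1 := by decide
  refine ⟨fun h2 => h.2.2.1 (by rw [h2]), fun h2 => ?_, fun h2 => ?_⟩
  · exact h1 s.1 (by rw [← h.2.1, ← h2])
  · exact h1 s.1 (by rw [← h.2.1, ← h2, h.1])

open Classical in
/-- The 3-graph on three cyclically arranged copies of `ZMod m × Fin N` whose edges are determined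
by the colouring `c`. -/
noncomputable def arcGraph [NeZero m]
    (c : ZMod m × Fin N → ZMod m × Fin N → {δ : ZMod m // δ ≠ 0}) :
    ThreeGraph (ZMod 3 × ZMod m × Fin N) where
  edges := {e | ∃ s t z, IsArcEdge c s t z ∧ e = {s, t, z}}
  card_eq := by
    intro e he
    simp only [Finset.mem_filter, Finset.mem_univ, true_and] at he
    obtain ⟨s, t, z, h, rfl⟩ := he
    rw [Finset.card_eq_three]
    exact ⟨s, t, z, h.ne.1, h.ne.2.1, h.ne.2.2, rfl⟩

variable [NeZero m] {c : ZMod m × Fin N → ZMod m × Fin N → {δ : ZMod m // δ ≠ 0}}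

theorem IsArcEdge.mem {s t z : ZMod 3 × ZMod m × Fin N} (h : IsArcEdge c s t z) :
    {s, t, z} ∈ (arcGraph c).edges := by
  simp only [arcGraph, Finset.mem_filter, Finset.mem_univ, true_and]
  exact ⟨s, t, z, h, by ext; simp⟩

theorem isArcEdge_of_mem {u v w : ZMod 3 × ZMod m × Fin N}
    (h : {u, v, w} ∈ (arcGraph c).edges) :
    IsArcEdge c u v w ∨ IsArcEdge c u w v ∨ IsArcEdge c v w u := by
  have hne := (arcGraph c).ne_of_mem h
  simp only [arcGraph, Finset.mem_filter, Finset.mem_univ, true_and] at h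
  obtain ⟨s, t, z, h, he⟩ := h
  have hu : u = s ∨ u = t ∨ u = z := by
    have h1 : u ∈ ({s, t, z} : Finset _) := by
      rw [← he]
      simp
    simpa using h1
  have hv : v = s ∨ v = t ∨ v = z := by
    have h1 : v ∈ ({s, t, z} : Finset _) := by
      rw [← he]
      simp
    simpa using h1
  have hw : w = s ∨ w = t ∨ w = z := by
    have h1 : w ∈ ({s, t, z} : Finset _) := by
      rw [← he]
      simp
    simpa using h1
  have h' := h.symm
  rcases hu with rfl | rfl | rfl <;> rcases hv with rfl | rfl | rfl <;>
    rcases hw with rfl | rfl | rfl <;> simp_all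

theorem le_codeg_arcGraph {K : ℝ}
    (h₁ : ∀ x y, x ≠ y → K ≤ (#{w | (c w x : ZMod m) = arcDiff x y ∧
        (c w y : ZMod m) = arcDiff y x} : ℝ))
    (h₂ : ∀ w a δ, K ≤ (#{y | y.1 = a ∧ c w y = δ} : ℝ))
    {u v : ZMod 3 × ZMod m × Fin N} (huv : u ≠ v) : K ≤ (codeg (arcGraph c) u v : ℝ) := by
  have hconsec : ∀ {u v : ZMod 3 × ZMod m × Fin N}, v.1 = u.1 + 1 →
      K ≤ (codeg (arcGraph c) u v : ℝ) := by
    intro u v huv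
    set δ := c v.2 u.2 with hδ
    refine (h₂ v.2 (u.2.1 + δ) ⟨-δ, neg_ne_zero.2 δ.2⟩).trans ?_
    norm_cast
    refine Finset.card_le_card_of_injOn (fun y => (u.1, y)) ?_ (fun y _ y' _ h => by simpa using h)
    intro y hy
    simp only [Finset.coe_filter, Finset.mem_univ, true_and, Set.mem_ofPred_eq,
      Subtype.ext_iff] at hy ⊢
    have hne : u.2.1 ≠ y.1 := by
      rw [hy.1]
      simp [δ.2]
    have h3 : IsArcEdge c u (u.1, y) v := by
      refine ⟨rfl, huv, fun h => hne (by rw [h]), ?_, ?_⟩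
      · simp only
        rw [arcDiff_of_ne hne, hy.1, ← hδ]
        ring
      · simp only
        rw [arcDiff_of_ne hne.symm, hy.1, hy.2]
        ring
    have h4 := h3.mem
    rwa [Finset.pair_comm] at h4
  have h3 : ∀ a b : ZMod 3, a = b ∨ b = a + 1 ∨ a = b + 1 := by decide
  rcases h3 u.1 v.1 with h | h | h
  · have hne : u.2 ≠ v.2 := fun h' => huv (Prod.ext h h')
    refine (h₁ u.2 v.2 hne).trans ?_
    norm_cast
    refine Finset.card_le_card_of_injOn (fun w => (u.1 + 1, w)) ?_
      (fun y _ y' _ h => by simpa using h)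
    intro w hw
    simp only [Finset.coe_filter, Finset.mem_univ, true_and, Set.mem_ofPred_eq] at hw ⊢
    exact IsArcEdge.mem ⟨h.symm, rfl, hne, hw.1, hw.2⟩
  · exact hconsec h
  · rw [codeg_comm]
    exact hconsec h

/-- The key by which the points are ordered after the circle is cut at the arc `j`. -/
def cutKey (j : ZMod m) (x : ZMod m × Fin N) : ℕ ×ₗ ℕ :=
  toLex ((x.1 - j).val, x.2.val)

theorem cutKey_injective (j : ZMod m) : Function.Injective (cutKey (N := N) j) := by
  intro x y h
  simp only [cutKey, EmbeddingLike.apply_eq_iff_eq, Prod.mk.injEq] at h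
  refine Prod.ext ?_ (Fin.ext h.2)
  simpa using ZMod.val_injective m h.1

theorem arcDiff_ne_of_cutKey_lt (hm : 3 ≤ m) {j : ZMod m} {x y z : ZMod m × Fin N}
    (hx : x.1 ≠ j) (hxy : cutKey j x < cutKey j y)
    (hyz : cutKey j y < cutKey j z) : arcDiff y x ≠ arcDiff y z := by
  intro h
  have hm1 : Fact (1 < m) := ⟨by omega⟩
  have hsucc : ∀ {a b : ZMod m}, a ≠ j → a - b = 1 → (b - j).val < (a - j).val := by
    intro a b ha hab
    have h1 : a - j = (b - j) + 1 := by rw [← hab]; ring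
    have h2 : (a - j).val ≠ 0 := by simpa [ZMod.val_eq_zero, sub_eq_zero] using ha
    rw [h1, ZMod.val_add, ZMod.val_one] at h2 ⊢
    have h3 := ZMod.val_lt (b - j)
    rcases (by omega : (b - j).val + 1 < m ∨ (b - j).val + 1 = m) with h4 | h4
    · rw [Nat.mod_eq_of_lt h4]
      omega
    · rw [h4, Nat.mod_self] at h2
      exact absurd rfl h2
  simp only [cutKey, Prod.Lex.toLex_lt_toLex] at hxy hyz
  have hval : ∀ {a b : ZMod m}, (a - j).val = (b - j).val → a = b := fun h => by
    simpa using ZMod.val_injective m h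
  by_cases h1 : y.1 = x.1 <;> by_cases h2 : y.1 = z.1
  · have h3 : arcDiff y x = -1 := by
      have : ¬ y.2 < x.2 := by
        rw [h1] at hxy
        simp only [lt_self_iff_false, true_and, false_or, Fin.val_fin_lt] at hxy
        exact hxy.asymm
      simp [arcDiff, h1, this]
    have h4 : arcDiff y z = 1 := by
      have : y.2 < z.2 := by
        rw [h2] at hyz
        simpa using hyz
      simp [arcDiff, h2, this]
    rw [h3, h4] at h
    have h5 : Fact (2 < m) := ⟨by omega⟩
    exact ZMod.neg_one_ne_one h
  · have h3 : arcDiff y x = -1 := by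
      have : ¬ y.2 < x.2 := by
        rw [h1] at hxy
        simp only [lt_self_iff_false, true_and, false_or, Fin.val_fin_lt] at hxy
        exact hxy.asymm
      simp [arcDiff, h1, this]
    rw [h3, arcDiff_of_ne h2] at h
    have h4 := hsucc (a := y.1) (b := z.1) (by rw [h1]; exact hx) (by rw [← neg_sub, ← h, neg_neg])
    omega
  · have h4 : arcDiff y z = 1 := by
      have : y.2 < z.2 := by
        rw [h2] at hyz
        simpa using hyz
      simp [arcDiff, h2, this]
    rw [h4, arcDiff_of_ne h1] at h
    have h5 := hsucc hx h
    omega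
  · rw [arcDiff_of_ne h1, arcDiff_of_ne h2, sub_left_inj] at h
    have h3 : (x.1 - j).val ≠ (y.1 - j).val := fun h' => h1 (hval h').symm
    rw [← h] at hyz
    omega

theorem linkOrdered_of_hasCopy_arcGraph {V : Type*} [Fintype V] [DecidableEq V] {F : ThreeGraph V}
    (hm : 3 ≤ m) (hV : Fintype.card V < m) (h : HasCopy (arcGraph c) F) : LinkOrdered F := by
  obtain ⟨φ, hφ, hedge⟩ := h
  obtain ⟨j, hj⟩ : ∃ j : ZMod m, ∀ v, (φ v).2.1 ≠ j := by
    by_contra! hcon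
    have := Fintype.card_le_of_surjective (fun v => (φ v).2.1) hcon
    rw [ZMod.card] at this
    omega
  let key : V → ℕ ×ₗ ℕ ×ₗ ℕ := fun v => toLex ((φ v).1.val, cutKey j (φ v).2)
  refine LinkOrdered.of_key key (fun u v h => hφ ?_) ?_
  · simp only [key, EmbeddingLike.apply_eq_iff_eq, Prod.mk.injEq] at h
    exact Prod.ext (ZMod.val_injective 3 h.1) (cutKey_injective j h.2)
  · intro u v x w huv hvx h1 h2
    have h1' := hedge _ h1
    have h2' := hedge _ h2
    simp only [Finset.image_insert, Finset.image_singleton] at h1' h2'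
    simp only [key, Prod.Lex.toLex_lt_toLex] at huv hvx
    have hclass : (φ u).1 = (φ x).1 → (φ v).1 = (φ u).1 := by
      intro h
      refine ZMod.val_injective 3 ?_
      rw [← h] at hvx
      omega
    rcases isArcEdge_of_mem h1' with e1 | e1 | e1 <;>
      rcases isArcEdge_of_mem h2' with e2 | e2 | e2
    · have h3 : (φ v).1 = (φ u).1 := e1.1
      have h4 : (φ x).1 = (φ v).1 := e2.1
      rw [h3] at huv
      rw [h4] at hvx
      simp only [lt_self_iff_false, true_and, false_or] at huv hvx
      exact arcDiff_ne_of_cutKey_lt hm (hj u) huv hvx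
        (e1.2.2.2.2.symm.trans e2.2.2.2.1)
    all_goals
      have h3 := e1.1
      have h4 := e1.2.1
      have h5 := e2.1
      have h6 := e2.2.1
      clear e1 e2 huv hvx h1 h2 h1' h2' hedge
      generalize (φ u).1 = a at *
      generalize (φ v).1 = b at *
      generalize (φ x).1 = d at *
      generalize (φ w).1 = e at *
      revert a b d e
      decide

end ArcGraph

theorem piCo_pos_of_not_linkOrdered {V : Type} [Fintype V] [DecidableEq V] {F : ThreeGraph V}
    (hF : ¬ LinkOrdered F) : 0 < piCo F := by
  obtain ⟨m, hmdef⟩ : ∃ m, m = Fintype.card V + 3 := ⟨_, rfl⟩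
  have hm : 3 ≤ m := by omega
  have : NeZero m := ⟨by omega⟩
  have hm0 : (0 : ℝ) < m := by exact_mod_cast (by omega : 0 < m)
  obtain ⟨θ, hθ, N₀, hN₀⟩ := exists_arc_coloring hm
  have hpos : 0 < min 1 (θ / (3 * m)) := lt_min one_pos (by positivity)
  refine hpos.trans_le (le_csSup ⟨1, fun x hx => hx.2.1⟩ ⟨hpos.le, min_le_left _ _, fun n₀ => ?_⟩)
  obtain ⟨c, h₁, h₂⟩ := hN₀ (max N₀ n₀) (le_max_left _ _)
  generalize hN : max N₀ n₀ = N at c h₁ h₂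
  have hcard : Fintype.card (ZMod 3 × ZMod m × Fin N) = 3 * m * N := by
    simp [mul_assoc]
  refine ⟨3 * m * N, ?_, (arcGraph c).mapEquiv (Fintype.equivFinOfCardEq hcard), fun h => ?_,
    fun u v huv => ?_⟩
  · exact (hN ▸ le_max_right _ _ : n₀ ≤ N).trans (Nat.le_mul_of_pos_left _ (by omega))
  · exact hF (linkOrdered_of_hasCopy_arcGraph hm (by omega) h.of_mapEquiv)
  · obtain ⟨u, rfl⟩ := (Fintype.equivFinOfCardEq hcard).surjective u
    obtain ⟨v, rfl⟩ := (Fintype.equivFinOfCardEq hcard).surjective v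
    rw [codeg_mapEquiv]
    have hne : u ≠ v := fun h => huv (by rw [h])
    have hco := le_codeg_arcGraph h₁ h₂ hne
    refine le_trans ?_ hco
    calc min 1 (θ / (3 * m)) * ((3 * m * N : ℕ) : ℝ) ≤ θ / (3 * m) * ((3 * m * N : ℕ) : ℝ) := by
          gcongr
          exact min_le_right _ _
      _ = θ * N := by
          push_cast
          field_simp

theorem exists_dense_pair_coloring : ∃ θ : ℝ, 0 < θ ∧ ∀ η : ℝ, 0 < η → ∃ n₀ : ℕ, ∀ n ≥ n₀,
    ∃ c : Fin n × Fin n → Fin 3, ∀ (A B : Finset (Fin n)) (i : Fin 3),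
      θ * ((#{p ∈ A ×ˢ B | p.1 < p.2} : ℝ) - η * (n : ℝ) ^ 2) ≤
        (#{p ∈ A ×ˢ B | p.1 < p.2 ∧ c p = i} : ℝ) := by
  obtain ⟨θ, hθ, t, ht, ht1, hcher⟩ :=
    exists_card_few_hits_le (ρ := 1 / 3) (by norm_num) (by norm_num)
  refine ⟨θ, hθ, fun η hη => ?_⟩
  obtain ⟨k, hk⟩ := exists_pow_lt_of_lt_one (by norm_num : (0 : ℝ) < 1 / 16) ht1
  refine ⟨⌈(k : ℝ) / η⌉₊ + 1, fun n hn => ?_⟩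
  have hkn : (k : ℝ) ≤ η * n := by
    rw [← div_le_iff₀' hη]
    refine (Nat.le_ceil _).trans ?_
    exact_mod_cast (by omega : ⌈(k : ℝ) / η⌉₊ ≤ n)
  let J : Finset (Fin n) × Finset (Fin n) × Fin 3 → Finset (Fin n × Fin n) := fun s =>
    {p ∈ s.1 ×ˢ s.2.1 | p.1 < p.2}
  obtain ⟨c, hc⟩ := exists_forall_not_of_card_mul_lt (ε := (1 / 16) ^ n)
    (fun (s : Finset (Fin n) × Finset (Fin n) × Fin 3) (c : Fin n × Fin n → Fin 3) =>
      η * (n : ℝ) ^ 2 ≤ #(J s) ∧ (#{p ∈ J s | c p ∈ ({s.2.2} : Finset (Fin 3))} : ℝ) < θ * #(J s))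
    (fun s => by
      by_cases hJ : η * (n : ℝ) ^ 2 ≤ #(J s)
      · simp only [hJ, true_and]
        refine (hcher (J s) (fun _ => {s.2.2}) (by simp)).trans ?_
        gcongr
        have h1 : k * n ≤ #(J s) := by
          have : ((k * n : ℕ) : ℝ) ≤ #(J s) := by
            refine le_trans ?_ hJ
            push_cast
            nlinarith [(Nat.cast_nonneg n : (0 : ℝ) ≤ n)]
          exact_mod_cast this
        calc t ^ #(J s) ≤ t ^ (k * n) := pow_le_pow_of_le_one ht.le ht1.le h1
          _ = (t ^ k) ^ n := pow_mul _ _ _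
          _ ≤ (1 / 16) ^ n := by gcongr
      · simp only [hJ, false_and, Finset.filter_false, Finset.card_empty, Nat.cast_zero]
        positivity)
    (by
      simp only [Fintype.card_prod, Fintype.card_finset, Fintype.card_fin]
      push_cast
      have h1 : (2 : ℝ) ^ n * (2 ^ n * 3) * (1 / 16) ^ n = 3 * (1 / 4) ^ n := by
        have h2 : (1 / 4 : ℝ) ^ n = 2 ^ n * 2 ^ n * (1 / 16) ^ n := by
          rw [← mul_pow, ← mul_pow]
          norm_num
        rw [h2]
        ring
      rw [h1]
      have h2 : (1 / 4 : ℝ) ^ n ≤ (1 / 4) ^ 1 :=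
        pow_le_pow_of_le_one (by norm_num) (by norm_num) (by omega)
      linarith)
  refine ⟨c, fun A B i => ?_⟩
  have h1 := hc (A, B, i)
  simp only [J, not_and, not_lt, Finset.filter_filter, Finset.mem_singleton] at h1
  by_cases hJ : η * (n : ℝ) ^ 2 ≤ (#{p ∈ A ×ˢ B | p.1 < p.2} : ℝ)
  · refine le_trans ?_ (h1 hJ)
    have : 0 ≤ η * (n : ℝ) ^ 2 := by positivity
    nlinarith
  · refine le_trans ?_ (Nat.cast_nonneg _)
    rw [not_le] at hJ
    nlinarith

theorem eq_of_sorted_triple_eq {κ : Type*} [LinearOrder κ] {a b c a' b' c' : κ} (hab : a < b)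
    (hbc : b < c) (hab' : a' < b') (hbc' : b' < c')
    (h : ({a, b, c} : Finset κ) = {a', b', c'}) : a = a' ∧ b = b' ∧ c = c' := by
  have h1 := Finset.ext_iff.1 h
  simp only [Finset.mem_insert, Finset.mem_singleton] at h1
  have ha := (h1 a).1 (by simp)
  have hb := (h1 b).1 (by simp)
  have hc := (h1 c).1 (by simp)
  have ha' := (h1 a').2 (by simp)
  have hb' := (h1 b').2 (by simp)
  have hc' := (h1 c').2 (by simp)
  clear h1 h
  grind

/-- The 3-graph of the increasing triples whose pairs receive three prescribed colours. -/
def colorGraph {n : ℕ} (c : Fin n × Fin n → Fin 3) : ThreeGraph (Fin n) where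
  edges := {e | ∃ x y z, x < y ∧ y < z ∧ c (x, y) = 0 ∧ c (x, z) = 1 ∧ c (y, z) = 2 ∧
    e = {x, y, z}}
  card_eq := by
    intro e he
    simp only [Finset.mem_filter, Finset.mem_univ, true_and] at he
    obtain ⟨x, y, z, hxy, hyz, -, -, -, rfl⟩ := he
    exact Finset.card_eq_three.2 ⟨x, y, z, hxy.ne, (hxy.trans hyz).ne, hyz.ne, rfl⟩

theorem mem_colorGraph_iff {n : ℕ} {c : Fin n × Fin n → Fin 3} {x y z : Fin n} (hxy : x < y)
    (hyz : y < z) : {x, y, z} ∈ (colorGraph c).edges ↔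
      c (x, y) = 0 ∧ c (x, z) = 1 ∧ c (y, z) = 2 := by
  simp only [colorGraph, Finset.mem_filter, Finset.mem_univ, true_and]
  constructor
  · rintro ⟨x', y', z', hxy', hyz', h0, h1, h2, h⟩
    obtain ⟨rfl, rfl, rfl⟩ := eq_of_sorted_triple_eq hxy hyz hxy' hyz' h
    exact ⟨h0, h1, h2⟩
  · rintro ⟨h0, h1, h2⟩
    exact ⟨x, y, z, hxy, hyz, h0, h1, h2, rfl⟩

theorem linkOrdered_of_hasCopy_colorGraph {V : Type*} [Fintype V] [DecidableEq V]
    {F : ThreeGraph V} {n : ℕ} {c : Fin n × Fin n → Fin 3} (h : HasCopy (colorGraph c) F) :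
    LinkOrdered F := by
  obtain ⟨φ, hφ, hedge⟩ := h
  refine LinkOrdered.of_key φ hφ fun u v x w huv hvx h1 h2 => ?_
  have hne1 := F.ne_of_mem h1
  have hne2 := F.ne_of_mem h2
  have e1 := hedge _ h1
  have e2 := hedge _ h2
  simp only [Finset.image_insert, Finset.image_singleton] at e1 e2
  have huw := hφ.ne hne1.2.1
  have hvw := hφ.ne hne1.2.2
  have hxw := hφ.ne hne2.2.2
  generalize φ u = u at *
  generalize φ v = v at *
  generalize φ x = x at *
  generalize φ w = w at *
  rcases hvw.lt_or_gt with hvw | hvw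
  · have h3 := (mem_colorGraph_iff huv hvw).1 e1
    rcases hxw.lt_or_gt with hxw | hxw
    · have h4 := (mem_colorGraph_iff hvx hxw).1 e2
      simp [h3.2.2] at h4
    · rw [Finset.pair_comm] at e2
      have h4 := (mem_colorGraph_iff hvw hxw).1 e2
      simp [h3.2.2] at h4
  · rw [Finset.pair_comm, Finset.insert_comm] at e2
    have h4 := (mem_colorGraph_iff hvw hvx).1 e2
    rw [Finset.pair_comm] at e1
    rcases huw.lt_or_gt with huw | huw
    · have h3 := (mem_colorGraph_iff huw hvw).1 e1
      simp [h4.1] at h3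
    · rw [Finset.insert_comm] at e1
      have h3 := (mem_colorGraph_iff huw huv).1 e1
      simp [h4.1] at h3

section Count

variable {n : ℕ}

theorem card_filter_triple_eq_sum (P : Fin n → Fin n → Fin n → Prop)
    [∀ a b c, Decidable (P a b c)] :
    #{t : Fin n × Fin n × Fin n | P t.1 t.2.1 t.2.2} = ∑ a, #{p : Fin n × Fin n | P a p.1 p.2} := by
  simp only [Finset.card_filter, Fintype.sum_prod_type]

theorem card_filter_triple_eq_sum_mid (P : Fin n → Fin n → Fin n → Prop)
    [∀ a b c, Decidable (P a b c)] :
    #{t : Fin n × Fin n × Fin n | P t.1 t.2.1 t.2.2} = ∑ b, #{p : Fin n × Fin n | P p.1 b p.2} := by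
  simp only [Finset.card_filter, Fintype.sum_prod_type]
  exact Finset.sum_comm

theorem card_filter_triple_eq_sum_last (P : Fin n → Fin n → Fin n → Prop)
    [∀ a b c, Decidable (P a b c)] :
    #{t : Fin n × Fin n × Fin n | P t.1 t.2.1 t.2.2} = ∑ c, #{p : Fin n × Fin n | P p.1 p.2 c} := by
  simp only [Finset.card_filter, Fintype.sum_prod_type]
  rw [Finset.sum_congr rfl fun a _ => Finset.sum_comm, Finset.sum_comm]

theorem sum_card_color_ge {θ η : ℝ} {c : Fin n × Fin n → Fin 3}
    (hc : ∀ (A B : Finset (Fin n)) (i : Fin 3),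
      θ * ((#{p ∈ A ×ˢ B | p.1 < p.2} : ℝ) - η * (n : ℝ) ^ 2) ≤
        (#{p ∈ A ×ˢ B | p.1 < p.2 ∧ c p = i} : ℝ)) (A B : Fin n → Finset (Fin n)) (i : Fin 3) :
    θ * (((∑ z, #{p ∈ A z ×ˢ B z | p.1 < p.2} : ℕ) : ℝ) - η * (n : ℝ) ^ 3) ≤
      ((∑ z, #{p ∈ A z ×ˢ B z | p.1 < p.2 ∧ c p = i} : ℕ) : ℝ) := by
  push_cast
  have h1 := Finset.sum_le_sum fun (z : Fin n) (_ : z ∈ Finset.univ) => hc (A z) (B z) i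
  rw [← Finset.mul_sum, Finset.sum_sub_distrib, Finset.sum_const, Finset.card_univ,
    Fintype.card_fin, nsmul_eq_mul] at h1
  refine le_trans (le_of_eq ?_) h1
  ring

theorem choose_three_le_card_sorted (U : Finset (Fin n)) :
    (#U).choose 3 ≤ #{t : Fin n × Fin n × Fin n | t.1 ∈ U ∧ t.2.1 ∈ U ∧ t.2.2 ∈ U ∧
      t.1 < t.2.1 ∧ t.2.1 < t.2.2} := by
  rw [← Finset.card_powersetCard]
  refine le_trans (Finset.card_le_card fun S hS => ?_)
    (Finset.card_image_le (f := fun t : Fin n × Fin n × Fin n => ({t.1, t.2.1, t.2.2} : Finset _)))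
  rw [Finset.mem_powersetCard] at hS
  obtain ⟨hSU, hS3⟩ := hS
  have hmono := (S.orderEmbOfFin hS3).strictMono
  have hmem : ∀ i, S.orderEmbOfFin hS3 i ∈ U := fun i => hSU (S.orderEmbOfFin_mem hS3 i)
  refine Finset.mem_image.2 ⟨(S.orderEmbOfFin hS3 0, S.orderEmbOfFin hS3 1,
    S.orderEmbOfFin hS3 2), ?_, ?_⟩
  · simp only [Finset.mem_filter, Finset.mem_univ, true_and]
    exact ⟨hmem _, hmem _, hmem _, hmono (by decide), hmono (by decide)⟩
  · rw [← Finset.coe_inj, ← S.range_orderEmbOfFin hS3]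
    ext a
    simp only [Finset.coe_insert, Finset.coe_singleton, Set.mem_insert_iff,
      Set.mem_singleton_iff, Set.mem_range, Fin.exists_fin_succ, Fin.exists_fin_zero]
    simp [eq_comm]

theorem uniformlyDense_colorGraph {θ η : ℝ} (hθ : 0 < θ) (hθ1 : θ ≤ 1) (hη : 0 < η)
    {c : Fin n × Fin n → Fin 3} (hc : ∀ (A B : Finset (Fin n)) (i : Fin 3),
      θ * ((#{p ∈ A ×ˢ B | p.1 < p.2} : ℝ) - η * (n : ℝ) ^ 2) ≤
        (#{p ∈ A ×ˢ B | p.1 < p.2 ∧ c p = i} : ℝ)) :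
    UniformlyDense (colorGraph c) (θ ^ 3) (3 * η) := by
  intro U
  let P₀ : Fin n → Fin n → Fin n → Prop := fun x y z =>
    x ∈ U ∧ y ∈ U ∧ z ∈ U ∧ x < y ∧ y < z
  let P₁ : Fin n → Fin n → Fin n → Prop := fun x y z => P₀ x y z ∧ c (y, z) = 2
  let P₂ : Fin n → Fin n → Fin n → Prop := fun x y z => P₁ x y z ∧ c (x, z) = 1
  let P₃ : Fin n → Fin n → Fin n → Prop := fun x y z => P₂ x y z ∧ c (x, y) = 0
  have h0 : (#U).choose 3 ≤ #{t : Fin n × Fin n × Fin n | P₀ t.1 t.2.1 t.2.2} :=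
    choose_three_le_card_sorted U
  have h1 : θ * ((#{t : Fin n × Fin n × Fin n | P₀ t.1 t.2.1 t.2.2} : ℝ) - η * (n : ℝ) ^ 3) ≤
      (#{t : Fin n × Fin n × Fin n | P₁ t.1 t.2.1 t.2.2} : ℝ) := by
    have := sum_card_color_ge hc (fun x => {y ∈ U | x ∈ U ∧ x < y}) (fun x => U) 2
    rw [card_filter_triple_eq_sum P₀, card_filter_triple_eq_sum P₁]
    refine (le_of_eq (congrArg (fun k : ℕ => θ * ((k : ℝ) - η * (n : ℝ) ^ 3))
      (Finset.sum_congr rfl fun x _ => congrArg Finset.card (Finset.ext fun p => ?_)))).trans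
      (this.trans (le_of_eq (congrArg (fun k : ℕ => (k : ℝ))
        (Finset.sum_congr rfl fun x _ => congrArg Finset.card (Finset.ext fun p => ?_)))))
    · simp only [P₀, Finset.mem_filter, Finset.mem_univ, Finset.mem_product]; grind
    · simp only [P₀, P₁, Finset.mem_filter, Finset.mem_univ, Finset.mem_product]; grind
  have h2 : θ * ((#{t : Fin n × Fin n × Fin n | P₁ t.1 t.2.1 t.2.2} : ℝ) - η * (n : ℝ) ^ 3) ≤
      (#{t : Fin n × Fin n × Fin n | P₂ t.1 t.2.1 t.2.2} : ℝ) := by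
    have := sum_card_color_ge hc (fun y => {x ∈ U | y ∈ U ∧ x < y})
      (fun y => {z ∈ U | y < z ∧ c (y, z) = 2}) 1
    rw [card_filter_triple_eq_sum_mid P₁, card_filter_triple_eq_sum_mid P₂]
    refine (le_of_eq (congrArg (fun k : ℕ => θ * ((k : ℝ) - η * (n : ℝ) ^ 3))
      (Finset.sum_congr rfl fun x _ => congrArg Finset.card (Finset.ext fun p => ?_)))).trans
      (this.trans (le_of_eq (congrArg (fun k : ℕ => (k : ℝ))
        (Finset.sum_congr rfl fun x _ => congrArg Finset.card (Finset.ext fun p => ?_)))))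
    · simp only [P₀, P₁, Finset.mem_filter, Finset.mem_univ, Finset.mem_product]; grind
    · simp only [P₀, P₁, P₂, Finset.mem_filter, Finset.mem_univ, Finset.mem_product]; grind
  have h3 : θ * ((#{t : Fin n × Fin n × Fin n | P₂ t.1 t.2.1 t.2.2} : ℝ) - η * (n : ℝ) ^ 3) ≤
      (#{t : Fin n × Fin n × Fin n | P₃ t.1 t.2.1 t.2.2} : ℝ) := by
    have := sum_card_color_ge hc (fun z => {x ∈ U | z ∈ U ∧ c (x, z) = 1})
      (fun z => {y ∈ U | y < z ∧ c (y, z) = 2}) 0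
    rw [card_filter_triple_eq_sum_last P₂, card_filter_triple_eq_sum_last P₃]
    refine (le_of_eq (congrArg (fun k : ℕ => θ * ((k : ℝ) - η * (n : ℝ) ^ 3))
      (Finset.sum_congr rfl fun x _ => congrArg Finset.card (Finset.ext fun p => ?_)))).trans
      (this.trans (le_of_eq (congrArg (fun k : ℕ => (k : ℝ))
        (Finset.sum_congr rfl fun x _ => congrArg Finset.card (Finset.ext fun p => ?_)))))
    · simp only [P₀, P₁, P₂, Finset.mem_filter, Finset.mem_univ, Finset.mem_product]; grind
    · simp only [P₀, P₁, P₂, P₃, Finset.mem_filter, Finset.mem_univ, Finset.mem_product]; grind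
  have h4 : #{t : Fin n × Fin n × Fin n | P₃ t.1 t.2.1 t.2.2} ≤
      #((colorGraph c).edges.filter fun e => e ⊆ U) := by
    refine Finset.card_le_card_of_injOn (fun t => {t.1, t.2.1, t.2.2}) ?_ ?_
    · intro t ht
      simp only [P₀, P₁, P₂, P₃, Finset.coe_filter, Finset.mem_univ, true_and,
        Set.mem_ofPred_eq] at ht ⊢
      obtain ⟨⟨⟨⟨hx, hy, hz, hxy, hyz⟩, h2⟩, h1⟩, h0⟩ := ht
      refine ⟨(mem_colorGraph_iff hxy hyz).2 ⟨h0, h1, h2⟩, ?_⟩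
      simp [Finset.insert_subset_iff, hx, hy, hz]
    · intro t ht t' ht' h
      simp only [P₀, P₁, P₂, P₃, Finset.coe_filter, Finset.mem_univ, true_and,
        Set.mem_ofPred_eq] at ht ht'
      have := eq_of_sorted_triple_eq ht.1.1.1.2.2.2.1 ht.1.1.1.2.2.2.2 ht'.1.1.1.2.2.2.1
        ht'.1.1.1.2.2.2.2 h
      exact Prod.ext this.1 (Prod.ext this.2.1 this.2.2)
  have h0' : ((#U).choose 3 : ℝ) ≤ #{t : Fin n × Fin n × Fin n | P₀ t.1 t.2.1 t.2.2} := by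
    exact_mod_cast h0
  have h4' : (#{t : Fin n × Fin n × Fin n | P₃ t.1 t.2.1 t.2.2} : ℝ) ≤
      #((colorGraph c).edges.filter fun e => e ⊆ U) := by
    exact_mod_cast h4
  refine le_trans ?_ h4'
  have hE : 0 ≤ η * (n : ℝ) ^ 3 := by positivity
  rw [mul_assoc 3 η]
  generalize η * (n : ℝ) ^ 3 = E at *
  have h5 : θ ^ 2 ≤ 1 := pow_le_one₀ hθ.le hθ1
  have h6 : θ ^ 3 ≤ 1 := pow_le_one₀ hθ.le hθ1
  have h7 := mul_le_mul_of_nonneg_left h2 hθ.le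
  have h8 := mul_le_mul_of_nonneg_left h1 (sq_nonneg θ)
  have h9 := mul_le_mul_of_nonneg_left h0' (pow_pos hθ 3).le
  have h10 := mul_le_mul_of_nonneg_right hθ1 hE
  have h11 := mul_le_mul_of_nonneg_right h5 hE
  have h12 := mul_le_mul_of_nonneg_right h6 hE
  linarith

end Count

theorem piUnif_pos_of_not_linkOrdered {V : Type} [Fintype V] [DecidableEq V] {F : ThreeGraph V}
    (hF : ¬ LinkOrdered F) : 0 < piUnif F := by
  obtain ⟨θ₀, hθ₀, hcol⟩ := exists_dense_pair_coloring
  have hpos : 0 < min θ₀ 1 ^ 3 := by positivity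
  refine hpos.trans_le (le_csSup ⟨1, fun x hx => hx.2.1⟩ ⟨hpos.le,
    pow_le_one₀ (by positivity) (min_le_right _ _), fun η hη n₀ => ?_⟩)
  obtain ⟨n₁, hn₁⟩ := hcol (η / 3) (by positivity)
  obtain ⟨c, hc⟩ := hn₁ (max n₀ n₁) (le_max_right _ _)
  refine ⟨max n₀ n₁, le_max_left _ _, colorGraph c,
    fun h => hF (linkOrdered_of_hasCopy_colorGraph h), ?_⟩
  have h1 := uniformlyDense_colorGraph (θ := min θ₀ 1) (η := η / 3) (by positivity)
    (min_le_right _ _) (by positivity) (c := c) (fun A B i => by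
      rcases le_total 0 ((#{p ∈ A ×ˢ B | p.1 < p.2} : ℝ) - η / 3 * ((max n₀ n₁ : ℕ) : ℝ) ^ 2)
        with h | h
      · exact (mul_le_mul_of_nonneg_right (min_le_left _ _) h).trans (hc A B i)
      · exact (mul_nonpos_of_nonneg_of_nonpos (by positivity) h).trans (Nat.cast_nonneg _))
  rwa [mul_div_cancel₀ η (by norm_num : (3 : ℝ) ≠ 0)] at h1

theorem mul_card_le_of_subset {W : Type*} {γ γ' ρ : ℝ} (hγ : 0 ≤ γ) (h1 : γ' ≤ γ * ρ) {A A₁ : Finset W}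
    (hA : ρ * #A ≤ #A₁) {s : ℝ} (hs : γ * #A₁ ≤ s) : γ' * #A ≤ s :=
  calc γ' * #A ≤ γ * ρ * #A := by gcongr
    _ = γ * (ρ * #A) := by ring
    _ ≤ γ * #A₁ := by gcongr
    _ ≤ s := hs

section Boxes

variable {W : Type*} [DecidableEq W]

/-- The number of triples in `A × B × C` that span an edge. -/
def ThreeGraph.boxCount (H : ThreeGraph W) (A B C : Finset W) : ℕ :=
  #{p ∈ A ×ˢ B ×ˢ C | {p.1, p.2.1, p.2.2} ∈ H.edges}

/-- Every box whose sides have relative size at least `γ` has density at least `δ`. -/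
def ThreeGraph.LowerDense (H : ThreeGraph W) (γ δ : ℝ) (A B C : Finset W) : Prop :=
  ∀ A₁ ⊆ A, ∀ B₁ ⊆ B, ∀ C₁ ⊆ C, γ * #A ≤ #A₁ → γ * #B ≤ #B₁ → γ * #C ≤ #C₁ →
    δ * (#A₁ * #B₁ * #C₁) ≤ H.boxCount A₁ B₁ C₁

/-- Every box whose sides have relative size at least `γ` has density at most `δ`. -/
def ThreeGraph.UpperSparse (H : ThreeGraph W) (γ δ : ℝ) (A B C : Finset W) : Prop :=
  ∀ A₁ ⊆ A, ∀ B₁ ⊆ B, ∀ C₁ ⊆ C, γ * #A ≤ #A₁ → γ * #B ≤ #B₁ → γ * #C ≤ #C₁ →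
    (H.boxCount A₁ B₁ C₁ : ℝ) ≤ δ * (#A₁ * #B₁ * #C₁)

variable (H : ThreeGraph W)

theorem ThreeGraph.boxCount_le (A B C : Finset W) :
    (H.boxCount A B C : ℝ) ≤ #A * #B * #C := by
  have : H.boxCount A B C ≤ #A * #B * #C :=
    (Finset.card_filter_le _ _).trans (by rw [Finset.card_product, Finset.card_product, mul_assoc])
  exact_mod_cast this

theorem ThreeGraph.boxCount_eq_sum (A B C : Finset W) :
    H.boxCount A B C = ∑ a ∈ A, H.boxCount {a} B C := by
  simp only [ThreeGraph.boxCount, Finset.card_filter, Finset.sum_product, Finset.sum_singleton]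

theorem ThreeGraph.boxCount_rotate (A B C : Finset W) :
    H.boxCount A B C = H.boxCount B C A := by
  refine Finset.card_bij' (fun p _ => (p.2.1, p.2.2, p.1)) (fun p _ => (p.2.2, p.1, p.2.1))
    ?_ ?_ (fun _ _ => rfl) (fun _ _ => rfl)
  · rintro ⟨x, y, z⟩ h
    simp only [Finset.mem_filter, Finset.mem_product] at h ⊢
    have e : ({y, z, x} : Finset W) = {x, y, z} := by ext; simp; tauto
    rw [e]; tauto
  · rintro ⟨x, y, z⟩ h
    simp only [Finset.mem_filter, Finset.mem_product] at h ⊢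
    have e : ({z, x, y} : Finset W) = {x, y, z} := by ext; simp; tauto
    rw [e]; tauto

theorem ThreeGraph.boxCount_swap (A B C : Finset W) :
    H.boxCount A B C = H.boxCount B A C := by
  refine Finset.card_bij' (fun p _ => (p.2.1, p.1, p.2.2)) (fun p _ => (p.2.1, p.1, p.2.2))
    ?_ ?_ (fun _ _ => rfl) (fun _ _ => rfl) <;>
  · rintro ⟨x, y, z⟩ h
    simp only [Finset.mem_filter, Finset.mem_product] at h ⊢
    rw [Finset.insert_comm y x]; tauto

variable {H} {γ δ : ℝ} {A B C : Finset W}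

theorem ThreeGraph.LowerDense.rotate (h : H.LowerDense γ δ A B C) : H.LowerDense γ δ B C A :=
  fun B' hB C' hC A' hA hb hc ha => by
    rw [← H.boxCount_rotate]
    exact le_trans (le_of_eq (by ring)) (h A' hA B' hB C' hC ha hb hc)

theorem ThreeGraph.LowerDense.swap (h : H.LowerDense γ δ A B C) : H.LowerDense γ δ B A C :=
  fun B' hB A' hA C' hC hb ha hc => by
    rw [← H.boxCount_swap, mul_comm (#B' : ℝ)]
    exact h A' hA B' hB C' hC ha hb hc

theorem ThreeGraph.LowerDense.mono {γ' ρ : ℝ} (h : H.LowerDense γ' δ A B C) (hγ : 0 ≤ γ)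
    (h1 : γ' ≤ γ * ρ) {A₁ B₁ C₁ : Finset W} (hA : A₁ ⊆ A) (hB : B₁ ⊆ B) (hC : C₁ ⊆ C)
    (ha : ρ * #A ≤ #A₁) (hb : ρ * #B ≤ #B₁) (hc : ρ * #C ≤ #C₁) :
    H.LowerDense γ δ A₁ B₁ C₁ := fun A' hA' B' hB' C' hC' ha' hb' hc' =>
  h A' (hA'.trans hA) B' (hB'.trans hB) C' (hC'.trans hC) (mul_card_le_of_subset hγ h1 ha ha')
    (mul_card_le_of_subset hγ h1 hb hb') (mul_card_le_of_subset hγ h1 hc hc')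

theorem ThreeGraph.UpperSparse.mono {γ' ρ : ℝ} (h : H.UpperSparse γ' δ A B C) (hγ : 0 ≤ γ)
    (h1 : γ' ≤ γ * ρ) {A₁ B₁ C₁ : Finset W} (hA : A₁ ⊆ A) (hB : B₁ ⊆ B) (hC : C₁ ⊆ C)
    (ha : ρ * #A ≤ #A₁) (hb : ρ * #B ≤ #B₁) (hc : ρ * #C ≤ #C₁) :
    H.UpperSparse γ δ A₁ B₁ C₁ := fun A' hA' B' hB' C' hC' ha' hb' hc' =>
  h A' (hA'.trans hA) B' (hB'.trans hB) C' (hC'.trans hC) (mul_card_le_of_subset hγ h1 ha ha')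
    (mul_card_le_of_subset hγ h1 hb hb') (mul_card_le_of_subset hγ h1 hc hc')

theorem exists_subset_card_eq_mul_le_sum {D : ℝ} {f : W → ℝ} {s : ℕ} (A : Finset W) (hs : s ≤ #A)
    (h : D * #A ≤ ∑ a ∈ A, f a) : ∃ A' ⊆ A, #A' = s ∧ D * s ≤ ∑ a ∈ A', f a := by
  induction A using Finset.strongInduction with
  | H A ih =>
    rcases hs.eq_or_lt with hs | hs
    · exact ⟨A, subset_rfl, hs.symm, by rwa [hs]⟩
    obtain ⟨a, ha, hmin⟩ := A.exists_min_image f (Finset.card_pos.1 (by omega))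
    have hcard := Finset.card_erase_add_one ha
    have hsum := Finset.add_sum_erase A f ha
    have hpos : (0 : ℝ) < #A := by exact_mod_cast (by omega : 0 < #A)
    have hc' : (#A : ℝ) = #(A.erase a) + 1 := by exact_mod_cast hcard.symm
    have hmul : #A * f a ≤ ∑ b ∈ A, f b := by
      simpa using Finset.card_nsmul_le_sum A f (f a) hmin
    obtain ⟨A', hA', h1, h2⟩ := ih _ (Finset.erase_ssubset ha) (by omega) (by
      by_cases hD : f a ≤ D
      · rw [hc'] at h; linarith
      · have : #(A.erase a) * f a ≤ ∑ b ∈ A.erase a, f b := by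
          simpa using Finset.card_nsmul_le_sum (A.erase a) f (f a)
            fun b hb => hmin b (Finset.mem_of_mem_erase hb)
        refine le_trans ?_ this
        rw [mul_comm]
        gcongr
        exact (not_le.1 hD).le)
    exact ⟨A', hA'.trans (Finset.erase_subset _ _), h1, h2⟩

theorem ThreeGraph.exists_subset_boxCount {D : ℝ} {s : ℕ} (hs : s ≤ #A)
    (h : D * (#A * #B * #C) ≤ H.boxCount A B C) :
    ∃ A' ⊆ A, #A' = s ∧ D * (s * #B * #C) ≤ H.boxCount A' B C := by
  rw [H.boxCount_eq_sum, Nat.cast_sum] at h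
  obtain ⟨A', h1, h2, h3⟩ := exists_subset_card_eq_mul_le_sum (D := D * (#B * #C)) A hs
    (le_trans (le_of_eq (by ring)) h)
  refine ⟨A', h1, h2, ?_⟩
  rw [H.boxCount_eq_sum, Nat.cast_sum]
  exact le_trans (le_of_eq (by ring)) h3

theorem ThreeGraph.exists_subbox_boxCount {D : ℝ} {s : ℕ} (hA : s ≤ #A) (hB : s ≤ #B)
    (hC : s ≤ #C) (h : D * (#A * #B * #C) ≤ H.boxCount A B C) :
    ∃ A' ⊆ A, ∃ B' ⊆ B, ∃ C' ⊆ C, #A' = s ∧ #B' = s ∧ #C' = s ∧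
      D * (s * s * s) ≤ H.boxCount A' B' C' := by
  obtain ⟨A', hA', ha, h1⟩ := H.exists_subset_boxCount hA h
  rw [H.boxCount_rotate] at h1
  obtain ⟨B', hB', hb, h2⟩ := H.exists_subset_boxCount (D := D) (C := A') hB
    (le_trans (le_of_eq (by rw [ha]; ring)) h1)
  rw [H.boxCount_rotate] at h2
  obtain ⟨C', hC', hc, h3⟩ := H.exists_subset_boxCount (D := D) (C := B') hC
    (le_trans (le_of_eq (by rw [ha, hb]; ring)) h2)
  rw [H.boxCount_rotate] at h3
  exact ⟨A', hA', B', hB', C', hC', ha, hb, hc, le_trans (le_of_eq (by rw [ha, hb])) h3⟩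

theorem ThreeGraph.boxCount_le_add {A' B' C' : Finset W} :
    H.boxCount A B C ≤ H.boxCount A' B' C' + H.boxCount (A \ A') B C +
      H.boxCount A' (B \ B') C + H.boxCount A' B' (C \ C') := by
  simp only [ThreeGraph.boxCount]
  refine le_trans (Finset.card_le_card ?_) ((Finset.card_union_le _ _).trans (Nat.add_le_add_right
    ((Finset.card_union_le _ _).trans (Nat.add_le_add_right (Finset.card_union_le _ _) _)) _))
  intro p hp
  simp only [Finset.mem_filter, Finset.mem_product, Finset.mem_union, Finset.mem_sdiff] at hp ⊢
  tauto

/-- A dense box which is not lower dense contains a large denser box. -/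
theorem ThreeGraph.exists_denser_box (hγ : 0 < γ) (hγ1 : γ ≤ 1) (hδ : 0 < δ) (hδ1 : δ ≤ 1)
    {d : ℝ} (hd : δ ≤ d) {q : ℕ} (hq : 0 < q) (hA : #A = q) (hB : #B = q) (hC : #C = q)
    (h : d * (q * q * q) ≤ H.boxCount A B C) (hnot : ¬ H.LowerDense γ (δ / 2) A B C) :
    ∃ A' ⊆ A, ∃ B' ⊆ B, ∃ C' ⊆ C, δ * γ ^ 3 / 16 * q ≤ #A' ∧ δ * γ ^ 3 / 16 * q ≤ #B' ∧
      δ * γ ^ 3 / 16 * q ≤ #C' ∧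
      (d + δ * γ ^ 3 / 16) * (#A' * #B' * #C') ≤ H.boxCount A' B' C' := by
  unfold ThreeGraph.LowerDense at hnot
  push Not at hnot
  obtain ⟨A', hA', B', hB', C', hC', ha, hb, hc, hlow⟩ := hnot
  by_contra! hcon
  have hq' : (0 : ℝ) < q := by exact_mod_cast hq
  rw [hA] at ha
  rw [hB] at hb
  rw [hC] at hc
  have hξ : δ * γ ^ 3 / 16 ≤ γ := by
    have : γ ^ 2 ≤ 1 := pow_le_one₀ hγ.le hγ1
    have h2 : δ * γ ^ 3 ≤ 1 * γ ^ 1 :=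
      mul_le_mul hδ1 (pow_le_pow_of_le_one hγ.le hγ1 (by norm_num)) (by positivity) (by norm_num)
    rw [pow_one] at h2
    linarith
  have hξ0 : 0 < δ * γ ^ 3 / 16 := by positivity
  have hξdef : δ * γ ^ 3 = 16 * (δ * γ ^ 3 / 16) := by ring
  generalize δ * γ ^ 3 / 16 = ξ at *
  have hd0 : 0 < d + ξ := by linarith
  have key : ∀ S ⊆ A, ∀ T ⊆ B, ∀ U ⊆ C,
      (H.boxCount S T U : ℝ) ≤ (d + ξ) * (#S * #T * #U) + ξ * (q * q * q) := by
    intro S hS T hT U hU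
    have hs : (#S : ℝ) ≤ q := by exact_mod_cast hA ▸ Finset.card_le_card hS
    have ht : (#T : ℝ) ≤ q := by exact_mod_cast hB ▸ Finset.card_le_card hT
    have hu : (#U : ℝ) ≤ q := by exact_mod_cast hC ▸ Finset.card_le_card hU
    have hmain : (0 : ℝ) ≤ (d + ξ) * (#S * #T * #U) := by positivity
    by_cases h1 : ξ * q ≤ #S
    · by_cases h2 : ξ * q ≤ #T
      · by_cases h3 : ξ * q ≤ #U
        · have := (hcon S hS T hT U hU h1 h2 h3).le
          have : 0 ≤ ξ * ((q : ℝ) * q * q) := by positivity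
          linarith
        · have h4 : (#S * #T * #U : ℝ) ≤ q * q * (ξ * q) := by gcongr; exact (not_le.1 h3).le
          have := H.boxCount_le S T U
          linarith
      · have h4 : (#S * #T * #U : ℝ) ≤ q * (ξ * q) * q := by gcongr; exact (not_le.1 h2).le
        have := H.boxCount_le S T U
        linarith
    · have h4 : (#S * #T * #U : ℝ) ≤ (ξ * q) * q * q := by gcongr; exact (not_le.1 h1).le
      have := H.boxCount_le S T U
      linarith
  have k1 := key (A \ A') Finset.sdiff_subset B subset_rfl C subset_rfl
  have k2 := key A' hA' (B \ B') Finset.sdiff_subset C subset_rfl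
  have k3 := key A' hA' B' hB' (C \ C') Finset.sdiff_subset
  have hadd : (H.boxCount A B C : ℝ) ≤ H.boxCount A' B' C' + H.boxCount (A \ A') B C +
      H.boxCount A' (B \ B') C + H.boxCount A' B' (C \ C') := by
    exact_mod_cast H.boxCount_le_add
  have cA : (#(A \ A') : ℝ) = q - #A' := by
    rw [Finset.cast_card_sdiff hA', hA]
  have cB : (#(B \ B') : ℝ) = q - #B' := by
    rw [Finset.cast_card_sdiff hB', hB]
  have cC : (#(C \ C') : ℝ) = q - #C' := by
    rw [Finset.cast_card_sdiff hC', hC]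
  rw [cA, hB, hC] at k1
  rw [cB, hC] at k2
  rw [cC] at k3
  have hvol : γ ^ 3 * (q * q * q) ≤ #A' * #B' * #C' := by
    calc γ ^ 3 * ((q : ℝ) * q * q) = (γ * q) * (γ * q) * (γ * q) := by ring
      _ ≤ #A' * #B' * #C' := by gcongr
  have hX : (0 : ℝ) < (q : ℝ) * q * q := by positivity
  have e1 : δ / 2 * (γ ^ 3 * (q * q * q)) ≤ (d + ξ - δ / 2) * (#A' * #B' * #C' : ℝ) := by
    have : (0 : ℝ) ≤ #A' * #B' * #C' := by positivity
    calc _ ≤ δ / 2 * (#A' * #B' * #C' : ℝ) := by gcongr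
      _ ≤ _ := by gcongr; linarith
  have e2 : δ / 2 * (γ ^ 3 * (q * q * q)) = 8 * ξ * ((q : ℝ) * q * q) := by
    linear_combination ((q : ℝ) * q * q) / 2 * hξdef
  have e3 : 0 < ξ * ((q : ℝ) * q * q) := by positivity
  nlinarith

end Boxes

theorem ThreeGraph.exists_lowerDense_of_density {γ δ : ℝ} (hγ : 0 < γ) (hγ1 : γ ≤ 1) (hδ : 0 < δ)
    (hδ1 : δ ≤ 1) (k : ℕ) : ∃ ρ : ℝ, 0 < ρ ∧ ρ ≤ 1 ∧ ∀ {n : ℕ} (H : ThreeGraph (Fin n))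
      (A B C : Finset (Fin n))      (q : ℕ) (d : ℝ), 0 < q → #A = q → #B = q → #C = q → δ ≤ d →
      1 < d + k * (δ * γ ^ 3 / 16) → d * (q * q * q) ≤ H.boxCount A B C →
      ∃ u : ℕ, ρ * q ≤ u ∧ u ≤ q ∧ ∃ A' ⊆ A, ∃ B' ⊆ B, ∃ C' ⊆ C, #A' = u ∧ #B' = u ∧ #C' = u ∧
        H.LowerDense γ (δ / 2) A' B' C' := by
  have hξ : 0 < δ * γ ^ 3 / 16 := by positivity
  have hξ1 : δ * γ ^ 3 / 16 ≤ 1 := by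
    have : δ * γ ^ 3 ≤ 1 * 1 :=
      mul_le_mul hδ1 (pow_le_one₀ hγ.le hγ1) (by positivity) (by norm_num)
    linarith
  induction k with
  | zero =>
    refine ⟨1, one_pos, le_rfl, fun {n} H A B C q d hq hA hB hC _ hd h => ?_⟩
    have hle := H.boxCount_le A B C
    rw [hA, hB, hC] at hle
    have hq' : (0 : ℝ) < (q : ℝ) * q * q := by positivity
    simp only [Nat.cast_zero, zero_mul, add_zero] at hd
    nlinarith
  | succ k ih =>
    obtain ⟨ρ, hρ, hρ1, ih⟩ := ih
    refine ⟨ρ * (δ * γ ^ 3 / 16), by positivity, mul_le_one₀ hρ1 hξ.le hξ1,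
      fun {n} H A B C q d hq hA hB hC hδd hd h => ?_⟩
    by_cases hH : H.LowerDense γ (δ / 2) A B C
    · refine ⟨q, ?_, le_rfl, A, subset_rfl, B, subset_rfl, C, subset_rfl, hA, hB, hC, hH⟩
      exact mul_le_of_le_one_left (by positivity) (mul_le_one₀ hρ1 hξ.le hξ1)
    obtain ⟨A₁, hA₁, B₁, hB₁, C₁, hC₁, ha, hb, hc, hden⟩ :=
      H.exists_denser_box hγ hγ1 hδ hδ1 hδd hq hA hB hC h hH
    obtain ⟨A₂, hA₂, B₂, hB₂, C₂, hC₂, ha₂, hb₂, hc₂, hden₂⟩ :=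
      H.exists_subbox_boxCount (s := ⌈δ * γ ^ 3 / 16 * q⌉₊) (Nat.ceil_le.2 ha) (Nat.ceil_le.2 hb)
        (Nat.ceil_le.2 hc) hden
    have hceil := Nat.le_ceil (δ * γ ^ 3 / 16 * q)
    obtain ⟨u, hu, hu', A', hA', B', hB', C', hC', h1, h2, h3, h4⟩ := ih H A₂ B₂ C₂ _
      (d + δ * γ ^ 3 / 16) (Nat.ceil_pos.2 (by positivity)) ha₂ hb₂ hc₂ (by linarith)
      (by push_cast at hd; linarith) hden₂
    refine ⟨u, ?_, hu'.trans ?_, A', hA'.trans (hA₂.trans hA₁), B', hB'.trans (hB₂.trans hB₁), C',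
      hC'.trans (hC₂.trans hC₁), h1, h2, h3, h4⟩
    · refine le_trans ?_ hu
      rw [mul_assoc]
      gcongr
    · rw [← ha₂, ← hA]
      exact Finset.card_le_card (hA₂.trans hA₁)

theorem ThreeGraph.exists_sparse_or_dense {γ δ : ℝ} (hγ : 0 < γ) (hγ1 : γ ≤ 1) (hδ : 0 < δ)
    (hδ1 : δ ≤ 1) : ∃ ρ : ℝ, 0 < ρ ∧ ρ ≤ 1 ∧ ∀ {n : ℕ} (H : ThreeGraph (Fin n))
      (A B C : Finset (Fin n))      (q : ℕ), 0 < q → #A = q → #B = q → #C = q →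
      ∃ u : ℕ, ρ * q ≤ u ∧ u ≤ q ∧ ∃ A' ⊆ A, ∃ B' ⊆ B, ∃ C' ⊆ C, #A' = u ∧ #B' = u ∧ #C' = u ∧
        (H.UpperSparse γ δ A' B' C' ∨ H.LowerDense γ (δ / 2) A' B' C') := by
  have hξ : 0 < δ * γ ^ 3 / 16 := by positivity
  obtain ⟨k, hk⟩ := exists_nat_gt (1 / (δ * γ ^ 3 / 16))
  rw [div_lt_iff₀ hξ] at hk
  obtain ⟨ρ, hρ, hρ1, hmain⟩ :=
    ThreeGraph.exists_lowerDense_of_density hγ hγ1 hδ hδ1 k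
  refine ⟨ρ * γ, by positivity, mul_le_one₀ hρ1 hγ.le hγ1, fun {n} H A B C q hq hA hB hC => ?_⟩
  by_cases hH : H.UpperSparse γ δ A B C
  · refine ⟨q, ?_, le_rfl, A, subset_rfl, B, subset_rfl, C, subset_rfl, hA, hB, hC, Or.inl hH⟩
    exact mul_le_of_le_one_left (by positivity) (mul_le_one₀ hρ1 hγ.le hγ1)
  unfold ThreeGraph.UpperSparse at hH
  push Not at hH
  obtain ⟨A₁, hA₁, B₁, hB₁, C₁, hC₁, ha, hb, hc, hden⟩ := hH
  rw [hA] at ha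
  rw [hB] at hb
  rw [hC] at hc
  obtain ⟨A₂, hA₂, B₂, hB₂, C₂, hC₂, ha₂, hb₂, hc₂, hden₂⟩ :=
    H.exists_subbox_boxCount (s := ⌈γ * q⌉₊) (Nat.ceil_le.2 ha) (Nat.ceil_le.2 hb)
      (Nat.ceil_le.2 hc) hden.le
  have hceil := Nat.le_ceil (γ * q)
  obtain ⟨u, hu, hu', A', hA', B', hB', C', hC', h1, h2, h3, h4⟩ := hmain H A₂ B₂ C₂ _
    δ (Nat.ceil_pos.2 (by positivity)) ha₂ hb₂ hc₂ le_rfl (by linarith) hden₂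
  refine ⟨u, ?_, hu'.trans ?_, A', hA'.trans (hA₂.trans hA₁), B', hB'.trans (hB₂.trans hB₁), C',
    hC'.trans (hC₂.trans hC₁), h1, h2, h3, Or.inr h4⟩
  · refine le_trans ?_ hu
    rw [mul_assoc]
    gcongr
  · rw [← ha₂, ← hA]
    exact Finset.card_le_card (hA₂.trans hA₁)

theorem ThreeGraph.exists_sparse_or_dense_list {ι : Type*} [DecidableEq ι] {δ : ℝ} (hδ : 0 < δ)
    (hδ1 : δ ≤ 1) (T : List (ι × ι × ι)) (hT : ∀ t ∈ T, t.1 ≠ t.2.1 ∧ t.1 ≠ t.2.2 ∧ t.2.1 ≠ t.2.2) :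
    ∀ {γ : ℝ}, 0 < γ → γ ≤ 1 → ∃ ρ : ℝ, 0 < ρ ∧ ρ ≤ 1 ∧ ∀ {n : ℕ} (H : ThreeGraph (Fin n))
      (X : ι → Finset (Fin n)) (q : ℕ), 0 < q → (∀ i, #(X i) = q) →
      ∃ u : ℕ, ρ * q ≤ u ∧ u ≤ q ∧ ∃ Z : ι → Finset (Fin n), (∀ i, Z i ⊆ X i) ∧ (∀ i, #(Z i) = u) ∧
        ∀ t ∈ T, H.UpperSparse γ δ (Z t.1) (Z t.2.1) (Z t.2.2) ∨
          H.LowerDense γ (δ / 2) (Z t.1) (Z t.2.1) (Z t.2.2) := by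
  induction T with
  | nil =>
    intro γ _ _
    exact ⟨1, one_pos, le_rfl, fun {n} H X q _ hX => ⟨q, by simp, le_rfl, X, fun _ => subset_rfl, hX,
      by simp⟩⟩
  | cons t T ih =>
    intro γ hγ hγ1
    obtain ⟨ρ, hρ, hρ1, hstep⟩ := ThreeGraph.exists_sparse_or_dense hγ hγ1 hδ hδ1
    obtain ⟨ρ', hρ', hρ1', hrec⟩ := ih (fun t ht => hT t (List.mem_cons_of_mem _ ht))
      (γ := γ * ρ) (by positivity) (mul_le_one₀ hγ1 hρ.le hρ1)
    refine ⟨ρ * ρ', by positivity, mul_le_one₀ hρ1 hρ'.le hρ1', fun {n} H X q hq hX => ?_⟩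
    obtain ⟨u, hu, huq, Z, hZX, hZ, hgood⟩ := hrec H X q hq hX
    have hq' : (0 : ℝ) < q := by exact_mod_cast hq
    have hu0 : 0 < u := by
      have : (0 : ℝ) < u := lt_of_lt_of_le (by positivity) hu
      exact_mod_cast this
    obtain ⟨i, j, k⟩ := t
    obtain ⟨hij, hik, hjk⟩ := hT (i, j, k) List.mem_cons_self
    obtain ⟨v, hv, hvu, A, hA, B, hB, C, hC, ha, hb, hc, hABC⟩ :=
      hstep H (Z i) (Z j) (Z k) u hu0 (hZ i) (hZ j) (hZ k)
    choose S hSZ hS using fun l => Finset.exists_subset_card_eq (s := Z l) (n := v)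
      (by rw [hZ]; exact hvu)
    let Z' : ι → Finset (Fin n) := Function.update (Function.update (Function.update S i A) j B) k C
    have hi : Z' i = A := by simp [Z', hij, hik]
    have hj : Z' j = B := by simp [Z', hjk]
    have hk : Z' k = C := by simp [Z']
    have hother : ∀ l, l ≠ i → l ≠ j → l ≠ k → Z' l = S l := by
      intro l h1 h2 h3
      simp [Z', h1, h2, h3]
    have hsub : ∀ l, Z' l ⊆ Z l := by
      intro l
      by_cases h1 : l = i
      · rw [h1, hi]; exact hA
      by_cases h2 : l = j
      · rw [h2, hj]; exact hB
      by_cases h3 : l = k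
      · rw [h3, hk]; exact hC
      rw [hother l h1 h2 h3]; exact hSZ l
    have hcard : ∀ l, #(Z' l) = v := by
      intro l
      by_cases h1 : l = i
      · rw [h1, hi]; exact ha
      by_cases h2 : l = j
      · rw [h2, hj]; exact hb
      by_cases h3 : l = k
      · rw [h3, hk]; exact hc
      rw [hother l h1 h2 h3]; exact hS l
    have hratio : ∀ l, ρ * #(Z l) ≤ #(Z' l) := by
      intro l
      rw [hZ, hcard]; exact hv
    refine ⟨v, ?_, hvu.trans huq, Z', fun l => (hsub l).trans (hZX l), hcard, ?_⟩
    · refine le_trans ?_ hv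
      rw [mul_assoc]
      gcongr
    · intro s hs
      rcases List.mem_cons.1 hs with rfl | hs
      · simp only [hi, hj, hk]
        exact hABC
      · exact (hgood s hs).imp
          (fun h => h.mono hγ.le le_rfl (hsub _) (hsub _) (hsub _) (hratio _) (hratio _) (hratio _))
          (fun h => h.mono hγ.le le_rfl (hsub _) (hsub _) (hsub _) (hratio _) (hratio _) (hratio _))

theorem forall_distinct_of_forall_lt {ι : Type*} [LinearOrder ι] {P : ι → ι → ι → Prop}
    (hrot : ∀ i j k, P i j k → P j k i) (hswap : ∀ i j k, P i j k → P j i k)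
    (h : ∀ i j k, i < j → j < k → P i j k) {i j k : ι} (hij : i ≠ j) (hik : i ≠ k) (hjk : j ≠ k) :
    P i j k := by
  rcases lt_or_gt_of_ne hij with h1 | h1 <;> rcases lt_or_gt_of_ne hik with h2 | h2 <;>
    rcases lt_or_gt_of_ne hjk with h3 | h3
  · exact h _ _ _ h1 h3
  · exact hswap _ _ _ (hrot _ _ _ (hrot _ _ _ (h _ _ _ h2 h3)))
  · exact absurd (h1.trans h3) h2.asymm
  · exact hrot _ _ _ (h _ _ _ h2 h1)
  · exact hswap _ _ _ (h _ _ _ h1 h2)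
  · exact absurd (h3.trans h1) h2.asymm
  · exact hrot _ _ _ (hrot _ _ _ (h _ _ _ h3 h2))
  · exact hswap _ _ _ (hrot _ _ _ (h _ _ _ h3 h1))

theorem exists_disjoint_parts {n M q : ℕ} (h : M * q ≤ n) :
    ∃ X : Fin M → Finset (Fin n), (∀ i, #(X i) = q) ∧ ∀ i j, i ≠ j → Disjoint (X i) (X j) := by
  obtain ⟨φ⟩ := Function.Embedding.nonempty_of_card_le (α := Fin M × Fin q) (β := Fin n)
    (by simpa using h)
  refine ⟨fun i => Finset.univ.image fun y => φ (i, y), fun i => ?_, fun i j hij => ?_⟩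
  · rw [Finset.card_image_of_injective _ fun y y' hy => (Prod.ext_iff.1 (φ.injective hy)).2]
    simp
  · rw [Finset.disjoint_left]
    intro x hx hx'
    simp only [Finset.mem_image, Finset.mem_univ, true_and] at hx hx'
    obtain ⟨y, rfl⟩ := hx
    obtain ⟨y', hy'⟩ := hx'
    exact hij (Prod.ext_iff.1 (φ.injective hy')).1.symm

theorem ThreeGraph.card_edges_subset_biUnion_le {n m : ℕ} (H : ThreeGraph (Fin n))
    (Y : Fin m → Finset (Fin n)) :
    #(H.edges.filter fun e => e ⊆ Finset.univ.biUnion Y) ≤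
      ∑ i, ∑ j, ∑ k, H.boxCount (Y i) (Y j) (Y k) := by
  let B : Fin m × Fin m × Fin m → Finset (Fin n × Fin n × Fin n) := fun t =>
    {p ∈ Y t.1 ×ˢ Y t.2.1 ×ˢ Y t.2.2 | {p.1, p.2.1, p.2.2} ∈ H.edges}
  have hsum : ∑ i, ∑ j, ∑ k, H.boxCount (Y i) (Y j) (Y k) = ∑ t, #(B t) := by
    simp only [Fintype.sum_prod_type]
    rfl
  rw [hsum]
  refine le_trans (Finset.card_le_card fun e he => ?_) ((Finset.card_image_le
    (f := fun p : Fin n × Fin n × Fin n => ({p.1, p.2.1, p.2.2} : Finset _))).trans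
      (Finset.card_biUnion_le (s := Finset.univ) (t := B)))
  rw [Finset.mem_filter] at he
  obtain ⟨x, y, z, -, -, -, rfl⟩ := Finset.card_eq_three.1 (H.card_eq e he.1)
  have hmem : ∀ a ∈ ({x, y, z} : Finset (Fin n)), ∃ i, a ∈ Y i := fun a ha => by
    simpa using he.2 ha
  obtain ⟨i, hi⟩ := hmem x (by simp)
  obtain ⟨j, hj⟩ := hmem y (by simp)
  obtain ⟨k, hk⟩ := hmem z (by simp)
  refine Finset.mem_image.2 ⟨(x, y, z), Finset.mem_biUnion.2 ⟨(i, j, k), Finset.mem_univ _, ?_⟩, rfl⟩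
  simp [B, hi, hj, hk, he.1]

theorem cube_le_choose_three {N : ℕ} (hN : 4 ≤ N) : (N : ℝ) ^ 3 / 48 ≤ N.choose 3 := by
  have h := Nat.pow_le_choose (α := ℝ) 3 N
  have h1 : (N : ℝ) / 2 ≤ ((N + 1 - 3 : ℕ) : ℝ) := by
    rw [div_le_iff₀ two_pos]
    exact_mod_cast (by omega : N ≤ (N + 1 - 3) * 2)
  have h2 : ((N : ℝ) / 2) ^ 3 ≤ ((N + 1 - 3 : ℕ) : ℝ) ^ 3 := by gcongr
  have h3 : ((Nat.factorial 3 : ℕ) : ℝ) = 6 := by norm_num [Nat.factorial]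
  rw [h3] at h
  have h4 : ((N : ℝ) / 2) ^ 3 = (N : ℝ) ^ 3 / 8 := by ring
  linarith

theorem ThreeGraph.not_sparse_of_uniformlyDense {n m u : ℕ} {H : ThreeGraph (Fin n)} {d η : ℝ}
    (hd : 0 < d) (hd1 : d ≤ 1) (hH : UniformlyDense H d η) (hm : 1200 / d ≤ m) (hu : 0 < u)
    (hη : η * (n : ℝ) ^ 3 ≤ d / 400 * (u : ℝ) ^ 3) (Y : Fin m → Finset (Fin n))
    (hY : ∀ i, #(Y i) = u) (hdisj : ∀ i j, i ≠ j → Disjoint (Y i) (Y j))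
    (hsparse : ∀ i j k, i ≠ j → i ≠ k → j ≠ k →
      (H.boxCount (Y i) (Y j) (Y k) : ℝ) ≤ d / 200 * (u : ℝ) ^ 3) : False := by
  have hU : #(Finset.univ.biUnion Y) = m * u := by
    rw [Finset.card_biUnion fun i _ j _ h => hdisj i j h]
    simp [hY]
  have h1 := hH (Finset.univ.biUnion Y)
  rw [hU] at h1
  have hdm : 1200 ≤ m * d := (div_le_iff₀ hd).1 hm
  have hm1 : (1200 : ℝ) ≤ m := by nlinarith [Nat.cast_nonneg (α := ℝ) m]
  have hm2 : 1200 ≤ m := by exact_mod_cast hm1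
  have hu1 : (1 : ℝ) ≤ u := by exact_mod_cast hu
  have h2 := cube_le_choose_three (N := m * u) (by nlinarith)
  have h3 : (#(H.edges.filter fun e => e ⊆ Finset.univ.biUnion Y) : ℝ) ≤
      ∑ i, ∑ j, ∑ k, (H.boxCount (Y i) (Y j) (Y k) : ℝ) := by
    exact_mod_cast H.card_edges_subset_biUnion_le Y
  have h4 : ∀ i j k, (H.boxCount (Y i) (Y j) (Y k) : ℝ) ≤ d / 200 * (u : ℝ) ^ 3 +
      (if i = j then (u : ℝ) ^ 3 else 0) + (if i = k then (u : ℝ) ^ 3 else 0) +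
      (if j = k then (u : ℝ) ^ 3 else 0) := by
    intro i j k
    have hle := H.boxCount_le (Y i) (Y j) (Y k)
    rw [hY, hY, hY] at hle
    have hle' : (H.boxCount (Y i) (Y j) (Y k) : ℝ) ≤ (u : ℝ) ^ 3 := hle.trans (le_of_eq (by ring))
    have hp : 0 < d / 200 * (u : ℝ) ^ 3 := by positivity
    have hp' : 0 < (u : ℝ) ^ 3 := by positivity
    by_cases hij : i = j
    · rw [if_pos hij]; split_ifs <;> linarith
    by_cases hik : i = k
    · rw [if_pos hik]; split_ifs <;> linarith
    by_cases hjk : j = k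
    · rw [if_pos hjk, if_neg hij, if_neg hik]; linarith
    have := hsparse i j k hij hik hjk
    simp [hij, hik, hjk, this]
  have h5 : ∑ i, ∑ j, ∑ k, (H.boxCount (Y i) (Y j) (Y k) : ℝ) ≤
      (m : ℝ) ^ 3 * (d / 200 * (u : ℝ) ^ 3) + 3 * (m : ℝ) ^ 2 * (u : ℝ) ^ 3 := by
    refine (Finset.sum_le_sum fun i _ => Finset.sum_le_sum fun j _ => Finset.sum_le_sum
      fun k _ => h4 i j k).trans (le_of_eq ?_)
    simp only [Finset.sum_add_distrib, Finset.sum_const, Finset.card_univ, Fintype.card_fin,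
      nsmul_eq_mul, Finset.sum_ite_eq, Finset.mem_univ, if_true, ← Finset.mul_sum]
    ring
  have h6 : d * (((m * u : ℕ) : ℝ) ^ 3 / 48) ≤ d * ((m * u).choose 3 : ℝ) := by gcongr
  push_cast at h6
  have hw : (0 : ℝ) < (u : ℝ) ^ 3 := by positivity
  have h7 : 3 * (m : ℝ) ^ 2 * (u : ℝ) ^ 3 ≤ d / 400 * ((m : ℝ) ^ 3 * (u : ℝ) ^ 3) := by
    have : 1200 * ((m : ℝ) ^ 2 * (u : ℝ) ^ 3) ≤ m * d * ((m : ℝ) ^ 2 * (u : ℝ) ^ 3) := by gcongr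
    linarith
  have h8 : d / 400 * (u : ℝ) ^ 3 ≤ d / 400 * ((m : ℝ) ^ 3 * (u : ℝ) ^ 3) := by
    gcongr
    exact le_mul_of_one_le_left hw.le (one_le_pow₀ (by linarith))
  have h9 : (0 : ℝ) < d * ((m : ℝ) ^ 3 * (u : ℝ) ^ 3) := by
    have : (0 : ℝ) < m := by linarith
    positivity
  rw [mul_pow] at h6
  linarith

theorem exists_strictMono_homogeneous (m : ℕ) : ∃ M, ∀ c : Fin M → Fin M → Fin M → Prop,
    ∃ g : Fin m → Fin M, StrictMono g ∧
      ((∀ i j k, i < j → j < k → c (g i) (g j) (g k)) ∨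
        (∀ i j k, i < j → j < k → ¬ c (g i) (g j) (g k))) := by
  obtain ⟨M, hM⟩ := exists_sublist_homogeneous (ι := ℕ) 3 m
  refine ⟨M, fun c => ?_⟩
  obtain ⟨S, hS, hlen, hc⟩ := hM (fun l => ∀ i j k : Fin M, l = [i.1, j.1, k.1] → c i j k)
    (List.range M) (by simp)
  have hsorted : S.SortedLT := (List.pairwise_lt_range.sublist hS).sortedLT
  have hlt : ∀ i : Fin m, S.get (i.cast hlen.symm) < M := fun i =>
    List.mem_range.1 (hS.subset (List.get_mem _ _))
  have hmono : StrictMono fun i : Fin m => (⟨S.get (i.cast hlen.symm), hlt i⟩ : Fin M) :=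
    fun i j hij => hsorted.strictMono_get (by simpa using hij)
  refine ⟨_, hmono, ?_⟩
  have hsub : ∀ i j k : Fin m, i < j → j < k → List.Sublist [S.get (i.cast hlen.symm),
      S.get (j.cast hlen.symm), S.get (k.cast hlen.symm)] S := by
    intro i j k hij hjk
    have h1 : S.get (i.cast hlen.symm) < S.get (j.cast hlen.symm) := hmono hij
    have h2 : S.get (j.cast hlen.symm) < S.get (k.cast hlen.symm) := hmono hjk
    have hp : List.Pairwise (· < ·) [S.get (i.cast hlen.symm), S.get (j.cast hlen.symm),
        S.get (k.cast hlen.symm)] := by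
      simp only [List.pairwise_cons, List.mem_cons, List.not_mem_nil, or_false, forall_eq_or_imp,
        forall_eq]
      exact ⟨⟨h1, h1.trans h2⟩, h2, by simp, List.Pairwise.nil⟩
    refine List.sublist_of_subperm_of_sortedLE (List.subperm_of_subset
      (hp.imp fun h => h.ne) ?_) hp.sortedLT.sortedLE hsorted.sortedLE
    intro a ha
    simp only [List.mem_cons, List.not_mem_nil, or_false] at ha
    rcases ha with rfl | rfl | rfl <;> exact List.get_mem _ _
  rcases hc with hc | hc
  · exact Or.inl fun i j k hij hjk => hc _ (hsub i j k hij hjk) rfl _ _ _ rfl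
  · refine Or.inr fun i j k hij hjk hcon => hc _ (hsub i j k hij hjk) rfl fun a b e h => ?_
    simp only [List.cons.injEq, and_true] at h
    obtain ⟨ha, hb, he⟩ := h
    rw [← Fin.ext (a := ⟨_, hlt i⟩) (b := a) ha, ← Fin.ext (a := ⟨_, hlt j⟩) (b := b) hb,
      ← Fin.ext (a := ⟨_, hlt k⟩) (b := e) he]
    exact hcon

theorem exists_lowerDense_cells {d γ : ℝ} (hd : 0 < d) (hd1 : d ≤ 1) (hγ : 0 < γ) (hγ1 : γ ≤ 1)
    (K : ℕ) : ∃ η : ℝ, 0 < η ∧ ∃ n₀, ∀ n, n₀ ≤ n → ∀ H : ThreeGraph (Fin n),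
      UniformlyDense H d η → ∃ u, 0 < u ∧ ∃ X : Fin K → Finset (Fin n), (∀ i, #(X i) = u) ∧
        (∀ i j, i ≠ j → Disjoint (X i) (X j)) ∧ ∀ i j k, i ≠ j → i ≠ k → j ≠ k →
          H.LowerDense γ (d / 400) (X i) (X j) (X k) := by
  obtain ⟨m, hKm, hdm⟩ : ∃ m : ℕ, K ≤ m ∧ 1200 / d ≤ m := by
    obtain ⟨m₀, hm₀⟩ := exists_nat_ge (1200 / d)
    exact ⟨max K m₀, le_max_left _ _, hm₀.trans (by exact_mod_cast le_max_right _ _)⟩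
  obtain ⟨M, hM⟩ := exists_strictMono_homogeneous m
  have hM0 : 0 < M := by
    have hm : 0 < m := by
      have : (0 : ℝ) < m := lt_of_lt_of_le (by positivity) hdm
      exact_mod_cast this
    obtain ⟨g, -⟩ := hM fun _ _ _ => True
    exact (g ⟨0, hm⟩).pos
  obtain ⟨ρ, hρ, hρ1, hreg⟩ := ThreeGraph.exists_sparse_or_dense_list (δ := d / 200) (by positivity)
    (by linarith) (Finset.univ.filter fun t : Fin M × Fin M × Fin M =>
      t.1 < t.2.1 ∧ t.2.1 < t.2.2).toList (fun t ht => by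
        rw [Finset.mem_toList, Finset.mem_filter] at ht
        exact ⟨ht.2.1.ne, (ht.2.1.trans ht.2.2).ne, ht.2.2.ne⟩) hγ hγ1
  refine ⟨d / 400 * (ρ / (2 * M)) ^ 3, by positivity, M, fun n hn H hH => ?_⟩
  have hq : 0 < n / M := Nat.div_pos hn hM0
  obtain ⟨V, hV, hVdisj⟩ := exists_disjoint_parts (n := n) (M := M) (q := n / M)
    (Nat.mul_div_le n M)
  obtain ⟨u, hu, -, Z, hZV, hZ, hgood⟩ := hreg H V (n / M) hq hV
  have hq' : (0 : ℝ) < (n / M : ℕ) := by exact_mod_cast hq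
  have hu0 : 0 < u := by
    have : (0 : ℝ) < u := lt_of_lt_of_le (by positivity) hu
    exact_mod_cast this
  have hdisj : ∀ i j, i ≠ j → Disjoint (Z i) (Z j) := fun i j hij =>
    (hVdisj i j hij).mono (hZV i) (hZV j)
  obtain ⟨g, hg, hhom⟩ := hM fun i j k => H.LowerDense γ (d / 200 / 2) (Z i) (Z j) (Z k)
  have hhigh : ∀ i j k, i < j → j < k →
      H.LowerDense γ (d / 200 / 2) (Z (g i)) (Z (g j)) (Z (g k)) := by
    refine hhom.resolve_right fun hlow => ?_
    refine ThreeGraph.not_sparse_of_uniformlyDense hd hd1 hH hdm hu0 ?_ (fun i => Z (g i))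
      (fun i => hZ _) (fun i j hij => hdisj _ _ (hg.injective.ne hij)) ?_
    · have h1 : ρ / (2 * M) * n ≤ u := by
        refine le_trans ?_ hu
        have h2 : (n : ℝ) ≤ 2 * M * (n / M : ℕ) := by
          have h3 := Nat.div_add_mod n M
          have h4 := Nat.mod_lt n hM0
          have h5 : M ≤ M * (n / M) := Nat.le_mul_of_pos_right M hq
          exact_mod_cast (by linarith : n ≤ 2 * M * (n / M))
        have hM' : (0 : ℝ) < 2 * M := by positivity
        rw [div_mul_eq_mul_div, div_le_iff₀ hM']
        calc ρ * n ≤ ρ * (2 * M * (n / M : ℕ)) := by gcongr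
          _ = _ := by ring
      calc d / 400 * (ρ / (2 * M)) ^ 3 * (n : ℝ) ^ 3 = d / 400 * (ρ / (2 * M) * n) ^ 3 := by ring
        _ ≤ d / 400 * (u : ℝ) ^ 3 := by gcongr
    · intro i j k hij hik hjk
      refine forall_distinct_of_forall_lt (P := fun i j k =>
        (H.boxCount (Z (g i)) (Z (g j)) (Z (g k)) : ℝ) ≤ d / 200 * (u : ℝ) ^ 3)
        (fun i j k h => by rwa [← H.boxCount_rotate])
        (fun i j k h => by rwa [← H.boxCount_swap]) (fun i j k hij hjk => ?_) hij hik hjk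
      have h1 := (hgood (g i, g j, g k) (Finset.mem_toList.2 (Finset.mem_filter.2
        ⟨Finset.mem_univ _, hg hij, hg hjk⟩))).resolve_right (hlow i j k hij hjk)
      have h2 := h1 _ subset_rfl _ subset_rfl _ subset_rfl
        (mul_le_of_le_one_left (by positivity) hγ1) (mul_le_of_le_one_left (by positivity) hγ1)
        (mul_le_of_le_one_left (by positivity) hγ1)
      simp only [hZ] at h2
      exact h2.trans (le_of_eq (by ring))
  refine ⟨u, hu0, fun i => Z (g (i.castLE hKm)), fun i => hZ _, fun i j hij =>
    hdisj _ _ (hg.injective.ne ((Fin.castLE_injective hKm).ne hij)), fun i j k hij hik hjk => ?_⟩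
  have := forall_distinct_of_forall_lt (P := fun i j k =>
    H.LowerDense γ (d / 200 / 2) (Z (g i)) (Z (g j)) (Z (g k))) (fun i j k h => h.rotate)
    (fun i j k h => h.swap) hhigh ((Fin.castLE_injective hKm).ne hij)
    ((Fin.castLE_injective hKm).ne hik) ((Fin.castLE_injective hKm).ne hjk)
  rwa [div_div, show (200 * 2 : ℝ) = 400 by norm_num] at this

/-- If `T` has density at least `δ` on large boxes, then few `y` fail to form with many `y'` a pair
with many extensions. -/
theorem card_poor_le {Y Z : Type} [Fintype Y] [Fintype Z] [Nonempty Z] {T : Y → Y → Z → Prop}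
    {δ ε : ℝ} (hδ : 0 ≤ δ) (hε : 0 < ε) (h : ∀ A B : Finset Y, ε * Fintype.card Y ≤ #A →
      ε * Fintype.card Y ≤ #B → δ * (#A * #B * Fintype.card Z) ≤
        ∑ a ∈ A, ∑ b ∈ B, (Nat.card {z // T a b z} : ℝ))
    (B : Finset Y) (hB : ε * Fintype.card Y ≤ #B) :
    (Nat.card {y // (Nat.card {y' // y' ∈ B ∧ Large (δ / 2) (T y y')} : ℝ) < δ / 2 * #B} : ℝ) ≤
      ε * Fintype.card Y := by
  classical
  by_contra! hcon
  rw [Nat.card_eq_fintype_card, Fintype.card_subtype] at hcon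
  generalize hA : ({y | (Nat.card {y' // y' ∈ B ∧ Large (δ / 2) (T y y')} : ℝ) < δ / 2 * #B} :
    Finset Y) = A at hcon
  have hZ : (0 : ℝ) < Fintype.card Z := by exact_mod_cast Fintype.card_pos
  have hA0 : (0 : ℝ) < #A := lt_of_le_of_lt (by positivity) hcon
  have hsum : ∀ a ∈ A, ∑ b ∈ B, (Nat.card {z // T a b z} : ℝ) < δ * (#B * Fintype.card Z) := by
    intro a ha
    rw [← hA, Finset.mem_filter] at ha
    have h1 : (#{b ∈ B | Large (δ / 2) (T a b)} : ℝ) < δ / 2 * #B := by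
      have h2 := ha.2
      rwa [Nat.card_eq_fintype_card, Fintype.card_subtype, ← Finset.filter_filter,
        Finset.filter_univ_mem] at h2
    have h2 : ∀ b ∈ B, (Nat.card {z // T a b z} : ℝ) ≤
        (if Large (δ / 2) (T a b) then (Fintype.card Z : ℝ) else 0) + δ / 2 * Fintype.card Z := by
      intro b _
      split_ifs with hb
      · have h3 : Nat.card {z // T a b z} ≤ Fintype.card Z := by
          rw [Nat.card_eq_fintype_card]
          exact Fintype.card_subtype_le _
        have h4 : (Nat.card {z // T a b z} : ℝ) ≤ Fintype.card Z := by exact_mod_cast h3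
        have : 0 ≤ δ / 2 * Fintype.card Z := by positivity
        linarith
      · rw [zero_add]
        exact (not_le.1 hb).le
    refine (Finset.sum_le_sum h2).trans_lt ?_
    rw [Finset.sum_add_distrib, ← Finset.sum_filter, Finset.sum_const, Finset.sum_const,
      nsmul_eq_mul, nsmul_eq_mul]
    have := mul_lt_mul_of_pos_right h1 hZ
    linarith
  have hne : A.Nonempty := Finset.card_pos.1 (by exact_mod_cast hA0)
  have h3 := Finset.sum_lt_sum_of_nonempty hne hsum
  have h4 := h A B hcon.le hB
  rw [Finset.sum_const, nsmul_eq_mul] at h3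
  linarith

theorem ThreeGraph.boxCount_image {n u : ℕ} (H : ThreeGraph (Fin n)) {φ ψ χ : Fin u → Fin n}
    (hφ : Function.Injective φ) (hψ : Function.Injective ψ) (hχ : Function.Injective χ)
    (A B C : Finset (Fin u)) : H.boxCount (A.image φ) (B.image ψ) (C.image χ) =
      ∑ a ∈ A, ∑ b ∈ B, #{c ∈ C | {φ a, ψ b, χ c} ∈ H.edges} := by
  simp only [ThreeGraph.boxCount, Finset.card_filter, Finset.sum_product]
  rw [Finset.sum_image fun _ _ _ _ h => hφ h]
  refine Finset.sum_congr rfl fun a _ => ?_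
  rw [Finset.sum_image fun _ _ _ _ h => hψ h]
  refine Finset.sum_congr rfl fun b _ => ?_
  rw [Finset.sum_image fun _ _ _ _ h => hχ h]

/-- Uniform density yields disjoint cells, parametrized by a common type, between which the
3-graph is dense. -/
theorem exists_dense_cell_maps {ι : Type} [Fintype ι] {d γ : ℝ} (hd : 0 < d) (hd1 : d ≤ 1)
    (hγ : 0 < γ) (hγ1 : γ ≤ 1) : ∃ η : ℝ, 0 < η ∧ ∃ n₀, ∀ n, n₀ ≤ n →
      ∀ H : ThreeGraph (Fin n), UniformlyDense H d η → ∃ u, 0 < u ∧ ∃ φ : ι → Fin u → Fin n,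
        (∀ i j y y', φ i y = φ j y' → i = j) ∧ ∀ i j k, i ≠ j → i ≠ k → j ≠ k →
          ∀ A B : Finset (Fin u), γ * u ≤ #A → γ * u ≤ #B →
            d / 400 * (#A * #B * u) ≤
              ∑ a ∈ A, ∑ b ∈ B, (#{c | {φ i a, φ j b, φ k c} ∈ H.edges} : ℝ) := by
  obtain ⟨η, hη, n₀, h⟩ := exists_lowerDense_cells hd hd1 hγ hγ1 (Fintype.card ι)
  refine ⟨η, hη, n₀, fun n hn H hH => ?_⟩
  obtain ⟨u, hu, X, hX, hdisj, hden⟩ := h n hn H hH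
  let e := Fintype.equivFin ι
  let φ : ι → Fin u → Fin n := fun i => (X (e i)).orderEmbOfFin (hX (e i))
  have hinj : ∀ i, Function.Injective (φ i) := fun i => (Finset.orderEmbOfFin _ _).injective
  have hmem : ∀ i y, φ i y ∈ X (e i) := fun i y => Finset.orderEmbOfFin_mem _ _ _
  have hsub : ∀ i (A : Finset (Fin u)), A.image (φ i) ⊆ X (e i) := fun i A x hx => by
    obtain ⟨y, -, rfl⟩ := Finset.mem_image.1 hx
    exact hmem i y
  have hcard : ∀ i (A : Finset (Fin u)), #(A.image (φ i)) = #A := fun i A =>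
    Finset.card_image_of_injective _ (hinj i)
  refine ⟨u, hu, φ, fun i j y y' hy => ?_, fun i j k hij hik hjk A B hA hB => ?_⟩
  · by_contra hij
    exact Finset.disjoint_left.1 (hdisj _ _ (e.injective.ne hij)) (hmem i y) (hy ▸ hmem j y')
  · have h1 := hden _ _ _ (e.injective.ne hij) (e.injective.ne hik) (e.injective.ne hjk)
      _ (hsub i A) _ (hsub j B) _ (hsub k Finset.univ)
      (by rw [hX, hcard]; exact hA) (by rw [hX, hcard]; exact hB)
      (by rw [hX, hcard, Finset.card_univ, Fintype.card_fin]
          exact mul_le_of_le_one_left (by positivity) hγ1)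
    rw [hcard, hcard, hcard, Finset.card_univ, Fintype.card_fin,
      H.boxCount_image (hinj i) (hinj j) (hinj k)] at h1
    exact_mod_cast h1

theorem piUnif_eq_zero_of_linkOrdered {V : Type} [Fintype V] [DecidableEq V] {F : ThreeGraph V}
    (hF : IsLayered F) (hL : LinkOrdered F) : piUnif F = 0 := by
  classical
  refine sSup_eq_zero_of_forall_pos_notMem (fun x hx => hx.1) ?_
  rintro d hd ⟨-, hd1, h⟩
  obtain ⟨par, f, r, E, hpar, hE, huniq, hedge⟩ := hF.exists_linkSystem hL
  obtain ⟨L, hfL⟩ := exists_layer_bound f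
  obtain ⟨N₀, hN₀⟩ := embeds hpar L hE hfL (d / 400 / 2) (by positivity) (by linarith)
  obtain ⟨ε, hε, p, hp, hemb⟩ := hN₀ (N₀ + 1) (Nat.le_succ _)
  have hγ : 0 < min ε 1 := lt_min hε one_pos
  obtain ⟨η, hη, n₀, hcells⟩ := exists_dense_cell_maps (ι := Fin L × Fin (N₀ + 1)) hd hd1 hγ
    (min_le_right ε 1)
  obtain ⟨n, hn, H, hH, hdense⟩ := h η hη n₀
  obtain ⟨u, hu, φ, hφ, hden⟩ := hcells n hn H hdense
  apply hH
  have : Nonempty (Fin u) := ⟨⟨0, hu⟩⟩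
  let R : ℕ × Fin (N₀ + 1) × Fin u → ℕ × Fin (N₀ + 1) × Fin u →
      ℕ × Fin (N₀ + 1) × Fin u → Prop := fun a b c =>
    ∀ (ha : a.1 < L) (hb : b.1 < L) (hc : c.1 < L),
      ({φ (⟨a.1, ha⟩, a.2.1) a.2.2, φ (⟨b.1, hb⟩, b.2.1) b.2.2,
        φ (⟨c.1, hc⟩, c.2.1) c.2.2} : Finset (Fin n)) ∈ H.edges
  have hRswap : ∀ {a b c}, R a b c → R b a c := fun hR hb ha hc => by
    rw [Finset.insert_comm]
    exact hR ha hb hc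
  let Γ : ℕ × Fin (N₀ + 1) × Fin u → ℕ × Fin (N₀ + 1) × Fin u → Prop := fun a b =>
    ∀ g, par g = some (a.1, b.1) ∨ par g = some (b.1, a.1) →
      Large (d / 400 / 2) fun z => R a b (g, z)
  have hhost : IsHost par (d / 400 / 2) (min ε 1) R Γ := by
    refine ⟨fun hab g hg => (hab g hg.symm).mono le_rfl fun z hz => hRswap hz,
      fun hg hab => hab _ (Or.inl hg), ?_⟩
    intro c b i j hne B hB
    have hreduce : ∀ T : Fin u → Fin u → Fin (N₀ + 1) × Fin u → Prop,
        (∀ y y', Large (d / 400 / 2) (T y y') → Γ (c, i, y) (b, j, y')) →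
        (∀ A B : Finset (Fin u), min ε 1 * Fintype.card (Fin u) ≤ #A →
          min ε 1 * Fintype.card (Fin u) ≤ #B →
          d / 400 * (#A * #B * Fintype.card (Fin (N₀ + 1) × Fin u)) ≤
            ∑ a ∈ A, ∑ b ∈ B, (Nat.card {z // T a b z} : ℝ)) →
        (Nat.card {y // (Nat.card {y' // y' ∈ B ∧ Γ (c, i, y) (b, j, y')} : ℝ) <
          d / 400 / 2 * #B} : ℝ) ≤ min ε 1 * Fintype.card (Fin u) := by
      intro T hT hsum
      refine le_trans ?_ (card_poor_le (by positivity) hγ hsum B hB)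
      refine Nat.cast_le.2 (Nat.card_le_card_of_injective (Subtype.map id fun y hy => ?_)
        (Subtype.map_injective _ Function.injective_id))
      refine lt_of_le_of_lt (Nat.cast_le.2 (Nat.card_le_card_of_injective
        (Subtype.map id fun y' hy' => ?_) (Subtype.map_injective _ Function.injective_id))) hy
      exact ⟨hy'.1, hT y y' hy'.2⟩
    by_cases hg : ∃ g, (par g = some (c, b) ∨ par g = some (b, c)) ∧ c < L ∧ b < L ∧ g < L
    · obtain ⟨g, hg, hc, hb, hgL⟩ := hg
      have hcg : c ≠ g ∧ b ≠ g := by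
        rcases hg with hg | hg
        · have h1 := hpar.le hg; have h2 := hpar.lt hg; omega
        · have h1 := hpar.le hg; have h2 := hpar.lt hg; omega
      refine hreduce (fun y y' z => R (c, i, y) (b, j, y') (g, z)) ?_ ?_
      · intro y y' hlarge g' hg'
        have : g' = g := by
          have hbc : ∀ g₁ g₂, par g₁ = some (c, b) → par g₂ = some (b, c) → c = b :=
            fun g₁ g₂ h1 h2 => le_antisymm (hpar.le h1) (hpar.le h2)
          rcases hg with hg | hg <;> rcases hg' with hg' | hg'
          · exact huniq _ _ _ hg' hg
          · obtain rfl := hbc _ _ hg hg'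
            exact huniq _ _ _ hg' hg
          · obtain rfl := hbc _ _ hg' hg
            exact huniq _ _ _ hg' hg
          · exact huniq _ _ _ hg' hg
        rw [this]
        exact hlarge
      · intro A B hA hB
        rw [Fintype.card_fin] at hA hB
        have hcount : ∀ a b', (Nat.card {z : Fin (N₀ + 1) × Fin u //
            R (c, i, a) (b, j, b') (g, z)} : ℝ) = ∑ k, (#{y | {φ (⟨c, hc⟩, i) a,
              φ (⟨b, hb⟩, j) b', φ (⟨g, hgL⟩, k) y} ∈ H.edges} : ℝ) := by
          intro a b'
          rw [Nat.card_eq_fintype_card, Fintype.card_subtype, Finset.card_filter,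
            Fintype.sum_prod_type, Nat.cast_sum]
          refine Finset.sum_congr rfl fun k _ => ?_
          rw [← Finset.card_filter]
          congr 2
          ext y
          simp only [R, Finset.mem_filter, Finset.mem_univ, true_and]
          exact ⟨fun h => h hc hb hgL, fun h _ _ _ => h⟩
        have hk : ∀ k, d / 400 * (#A * #B * u) ≤ ∑ a ∈ A, ∑ b' ∈ B,
            (#{y | {φ (⟨c, hc⟩, i) a, φ (⟨b, hb⟩, j) b', φ (⟨g, hgL⟩, k) y} ∈ H.edges} : ℝ) := by
          intro k
          refine hden _ _ _ ?_ ?_ ?_ A B hA hB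
          · simpa [Prod.ext_iff] using hne
          · simp [hcg.1]
          · simp [hcg.2]
        have hall := Finset.sum_le_sum fun k (_ : k ∈ (Finset.univ : Finset (Fin (N₀ + 1)))) => hk k
        rw [Finset.sum_const, nsmul_eq_mul, Finset.card_univ] at hall
        simp only [hcount]
        rw [Finset.sum_congr rfl fun a _ => Finset.sum_comm, Finset.sum_comm]
        refine le_trans (le_of_eq ?_) hall
        rw [Fintype.card_prod, Fintype.card_fin, Fintype.card_fin]
        push_cast
        ring
    · refine hreduce (fun _ _ _ => True) ?_ ?_
      · intro y y' _ g hg'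
        refine (Large.of_forall fun z => ?_).mono (by linarith) fun _ h => h
        intro hc hb hgL
        exact absurd ⟨g, hg', hc, hb, hgL⟩ hg
      · intro A B _ _
        simp only [Nat.card_eq_fintype_card, Fintype.card_subtype_true, Finset.sum_const,
          nsmul_eq_mul]
        rw [← mul_assoc (#A : ℝ)]
        exact mul_le_of_le_one_left (by positivity) (by linarith)
  obtain ⟨κ, hκ, hcopy⟩ := hemb (hhost.mono (min_le_left ε 1))
  obtain ⟨x, hx⟩ := hcopy.exists hp
  have hinj : Function.Injective fun v => φ (⟨f v, hfL v⟩, κ v) (x v) := by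
    intro v w hvw
    have := hφ _ _ _ _ hvw
    simp only [Prod.mk.injEq, Fin.mk.injEq] at this
    exact hκ v w this.1 this.2
  refine ⟨_, hinj, fun e he => ?_⟩
  obtain ⟨v, w, t, rfl, hvwt⟩ := hedge e he
  simpa [Finset.image_insert] using hx.1 v w t hvwt (hfL v) (hfL w) (hfL t)

/-- For a layered 3-graph `F`, the codegree Turán density is zero if and only if
the uniform Turán density is zero. -/
theorem stmt1 {α : Type} [Fintype α] [DecidableEq α] (F : ThreeGraph α)
    (hF : IsLayered F) : piCo F = 0 ↔ piUnif F = 0 := by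
  by_cases hL : LinkOrdered F
  · exact iff_of_true (piCo_eq_zero_of_linkOrdered hF hL) (piUnif_eq_zero_of_linkOrdered hF hL)
  · exact iff_of_false (piCo_pos_of_not_linkOrdered hL).ne' (piUnif_pos_of_not_linkOrdered hL).ne'
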